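/- arXiv:0911.0668 — 5 statements merged into one kernel-verified Lean document; each statement's English description precedes it below -/
import Mathlib

section
/- Let J be an almost complex structure on ℂⁿ that is Hölder continuous with exponent 1/2, i.e. there is a constant K > 0 with ‖J(p) − J(q)‖ ≤ K·|p − q|^{1/2} (operator norm) for all p, q ∈ ℂⁿ. Let u : D → ℂⁿ be a map of class C¹ that is J-holomorphic. If u = 0 on some nonempty open subset of D, then u ≡ 0 on D. -/
open Complex MeasureTheory Metric Filter Asymptotics Topology

/-- The Wirtinger derivative `∂u/∂z̄` of a map `u : ℂ → E`, computed from the real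
Fréchet derivative: `∂u/∂z̄ = (1/2)(∂u/∂x + i • ∂u/∂y)`. -/
noncomputable def dbar {E : Type*} [NormedAddCommGroup E] [NormedSpace ℂ E]
    (u : ℂ → E) (z : ℂ) : E :=
  (2⁻¹ : ℝ) • (fderiv ℝ u z 1 + Complex.I • fderiv ℝ u z Complex.I)


section
variable {H : Type*} [NormedAddCommGroup H] [InnerProductSpace ℝ H]

lemma aux_deriv_swap {a b : ℂ → H} (ha : ContDiff ℝ 1 a) (hb : ContDiff ℝ 1 b)
    (ca : HasCompactSupport a) (cb : HasCompactSupport b) (B : H →L[ℝ] H →L[ℝ] ℝ) (s t : ℂ) :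
    ∫ z, B (fderiv ℝ a z s) (fderiv ℝ b z t) = ∫ z, B (fderiv ℝ a z t) (fderiv ℝ b z s) := by
  have hda : Continuous (fderiv ℝ a) := ha.continuous_fderiv one_ne_zero
  have hdb : Continuous (fderiv ℝ b) := hb.continuous_fderiv one_ne_zero
  have dA : Differentiable ℝ a := ha.differentiable one_ne_zero
  have dB : Differentiable ℝ b := hb.differentiable one_ne_zero
  have hac := ha.continuous
  have hbc := hb.continuous
  obtain ⟨La, hLa⟩ := ha.lipschitzWith_of_hasCompactSupport ca one_ne_zero
  obtain ⟨Lb, hLb⟩ := hb.lipschitzWith_of_hasCompactSupport cb one_ne_zero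
  have zb : ∀ x ∉ tsupport b, b x = 0 ∧ fderiv ℝ b x = 0 := fun x hx =>
    ⟨image_eq_zero_of_notMem_tsupport hx, fderiv_of_notMem_tsupport ℝ hx⟩
  have za : ∀ x ∉ tsupport a, a x = 0 ∧ fderiv ℝ a x = 0 := fun x hx =>
    ⟨image_eq_zero_of_notMem_tsupport hx, fderiv_of_notMem_tsupport ℝ hx⟩
  -- finite difference identity
  have key : ∀ h : ℝ, h ≠ 0 → ∫ z, B (h⁻¹ • (a (z + h • s) - a z)) (fderiv ℝ b z t)
      = ∫ z, B (fderiv ℝ a z t) ((-h)⁻¹ • (b (z + (-h) • s) - b z)) := by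
    intro h hh
    have i1 : Integrable (fun z => B (fderiv ℝ a (z + h • s) t) (b z)) :=
      Continuous.integrable_of_hasCompactSupport (by fun_prop)
        (HasCompactSupport.intro cb fun x hx => by simp [zb x hx])
    have i2 : Integrable (fun z => B (fderiv ℝ a z t) (b z)) :=
      Continuous.integrable_of_hasCompactSupport (by fun_prop)
        (HasCompactSupport.intro cb fun x hx => by simp [zb x hx])
    have i3 : Integrable (fun z => B (fderiv ℝ a z t) (b (z + (-h) • s))) :=
      Continuous.integrable_of_hasCompactSupport (by fun_prop)
        (HasCompactSupport.intro ca fun x hx => by simp [za x hx])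
    have hd : ∀ z, HasFDerivAt (fun z => a (z + h • s) - a z)
        (fderiv ℝ a (z + h • s) - fderiv ℝ a z) z := by
      intro z
      have h1 : HasFDerivAt (fun z => a (z + h • s)) (fderiv ℝ a (z + h • s)) z :=
        (hasFDerivAt_comp_add_right (h • s)).2 (dA _).hasFDerivAt
      exact h1.sub (dA z).hasFDerivAt
    have e1 := integral_bilinear_hasFDerivAt_right_eq_neg_left_of_integrable (μ := volume)
      (f := fun z => a (z + h • s) - a z) (f' := fun z => fderiv ℝ a (z + h • s) - fderiv ℝ a z)
      (g := b) (g' := fderiv ℝ b) (v := t) (B := B)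
      (Continuous.integrable_of_hasCompactSupport (by fun_prop)
        (HasCompactSupport.intro cb fun x hx => by simp [zb x hx]))
      (Continuous.integrable_of_hasCompactSupport (by fun_prop)
        (HasCompactSupport.intro cb fun x hx => by simp [zb x hx]))
      (Continuous.integrable_of_hasCompactSupport (by fun_prop)
        (HasCompactSupport.intro cb fun x hx => by simp [zb x hx]))
      (fun z _ => hd z) (fun z _ => (dB z).hasFDerivAt)
    have e2 : ∫ z, B (fderiv ℝ a (z + h • s) t) (b z)
        = ∫ z, B (fderiv ℝ a z t) (b (z + (-h) • s)) := by
      rw [← integral_add_right_eq_self (μ := volume)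
        (fun z => B (fderiv ℝ a z t) (b (z + (-h) • s))) (h • s)]
      simp
    have e3 : ∫ z, B ((fderiv ℝ a (z + h • s) - fderiv ℝ a z) t) (b z)
        = ∫ z, B (fderiv ℝ a z t) (b (z + (-h) • s) - b z) := by
      simp only [_root_.sub_apply, map_sub]
      rw [integral_sub i1 i2, e2, integral_sub i3 i2]
    simp only [map_smul, _root_.smul_apply]
    simp only [integral_smul]
    rw [e1, e3, inv_neg]; simp
  -- limits
  have lim : ∀ (f : ℂ → H), Differentiable ℝ f → ∀ z, Tendsto (fun h : ℝ => h⁻¹ • (f (z + h • s) - f z))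
      (𝓝[≠] 0) (𝓝 (fderiv ℝ f z s)) := by
    intro f hf z
    have := (hf z).hasFDerivAt.hasLineDerivAt s
    simpa using this.tendsto_slope_zero
  have bd : ∀ (f : ℂ → H) (L : NNReal), LipschitzWith L f → ∀ (h : ℝ) z,
      ‖h⁻¹ • (f (z + h • s) - f z)‖ ≤ L * ‖s‖ := by
    intro f L hL h z
    by_cases hh : h = 0
    · subst hh; simp; positivity
    rw [norm_smul]
    have := hL.dist_le_mul (z + h • s) z
    rw [dist_eq_norm, dist_eq_norm, add_sub_cancel_left, norm_smul] at this
    calc _ ≤ ‖h⁻¹‖ * (L * (‖h‖ * ‖s‖)) := by gcongr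
      _ = _ := by rw [norm_inv]; field_simp
  have l1 : Tendsto (fun h : ℝ => ∫ z, B (h⁻¹ • (a (z + h • s) - a z)) (fderiv ℝ b z t)) (𝓝[≠] 0)
      (𝓝 (∫ z, B (fderiv ℝ a z s) (fderiv ℝ b z t))) := by
    apply tendsto_integral_filter_of_dominated_convergence
      (fun z => ‖B‖ * (La * ‖s‖) * ‖fderiv ℝ b z t‖)
    · exact Eventually.of_forall fun h => Continuous.aestronglyMeasurable (by fun_prop)
    · refine Eventually.of_forall fun h => Eventually.of_forall fun z => ?_
      refine (B.le_opNorm₂ _ _).trans ?_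
      gcongr
      exact bd a La hLa h z
    · exact Continuous.integrable_of_hasCompactSupport (by fun_prop)
        (HasCompactSupport.intro cb fun x hx => by simp [zb x hx])
    · refine Eventually.of_forall fun z => ?_
      exact ((B.flip (fderiv ℝ b z t)).continuous.tendsto _).comp (lim a dA z)
  have l2 : Tendsto (fun h : ℝ => ∫ z, B (fderiv ℝ a z t) (h⁻¹ • (b (z + h • s) - b z))) (𝓝[≠] 0)
      (𝓝 (∫ z, B (fderiv ℝ a z t) (fderiv ℝ b z s))) := by
    apply tendsto_integral_filter_of_dominated_convergence
      (fun z => ‖B‖ * ‖fderiv ℝ a z t‖ * (Lb * ‖s‖))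
    · exact Eventually.of_forall fun h => Continuous.aestronglyMeasurable (by fun_prop)
    · refine Eventually.of_forall fun h => Eventually.of_forall fun z => ?_
      refine (B.le_opNorm₂ _ _).trans ?_
      gcongr
      exact bd b Lb hLb h z
    · exact Continuous.integrable_of_hasCompactSupport (by fun_prop)
        (HasCompactSupport.intro ca fun x hx => by simp [za x hx])
    · refine Eventually.of_forall fun z => ?_
      exact ((B (fderiv ℝ a z t)).continuous.tendsto _).comp (lim b dB z)
  have hneg : Tendsto (fun h : ℝ => -h) (𝓝[≠] 0) (𝓝[≠] 0) := by
    refine tendsto_nhdsWithin_iff.2 ⟨?_, ?_⟩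
    · have : Tendsto (fun h : ℝ => -h) (𝓝 0) (𝓝 0) := by
        simpa using (continuous_neg (G := ℝ)).tendsto 0
      exact this.mono_left nhdsWithin_le_nhds
    · filter_upwards [self_mem_nhdsWithin] with h hh
      simpa using hh
  refine tendsto_nhds_unique l1 ?_
  refine (l2.comp hneg).congr' ?_
  filter_upwards [self_mem_nhdsWithin] with h hh
  exact (key h hh).symm

lemma aux_carleman (J : H →L[ℝ] H) (hskew : ∀ x y, inner ℝ (J x) y = - inner ℝ x (J y))
    (hsq : ∀ x, J (J x) = -x)
    {w : ℂ → H} (hw : ContDiff ℝ 1 w) (cw : HasCompactSupport w)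
    {p q : ℂ → ℝ} (hp : ContDiff ℝ 1 p) (hq : ContDiff ℝ 1 q) :
    ∫ z, (‖fderiv ℝ w z 1 + J (fderiv ℝ w z I) - (p z • w z + q z • J (w z))‖ ^ 2
      - ‖fderiv ℝ w z 1 - J (fderiv ℝ w z I) + (p z • w z - q z • J (w z))‖ ^ 2
      - 2 * (fderiv ℝ p z 1 + fderiv ℝ q z I) * ‖w z‖ ^ 2) = 0 := by
  have hwc := hw.continuous
  have hpc := hp.continuous
  have hqc := hq.continuous
  have hdw : Continuous (fderiv ℝ w) := hw.continuous_fderiv one_ne_zero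
  have hdp : Continuous (fderiv ℝ p) := hp.continuous_fderiv one_ne_zero
  have hdq : Continuous (fderiv ℝ q) := hq.continuous_fderiv one_ne_zero
  have zw : ∀ x ∉ tsupport w, w x = 0 ∧ fderiv ℝ w x = 0 := fun x hx =>
    ⟨image_eq_zero_of_notMem_tsupport hx, fderiv_of_notMem_tsupport ℝ hx⟩
  have dn : ∀ z, HasFDerivAt (fun z => ‖w z‖ ^ 2) (2 • (innerSL ℝ (w z)).comp (fderiv ℝ w z)) z := by
    intro z
    exact ((hw.differentiable one_ne_zero) z).hasFDerivAt.norm_sq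
  have ibp : ∀ (r : ℂ → ℝ), ContDiff ℝ 1 r → ∀ v : ℂ,
      Integrable (fun z => r z * (2 * inner ℝ (w z) (fderiv ℝ w z v))) ∧
      Integrable (fun z => fderiv ℝ r z v * ‖w z‖ ^ 2) ∧
      ∫ z, r z * (2 * inner ℝ (w z) (fderiv ℝ w z v)) = - ∫ z, fderiv ℝ r z v * ‖w z‖ ^ 2 := by
    intro r hr v
    have hrc := hr.continuous
    have hdr : Continuous (fderiv ℝ r) := hr.continuous_fderiv one_ne_zero
    have j1 : Integrable (fun z => r z * (2 * inner ℝ (w z) (fderiv ℝ w z v))) :=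
      Continuous.integrable_of_hasCompactSupport (by fun_prop)
        (HasCompactSupport.intro cw fun x hx => by simp [zw x hx])
    have j2 : Integrable (fun z => fderiv ℝ r z v * ‖w z‖ ^ 2) :=
      Continuous.integrable_of_hasCompactSupport (by fun_prop)
        (HasCompactSupport.intro cw fun x hx => by simp [zw x hx])
    refine ⟨j1, j2, ?_⟩
    have := integral_bilinear_hasFDerivAt_right_eq_neg_left_of_integrable (μ := volume)
      (f := r) (f' := fderiv ℝ r) (g := fun z => ‖w z‖ ^ 2)
      (g' := fun z => 2 • (innerSL ℝ (w z)).comp (fderiv ℝ w z)) (v := v)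
      (B := ContinuousLinearMap.mul ℝ ℝ) (by simpa using j2) (by simpa using j1)
      (Continuous.integrable_of_hasCompactSupport (by fun_prop)
        (HasCompactSupport.intro cw fun x hx => by simp [zw x hx]))
      (fun z _ => ((hr.differentiable one_ne_zero) z).hasFDerivAt) (fun z _ => dn z)
    simpa using this
  obtain ⟨ip1, ip2, ip3⟩ := ibp p hp 1
  obtain ⟨iq1, iq2, iq3⟩ := ibp q hq I
  have jj : ∀ x y, inner ℝ (J x) (J y) = inner ℝ x y := by
    intro x y; rw [hskew, hsq]; simp
  have j0 : ∀ x, inner ℝ (J x) x = 0 := by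
    intro x
    have h1 := hskew x x
    rw [real_inner_comm] at h1
    have h2 := real_inner_comm x (J x)
    linarith
  have i0 : Integrable (fun z => inner ℝ (fderiv ℝ w z 1) (J (fderiv ℝ w z I))) :=
      Continuous.integrable_of_hasCompactSupport (by fun_prop)
        (HasCompactSupport.intro cw fun x hx => by simp [zw x hx])
  have hjac : ∫ z, inner ℝ (fderiv ℝ w z 1) (J (fderiv ℝ w z I)) = 0 := by
    have := aux_deriv_swap hw hw cw cw ((innerSL ℝ).flip.comp J).flip 1 I
    simp only [ContinuousLinearMap.flip_apply, ContinuousLinearMap.comp_apply, innerSL_apply_apply] at this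
    have h2 : ∀ z, inner ℝ (fderiv ℝ w z I) (J (fderiv ℝ w z 1))
        = - inner ℝ (fderiv ℝ w z 1) (J (fderiv ℝ w z I)) := by
      intro z
      rw [← neg_eq_iff_eq_neg, ← hskew, real_inner_comm]
    simp only [h2, integral_neg] at this
    linarith
  have hpt : ∀ z, (‖fderiv ℝ w z 1 + J (fderiv ℝ w z I) - (p z • w z + q z • J (w z))‖ ^ 2
      - ‖fderiv ℝ w z 1 - J (fderiv ℝ w z I) + (p z • w z - q z • J (w z))‖ ^ 2
      - 2 * (fderiv ℝ p z 1 + fderiv ℝ q z I) * ‖w z‖ ^ 2)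
      = 4 * inner ℝ (fderiv ℝ w z 1) (J (fderiv ℝ w z I))
        - 2 * (p z * (2 * inner ℝ (w z) (fderiv ℝ w z 1)) + fderiv ℝ p z 1 * ‖w z‖ ^ 2)
        - 2 * (q z * (2 * inner ℝ (w z) (fderiv ℝ w z I)) + fderiv ℝ q z I * ‖w z‖ ^ 2) := by
    intro z
    set a := fderiv ℝ w z 1
    set b := fderiv ℝ w z I
    have e1 : a + J b - (p z • w z + q z • J (w z)) = (a - q z • J (w z)) + (J b - p z • w z) := by abel
    have e2 : a - J b + (p z • w z - q z • J (w z)) = (a - q z • J (w z)) - (J b - p z • w z) := by abel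
    rw [e1, e2, norm_add_sq_real (a - q z • J (w z)), norm_sub_sq_real (a - q z • J (w z)) (J b - p z • w z)]
    simp only [inner_sub_left, inner_sub_right, inner_smul_left, inner_smul_right, jj, j0]
    rw [real_inner_comm (w z) a]
    simp
    ring
  simp only [hpt]
  rw [integral_sub, integral_sub, integral_const_mul, integral_const_mul, integral_const_mul,
    integral_add ip1 ip2, integral_add iq1 iq2, ip3, iq3, hjac]
  · simp
  · exact i0.const_mul _
  · exact (ip1.add ip2).const_mul _
  · exact (i0.const_mul _).sub ((ip1.add ip2).const_mul _)
  · exact (iq1.add iq2).const_mul _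

end

lemma aux_weight (c : ℂ) (r R A : ℝ) (hr : 0 < r) (hrR : r < R) (hA : 0 ≤ A) :
    ∃ (ψ p q D : ℂ → ℝ) (ψ₁ : ℝ), 0 < ψ₁ ∧ ContDiff ℝ 1 ψ ∧ ContDiff ℝ 1 p ∧ ContDiff ℝ 1 q ∧
      (∀ z, fderiv ℝ ψ z 1 = p z) ∧ (∀ z, fderiv ℝ ψ z I = q z) ∧
      (∀ z, fderiv ℝ p z 1 + fderiv ℝ q z I = D z) ∧
      (∀ z, r ≤ dist z c → dist z c < R → ψ₁ ≤ ψ z ∧ 2 * A * (|p z| + |q z|) + ψ₁ ≤ D z) ∧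
      (∀ z, R ≤ dist z c → ψ z ≤ ψ₁ ∧ 0 ≤ D z) := by
  obtain ⟨l, hl1, hl2⟩ : ∃ l : ℝ, 1 ≤ l ∧ 8 * A * R + 5 ≤ 4 * l * r ^ 2 := by
    refine ⟨1 + (8 * A * R + 5) / (4 * r ^ 2), ?_, ?_⟩
    · have : 0 ≤ (8 * A * R + 5) / (4 * r ^ 2) := by
        have : 0 < R := hr.trans hrR
        positivity
      linarith
    · have : 4 * (1 + (8 * A * R + 5) / (4 * r ^ 2)) * r ^ 2 = 4 * r ^ 2 + (8 * A * R + 5) := by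
        field_simp
      rw [this]; nlinarith
  have hl0 : 0 < l := by linarith
  have hR : 0 < R := hr.trans hrR
  let ψ : ℂ → ℝ := fun z => Real.exp (-l * ((z.re - c.re) ^ 2 + (z.im - c.im) ^ 2))
  let p : ℂ → ℝ := fun z => -2 * l * (z.re - c.re) * ψ z
  let q : ℂ → ℝ := fun z => -2 * l * (z.im - c.im) * ψ z
  have hre : ContDiff ℝ 1 (fun z : ℂ => z.re) := reCLM.contDiff
  have him : ContDiff ℝ 1 (fun z : ℂ => z.im) := imCLM.contDiff
  have cψ : ContDiff ℝ 1 ψ := by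
    refine Real.contDiff_exp.comp ?_
    exact contDiff_const.mul (((hre.sub contDiff_const).pow 2).add ((him.sub contDiff_const).pow 2))
  have cp : ContDiff ℝ 1 p := (contDiff_const.mul (hre.sub contDiff_const)).mul cψ
  have cq : ContDiff ℝ 1 q := (contDiff_const.mul (him.sub contDiff_const)).mul cψ
  have dre : ∀ z, HasFDerivAt (fun z : ℂ => z.re - c.re) reCLM z := fun z =>
    (reCLM.hasFDerivAt).sub_const _
  have dim : ∀ z, HasFDerivAt (fun z : ℂ => z.im - c.im) imCLM z := fun z =>
    (imCLM.hasFDerivAt).sub_const _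
  have dψ := fun z => ((((dre z).pow 2).add ((dim z).pow 2)).const_mul (-l)).exp
  have dψ1 : ∀ z, fderiv ℝ ψ z 1 = p z := by
    intro z
    have h : HasFDerivAt ψ _ z := dψ z
    rw [h.fderiv]
    simp [p, ψ]; ring
  have dψI : ∀ z, fderiv ℝ ψ z I = q z := by
    intro z
    have h : HasFDerivAt ψ _ z := dψ z
    rw [h.fderiv]
    simp [q, ψ]; ring
  have hψd : ∀ z, HasFDerivAt ψ (fderiv ℝ ψ z) z := fun z =>
    ((cψ.differentiable one_ne_zero) z).hasFDerivAt
  have dp1 : ∀ z, fderiv ℝ p z 1 = (-2 * l + 4 * l ^ 2 * (z.re - c.re) ^ 2) * ψ z := by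
    intro z
    have h : HasFDerivAt p _ z := ((dre z).const_mul (-2 * l)).mul (hψd z)
    rw [h.fderiv]
    simp [dψ1, p]; ring
  have dqI : ∀ z, fderiv ℝ q z I = (-2 * l + 4 * l ^ 2 * (z.im - c.im) ^ 2) * ψ z := by
    intro z
    have h : HasFDerivAt q _ z := ((dim z).const_mul (-2 * l)).mul (hψd z)
    rw [h.fderiv]
    simp [dψI, q]; ring
  have hd : ∀ z, (z.re - c.re) ^ 2 + (z.im - c.im) ^ 2 = dist z c ^ 2 := by
    intro z
    rw [Complex.dist_eq, ← Complex.normSq_eq_norm_sq, Complex.normSq_apply]; simp; ring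
  have hψ : ∀ z, ψ z = Real.exp (-l * dist z c ^ 2) := by
    intro z; rw [← hd]
  have pos : ∀ z, 0 < ψ z := fun z => Real.exp_pos _
  refine ⟨ψ, p, q, fun z => l * (4 * l * dist z c ^ 2 - 4) * ψ z, Real.exp (-l * R ^ 2),
    Real.exp_pos _, cψ, cp, cq, dψ1, dψI, ?_, ?_, ?_⟩
  · intro z
    dsimp only
    rw [dp1, dqI, ← hd]; ring
  · intro z h1 h2
    have h3 : Real.exp (-l * R ^ 2) ≤ ψ z := by
      rw [hψ, Real.exp_le_exp]
      have : dist z c ^ 2 ≤ R ^ 2 := by gcongr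
      nlinarith
    refine ⟨h3, ?_⟩
    have hx : |z.re - c.re| ≤ R := by
      apply abs_le_of_sq_le_sq _ hR.le
      have : dist z c ^ 2 ≤ R ^ 2 := by gcongr
      nlinarith [hd z, sq_nonneg (z.im - c.im)]
    have hy : |z.im - c.im| ≤ R := by
      apply abs_le_of_sq_le_sq _ hR.le
      have : dist z c ^ 2 ≤ R ^ 2 := by gcongr
      nlinarith [hd z, sq_nonneg (z.re - c.re)]
    have hpq : |p z| + |q z| ≤ 4 * l * R * ψ z := by
      simp only [p, q, abs_mul, abs_of_pos (pos z), abs_of_pos hl0]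
      norm_num
      have := pos z
      calc _ ≤ 2 * l * R * ψ z + 2 * l * R * ψ z := by gcongr
        _ = _ := by ring
    have h4 : r ^ 2 ≤ dist z c ^ 2 := by gcongr
    have h5 : 8 * A * R + 1 ≤ 4 * l * dist z c ^ 2 - 4 := by nlinarith
    calc 2 * A * (|p z| + |q z|) + Real.exp (-l * R ^ 2)
        ≤ 2 * A * (4 * l * R * ψ z) + 1 * ψ z := by rw [one_mul]; gcongr
      _ ≤ 2 * A * (4 * l * R * ψ z) + l * ψ z := by have := pos z; gcongr
      _ = l * (8 * A * R + 1) * ψ z := by ring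
      _ ≤ l * (4 * l * dist z c ^ 2 - 4) * ψ z := by have := pos z; gcongr
  · intro z h1
    have h4 : R ^ 2 ≤ dist z c ^ 2 := by gcongr
    constructor
    · rw [hψ, Real.exp_le_exp]; nlinarith
    · have h6 : r ^ 2 ≤ R ^ 2 := by gcongr
      have : 0 ≤ 8 * A * R := by positivity
      have h5 : 0 ≤ 4 * l * dist z c ^ 2 - 4 := by nlinarith
      have := pos z
      positivity

section
variable {H : Type*} [NormedAddCommGroup H] [InnerProductSpace ℝ H]

lemma aux_carleman_weighted (J : H →L[ℝ] H) (hskew : ∀ x y, inner ℝ (J x) y = - inner ℝ x (J y))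
    (hsq : ∀ x, J (J x) = -x)
    {v : ℂ → H} (hv : ContDiff ℝ 1 v) (cv : HasCompactSupport v)
    {φ p q : ℂ → ℝ} (hφ : ContDiff ℝ 1 φ) (hp : ContDiff ℝ 1 p) (hq : ContDiff ℝ 1 q)
    (h1 : ∀ z, fderiv ℝ φ z 1 = p z) (h2 : ∀ z, fderiv ℝ φ z I = q z) :
    ∫ z, Real.exp (2 * φ z) * (‖fderiv ℝ v z 1 + J (fderiv ℝ v z I)‖ ^ 2
      - ‖fderiv ℝ v z 1 - J (fderiv ℝ v z I) + (2 : ℝ) • (p z • v z - q z • J (v z))‖ ^ 2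
      - 2 * (fderiv ℝ p z 1 + fderiv ℝ q z I) * ‖v z‖ ^ 2) = 0 := by
  have hw : ContDiff ℝ 1 (fun z => Real.exp (φ z) • v z) := (Real.contDiff_exp.comp hφ).smul hv
  have cw : HasCompactSupport (fun z => Real.exp (φ z) • v z) := cv.smul_left
  rw [← aux_carleman J hskew hsq hw cw hp hq]
  congr 1
  ext z
  have hd : HasFDerivAt (fun z => Real.exp (φ z) • v z) _ z :=
    (((hφ.differentiable one_ne_zero) z).hasFDerivAt.exp).smul
      ((hv.differentiable one_ne_zero) z).hasFDerivAt
  have e1 : fderiv ℝ (fun z => Real.exp (φ z) • v z) z 1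
      = Real.exp (φ z) • (fderiv ℝ v z 1 + p z • v z) := by
    rw [hd.fderiv]; simp [h1, smul_smul]
  have e2 : fderiv ℝ (fun z => Real.exp (φ z) • v z) z I
      = Real.exp (φ z) • (fderiv ℝ v z I + q z • v z) := by
    rw [hd.fderiv]; simp [h2, smul_smul]
  rw [e1, e2]
  have e3 : Real.exp (φ z) • (fderiv ℝ v z 1 + p z • v z)
      + J (Real.exp (φ z) • (fderiv ℝ v z I + q z • v z))
      - (p z • Real.exp (φ z) • v z + q z • J (Real.exp (φ z) • v z))
      = Real.exp (φ z) • (fderiv ℝ v z 1 + J (fderiv ℝ v z I)) := by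
    simp only [map_smul, map_add]; module
  have e4 : Real.exp (φ z) • (fderiv ℝ v z 1 + p z • v z)
      - J (Real.exp (φ z) • (fderiv ℝ v z I + q z • v z))
      + (p z • Real.exp (φ z) • v z - q z • J (Real.exp (φ z) • v z))
      = Real.exp (φ z) • (fderiv ℝ v z 1 - J (fderiv ℝ v z I)
        + (2 : ℝ) • (p z • v z - q z • J (v z))) := by
    simp only [map_smul, map_add]; module
  rw [e3, e4, norm_smul, norm_smul, norm_smul, Real.norm_of_nonneg (Real.exp_pos _).le, two_mul,
    Real.exp_add]
  ring

lemma aux_step (J : H →L[ℝ] H) (hskew : ∀ x y, inner ℝ (J x) y = - inner ℝ x (J y))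
    (hsq : ∀ x, J (J x) = -x) (f : ℂ → H) (c : ℂ) (r R R' A : ℝ) (hr : 0 < r) (hrR : r < R)
    (hRR : R < R') (hA : 0 ≤ A) (hf : ContDiffOn ℝ 1 f (ball c R'))
    (h0 : ∀ z ∈ ball c r, f z = 0)
    (hineq : ∀ z ∈ ball c R', ‖fderiv ℝ f z 1 + J (fderiv ℝ f z I)‖ ^ 2 ≤
      A * (‖f z‖ * ‖fderiv ℝ f z 1 - J (fderiv ℝ f z I)‖ + ‖f z‖ ^ 2)) :
    ∀ z ∈ ball c R, f z = 0 := by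
  intro z₀ hz₀
  by_contra hne
  have jn : ∀ x, ‖J x‖ = ‖x‖ := by
    intro x
    have : ‖J x‖ ^ 2 = ‖x‖ ^ 2 := by
      rw [← real_inner_self_eq_norm_sq, hskew, hsq]; simp
    exact (sq_eq_sq₀ (norm_nonneg _) (norm_nonneg _)).1 this
  have hR : 0 < R := hr.trans hrR
  let χ : ContDiffBump c := ⟨R, (R + R') / 2, hR, by linarith⟩
  obtain ⟨ρ, hρ1, hρ2⟩ := exists_between (show max (dist z₀ c) 0 < R from max_lt hz₀ hR)
  let η : ContDiffBump c := ⟨ρ, R, (le_max_right _ _).trans_lt hρ1, hρ2⟩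
  let v : ℂ → H := fun z => χ z • f z
  have hv : ContDiff ℝ 1 v := by
    rw [contDiff_iff_contDiffAt]
    intro z
    by_cases hz : z ∈ ball c R'
    · exact (χ.contDiff.contDiffAt).smul (hf.contDiffAt (isOpen_ball.mem_nhds hz))
    · have hz' : z ∉ tsupport χ := by
        rw [χ.tsupport_eq]
        simp only [mem_ball, not_lt] at hz
        simp only [mem_closedBall, not_le, χ]
        linarith
      have : v =ᶠ[𝓝 z] fun _ => 0 := by
        filter_upwards [(notMem_tsupport_iff_eventuallyEq.1 hz')] with y hy
        simp [v, hy]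
      exact contDiffAt_const.congr_of_eventuallyEq this
  have cv : HasCompactSupport v := χ.hasCompactSupport.smul_right
  have hvc := hv.continuous
  have hdv : Continuous (fderiv ℝ v) := hv.continuous_fderiv one_ne_zero
  have zv : ∀ x ∉ tsupport v, v x = 0 ∧ fderiv ℝ v x = 0 := fun x hx =>
    ⟨image_eq_zero_of_notMem_tsupport hx, fderiv_of_notMem_tsupport ℝ hx⟩
  have vin : ∀ z ∈ ball c R, v z = f z ∧ fderiv ℝ v z = fderiv ℝ f z := by
    intro z hz
    have : v =ᶠ[𝓝 z] f := by
      filter_upwards [isOpen_ball.mem_nhds hz] with y hy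
      simp only [v]
      rw [χ.one_of_mem_closedBall (ball_subset_closedBall hy), one_smul]
    exact ⟨this.eq_of_nhds, this.fderiv_eq⟩
  have vr : ∀ z ∈ ball c r, v z = 0 ∧ fderiv ℝ v z = 0 := by
    intro z hz
    have : v =ᶠ[𝓝 z] fun _ => 0 := by
      filter_upwards [isOpen_ball.mem_nhds hz] with y hy
      simp [v, h0 y hy]
    refine ⟨this.eq_of_nhds, ?_⟩
    rw [this.fderiv_eq]; simp
  obtain ⟨ψ, p, q, D, ψ₁, hψ1, cψ, cp, cq, dψ1, dψI, hD, hin, hout⟩ := aux_weight c r R A hr hrR hA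
  have cDD : Continuous D := by
    have : D = fun z => fderiv ℝ p z 1 + fderiv ℝ q z I := by ext z; rw [hD]
    rw [this]
    have := cp.continuous_fderiv one_ne_zero
    have := cq.continuous_fderiv one_ne_zero
    fun_prop
  have cψ' := cψ.continuous
  have cp' := cp.continuous
  have cq' := cq.continuous
  let X : ℂ → ℝ := fun z => ‖fderiv ℝ v z 1 + J (fderiv ℝ v z I)‖ ^ 2
  let g : ℂ → ℝ := fun z => η z * ‖v z‖ ^ 2
  have cX : Continuous X := by fun_prop
  have hη : Continuous η := η.continuous
  have cg : Continuous g := by fun_prop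
  have sX : HasCompactSupport X := HasCompactSupport.intro cv fun x hx => by simp [X, zv x hx]
  have sg : HasCompactSupport g := HasCompactSupport.intro cv fun x hx => by simp [g, zv x hx]
  have iX : Integrable X := cX.integrable_of_hasCompactSupport sX
  have ig : Integrable g := cg.integrable_of_hasCompactSupport sg
  have gpos : 0 < ∫ z, g z := by
    refine cg.integral_pos_of_hasCompactSupport_nonneg_nonzero sg
      (fun z => mul_nonneg η.nonneg (by positivity)) (x := z₀) ?_
    have h1 : η z₀ = 1 := η.one_of_mem_closedBall (by
      simp only [mem_closedBall, η]; exact ((le_max_left _ _).trans_lt hρ1).le)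
    simp only [g, h1, (vin z₀ hz₀).1, one_mul]
    exact pow_ne_zero _ (norm_ne_zero_iff.2 hne)
  have main : ∀ τ : ℝ, 0 < τ → A ^ 2 + A ≤ τ * ψ₁ → τ * ψ₁ * ∫ z, g z ≤ ∫ z, X z := by
    intro τ hτ hτA
    have dp := fun z => ((cp.differentiable one_ne_zero) z)
    have dq := fun z => ((cq.differentiable one_ne_zero) z)
    have dpsi := fun z => ((cψ.differentiable one_ne_zero) z)
    have C := aux_carleman_weighted J hskew hsq hv cv (φ := fun z => τ * ψ z)
      (p := fun z => τ * p z) (q := fun z => τ * q z) (contDiff_const.mul cψ)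
      (contDiff_const.mul cp) (contDiff_const.mul cq)
      (fun z => by rw [fderiv_const_mul (dpsi z)]; simp [dψ1])
      (fun z => by rw [fderiv_const_mul (dpsi z)]; simp [dψI])
    have hD' : ∀ z, fderiv ℝ (fun z => τ * p z) z 1 + fderiv ℝ (fun z => τ * q z) z I = τ * D z := by
      intro z
      rw [fderiv_const_mul (dp z), fderiv_const_mul (dq z), ← hD]; simp; ring
    simp only [hD'] at C
    have hle : ∫ z, Real.exp (2 * (τ * ψ z)) * (‖fderiv ℝ v z 1 + J (fderiv ℝ v z I)‖ ^ 2
      - ‖fderiv ℝ v z 1 - J (fderiv ℝ v z I)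
        + (2 : ℝ) • ((τ * p z) • v z - (τ * q z) • J (v z))‖ ^ 2
      - 2 * (τ * D z) * ‖v z‖ ^ 2) ≤ ∫ z, Real.exp (2 * (τ * ψ₁)) * (X z - τ * ψ₁ * g z) := by
      apply integral_mono
      · exact Continuous.integrable_of_hasCompactSupport (by fun_prop)
          (HasCompactSupport.intro cv fun x hx => by simp [zv x hx])
      · exact (iX.sub (ig.const_mul _)).const_mul _
      intro z
      dsimp only
      rcases lt_or_ge (dist z c) r with hz | hz
      · simp [X, g, vr z hz]
      rcases lt_or_ge (dist z c) R with hz' | hz'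
      · obtain ⟨w1, w2⟩ := hin z hz hz'
        obtain ⟨w3, w4⟩ := vin z hz'
        have hi := hineq z (ball_subset_ball hRR.le hz')
        rw [← w3, ← w4] at hi
        set G := fderiv ℝ v z 1 - J (fderiv ℝ v z I) with hG
        set T := G + (2 : ℝ) • ((τ * p z) • v z - (τ * q z) • J (v z)) with hT
        have hGT : ‖G‖ ≤ ‖T‖ + 2 * τ * (|p z| + |q z|) * ‖v z‖ := by
          have e : G = T - (2 : ℝ) • ((τ * p z) • v z - (τ * q z) • J (v z)) := by rw [hT]; abel
          rw [e]
          refine (norm_sub_le _ _).trans ?_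
          gcongr
          rw [norm_smul]
          have := norm_sub_le ((τ * p z) • v z) ((τ * q z) • J (v z))
          rw [norm_smul (τ * p z) (v z), norm_smul (τ * q z) (J (v z)), jn, norm_mul, norm_mul, Real.norm_of_nonneg hτ.le,
            Real.norm_eq_abs, Real.norm_eq_abs] at this
          rw [Real.norm_of_nonneg zero_le_two]
          linarith
        have hgle : g z ≤ ‖v z‖ ^ 2 := by
          have := η.le_one (x := z)
          have h3 : 0 ≤ ‖v z‖ ^ 2 := by positivity
          simp only [g]; nlinarith
        have hX0 : 0 ≤ X z := by positivity
        set N := ‖v z‖ with hN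
        have hN0 : 0 ≤ N := norm_nonneg _
        set S := |p z| + |q z| with hS
        have hS0 : 0 ≤ S := by positivity
        have hX : X z ≤ A * (N * ‖G‖ + N ^ 2) := hi
        have hb : X z - ‖T‖ ^ 2 - 2 * (τ * D z) * N ^ 2 ≤ - (τ * ψ₁ * g z) := by
          have k1 : A * (N * ‖G‖) ≤ A * (N * (‖T‖ + 2 * τ * S * N)) := by gcongr
          have k2 : τ * (2 * A * S + ψ₁) * N ^ 2 ≤ τ * D z * N ^ 2 := by gcongr
          have k3 : (A ^ 2 + A) * N ^ 2 ≤ τ * ψ₁ * N ^ 2 := by gcongr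
          have k4 : τ * ψ₁ * g z ≤ τ * ψ₁ * N ^ 2 := by gcongr
          have k5 : A * N * ‖T‖ ≤ ‖T‖ ^ 2 + A ^ 2 * N ^ 2 := by
            nlinarith [sq_nonneg (A * N - ‖T‖), sq_nonneg (A * N), sq_nonneg ‖T‖]
          have k6 : 0 ≤ τ * (2 * A * S) * N ^ 2 := by positivity
          nlinarith
        have hgn : 0 ≤ τ * ψ₁ * g z := by
          have : 0 ≤ g z := mul_nonneg η.nonneg (by positivity)
          positivity
        calc _ ≤ Real.exp (2 * (τ * ψ z)) * (- (τ * ψ₁ * g z)) := by gcongr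
          _ ≤ Real.exp (2 * (τ * ψ₁)) * (- (τ * ψ₁ * g z)) := by
            apply mul_le_mul_of_nonpos_right _ (by linarith)
            gcongr
          _ ≤ _ := by gcongr; linarith
      · obtain ⟨w1, w2⟩ := hout z hz'
        have hη0 : g z = 0 := by
          have : η z = 0 := η.zero_of_le_dist hz'
          simp [g, this]
        rw [hη0, mul_zero, sub_zero]
        have hX0 : 0 ≤ X z := by positivity
        calc _ ≤ Real.exp (2 * (τ * ψ z)) * X z := by
              gcongr
              have : 0 ≤ 2 * (τ * D z) * ‖v z‖ ^ 2 := by positivity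
              have h5 := sq_nonneg ‖fderiv ℝ v z 1 - J (fderiv ℝ v z I)
                + (2 : ℝ) • ((τ * p z) • v z - (τ * q z) • J (v z))‖
              simp only [X]
              linarith
          _ ≤ _ := by gcongr
    rw [C, integral_const_mul, integral_sub iX (ig.const_mul _), integral_const_mul] at hle
    have h6 := (mul_nonneg_iff_of_pos_left (Real.exp_pos _)).1 hle
    linarith
  have X0 : 0 ≤ ∫ z, X z := integral_nonneg fun z => by positivity
  set Gi := ∫ z, g z
  set Xi := ∫ z, X z
  have m := main ((A ^ 2 + A + 1 + (Xi + 1) / Gi) / ψ₁) (by positivity) (by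
    have : 0 ≤ (Xi + 1) / Gi := by positivity
    field_simp
    field_simp at this
    nlinarith)
  rw [div_mul_cancel₀ _ hψ1.ne', add_mul, div_mul_cancel₀ _ gpos.ne'] at m
  have : 0 ≤ (A ^ 2 + A + 1) * Gi := by positivity
  linarith

end

lemma aux_sq (Y G N B : ℝ) (h : Y ^ 2 ≤ B * (N * (Y + G)))  (hB : 0 ≤ B) (hN : 0 ≤ N) (hG : 0 ≤ G) :
    Y ^ 2 ≤ (2 * B + B ^ 2) * (N * G + N ^ 2) := by
  have h1 : Y ^ 2 ≤ 2 * B * (N * G) + B ^ 2 * N ^ 2 := by nlinarith [sq_nonneg (Y - B * N)]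
  have h2 : 0 ≤ B ^ 2 * (N * G) := by positivity
  have h3 : 0 ≤ 2 * B * N ^ 2 := by positivity
  nlinarith

lemma aux_ball (n : ℕ)
    (J : EuclideanSpace ℂ (Fin n) →
      (EuclideanSpace ℂ (Fin n) →L[ℝ] EuclideanSpace ℂ (Fin n)))
    (K : ℝ) (hK : 0 < K)
    (hJsq : ∀ p x, J p (J p x) = -x)
    (hHolder : ∀ p q, ‖J p - J q‖ ≤ K * ‖p - q‖ ^ ((1 : ℝ) / 2))
    (u : ℂ → EuclideanSpace ℂ (Fin n))
    (hu : ContDiffOn ℝ 1 u (ball (0 : ℂ) 1))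
    (hJhol : ∀ z ∈ ball (0 : ℂ) 1,
      fderiv ℝ u z Complex.I = J (u z) (fderiv ℝ u z 1))
    (c : ℂ) (r R R' : ℝ) (hr : 0 < r) (hrR : r < R) (hRR : R < R')
    (hsub : closedBall c R' ⊆ ball 0 1) (h0 : ∀ z ∈ ball c r, u z = 0) :
    ∀ z ∈ ball c R, u z = 0 := by
  let E := EuclideanSpace ℂ (Fin n)
  let e := (WithLp.prodContinuousLinearEquiv 2 ℝ E E).symm
  let JH : WithLp 2 (E × E) →L[ℝ] WithLp 2 (E × E) :=
    (e : E × E →L[ℝ] WithLp 2 (E × E)).comp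
      (((-(ContinuousLinearMap.snd ℝ E E)).prod (ContinuousLinearMap.fst ℝ E E)).comp
        (e.symm : WithLp 2 (E × E) →L[ℝ] E × E))
  let F : E →L[ℝ] WithLp 2 (E × E) := (e : E × E →L[ℝ] WithLp 2 (E × E)).comp
    ((ContinuousLinearMap.id ℝ E).prod (-(J 0)))
  have hskew : ∀ x y, inner ℝ (JH x) y = - inner ℝ x (JH y) := by
    intro x y
    simp [JH, e, WithLp.prod_inner_apply]
  have hsq : ∀ x, JH (JH x) = -x := by
    intro x
    apply (WithLp.prodContinuousLinearEquiv 2 ℝ E E).injective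
    ext <;> simp [JH, e]
  have hF : ∀ x, JH (F x) = F (J 0 x) := by
    intro x
    simp [JH, F, e, hJsq]
    exact ⟨neg_neg _, (neg_neg _).symm⟩
  have hFn : ∀ x, ‖x‖ ≤ ‖F x‖ := by
    intro x
    have : ‖x‖ ^ 2 ≤ ‖F x‖ ^ 2 := by
      rw [WithLp.prod_norm_sq_eq_of_L2]
      simp [F, e]
    exact (sq_le_sq₀ (norm_nonneg _) (norm_nonneg _)).1 this
  have hR : 0 < R := hr.trans hrR
  have hcont : ContinuousOn (fun z => ‖fderiv ℝ u z 1‖) (closedBall c R') :=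
    ((hu.continuousOn_fderiv_of_isOpen isOpen_ball le_rfl).mono hsub).clm_apply
      continuousOn_const |>.norm
  obtain ⟨M, hM⟩ := (isCompact_closedBall c R').bddAbove_image hcont
  have hM' : ∀ z ∈ closedBall c R', ‖fderiv ℝ u z 1‖ ≤ M := fun z hz => hM ⟨z, hz, rfl⟩
  have hM0 : 0 ≤ M := (norm_nonneg _).trans (hM' c (mem_closedBall_self (hR.trans hRR).le))
  set L := ‖F‖ * ‖J 0‖ * K with hL
  have hL0 : 0 ≤ L := by positivity
  have hdiff : ∀ z ∈ ball c R', DifferentiableAt ℝ u z := fun z hz =>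
    (hu.contDiffAt (isOpen_ball.mem_nhds (hsub (ball_subset_closedBall hz)))).differentiableAt
      one_ne_zero
  have key := aux_step JH hskew hsq (fun z => F (u z)) c r R R' (2 * (L ^ 2 * M) + (L ^ 2 * M) ^ 2)
    hr hrR hRR (by positivity)
    (F.contDiff.comp_contDiffOn (hu.mono ((ball_subset_closedBall).trans hsub)))
    (fun z hz => by simp [h0 z hz]) ?_
  · intro z hz
    have h1 := hFn (u z)
    rw [key z hz, norm_zero] at h1
    exact norm_le_zero_iff.1 h1
  intro z hz
  have hd : HasFDerivAt (fun z => F (u z)) (F.comp (fderiv ℝ u z)) z :=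
    F.hasFDerivAt.comp z (hdiff z hz).hasFDerivAt
  rw [hd.fderiv]
  simp only [ContinuousLinearMap.comp_apply, hF]
  have hz1 := hsub (ball_subset_closedBall hz)
  have hh := hJhol z hz1
  have hMz := hM' z (ball_subset_closedBall hz)
  set a := fderiv ℝ u z 1
  set b := fderiv ℝ u z I
  apply aux_sq _ _ _ _ _ (by positivity) (norm_nonneg _) (norm_nonneg _)
  have e1 : F a + F (J 0 b) = F (J 0 ((J (u z) - J 0) a)) := by
    rw [← map_add, hh]
    simp [hJsq, add_comm]
  have e2 : ‖F a + F (J 0 b)‖ ≤ L * ‖u z‖ ^ ((1 : ℝ) / 2) * ‖a‖ := by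
    rw [e1]
    have h3 := hHolder (u z) 0
    rw [sub_zero] at h3
    calc _ ≤ ‖F‖ * (‖J 0‖ * (‖J (u z) - J 0‖ * ‖a‖)) := by
          refine (F.le_opNorm _).trans ?_
          gcongr
          refine ((J 0).le_opNorm _).trans ?_
          gcongr
          exact ContinuousLinearMap.le_opNorm _ _
      _ ≤ ‖F‖ * (‖J 0‖ * ((K * ‖u z‖ ^ ((1 : ℝ) / 2)) * ‖a‖)) := by gcongr
      _ = _ := by rw [hL]; ring
  have e3 : (‖u z‖ ^ ((1 : ℝ) / 2)) ^ 2 = ‖u z‖ := by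
    rw [← Real.sqrt_eq_rpow, Real.sq_sqrt (norm_nonneg _)]
  have e4 : ‖a‖ ≤ ‖F a + F (J 0 b)‖ + ‖F a - F (J 0 b)‖ := by
    have h5 : F a + F a = (F a + F (J 0 b)) + (F a - F (J 0 b)) := by abel
    have h6 := norm_add_le (F a + F (J 0 b)) (F a - F (J 0 b))
    rw [← h5, ← two_smul ℝ (F a), norm_smul, Real.norm_of_nonneg zero_le_two] at h6
    linarith [hFn a, norm_nonneg (F a)]
  calc ‖F a + F (J 0 b)‖ ^ 2 ≤ (L * ‖u z‖ ^ ((1 : ℝ) / 2) * ‖a‖) ^ 2 := by gcongr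
    _ = L ^ 2 * ‖u z‖ * ‖a‖ * ‖a‖ := by rw [mul_pow, mul_pow, e3]; ring
    _ ≤ L ^ 2 * ‖F (u z)‖ * M * (‖F a + F (J 0 b)‖ + ‖F a - F (J 0 b)‖) := by
      have := hFn (u z)
      gcongr
    _ = _ := by ring

/-- Let `J` be an almost complex structure on `ℂⁿ` that is `1/2`-Hölder
continuous.  If a `C¹` `J`-holomorphic map `u : D → ℂⁿ` vanishes on a nonempty open
subset of the unit disc `D`, then `u ≡ 0` on `D`. -/
theorem uniqueness_half_holder_acs (n : ℕ)
    (J : EuclideanSpace ℂ (Fin n) →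
      (EuclideanSpace ℂ (Fin n) →L[ℝ] EuclideanSpace ℂ (Fin n)))
    (K : ℝ) (hK : 0 < K)
    (hJsq : ∀ p x, J p (J p x) = -x)
    (hHolder : ∀ p q, ‖J p - J q‖ ≤ K * ‖p - q‖ ^ ((1 : ℝ) / 2))
    (u : ℂ → EuclideanSpace ℂ (Fin n))
    (hu : ContDiffOn ℝ 1 u (ball (0 : ℂ) 1))
    (hJhol : ∀ z ∈ ball (0 : ℂ) 1,
      fderiv ℝ u z Complex.I = J (u z) (fderiv ℝ u z 1))
    (V : Set ℂ) (hVopen : IsOpen V) (hVne : V.Nonempty)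
    (hVD : V ⊆ ball (0 : ℂ) 1) (hUV : ∀ z ∈ V, u z = 0) :
    ∀ z ∈ ball (0 : ℂ) 1, u z = 0 := by
  let U : Set ℂ := interior {z | u z = 0}
  have hsub : ball (0 : ℂ) 1 ⊆ U := by
    apply (convex_ball (0 : ℂ) 1).isPreconnected.subset_of_closure_inter_subset isOpen_interior
    · obtain ⟨x, hx⟩ := hVne
      exact ⟨x, hVD hx, mem_interior.2 ⟨V, hUV, hVopen, hx⟩⟩
    · rintro q ⟨hq, hq1⟩
      have hq2 : ‖q‖ < 1 := by simpa using hq1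
      set d := (1 - ‖q‖) / 4 with hd
      have hd0 : 0 < d := by rw [hd]; linarith
      obtain ⟨c, hc, hqc⟩ := Metric.mem_closure_iff.1 hq d hd0
      obtain ⟨r, hr, hrs⟩ := Metric.isOpen_iff.1 isOpen_interior c hc
      have hz := aux_ball n J K hK hJsq hHolder u hu hJhol c (min r (d / 2)) d (2 * d)
        (by positivity) ((min_le_right _ _).trans_lt (by linarith)) (by linarith)
        (by
          intro z hz
          rw [mem_closedBall, Complex.dist_eq] at hz
          rw [Complex.dist_eq] at hqc
          rw [mem_ball_zero_iff]
          have h1 : z = (z - c) - (q - c) + q := by ring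
          rw [h1]
          have h2 := norm_add_le ((z - c) - (q - c)) q
          have h3 := norm_sub_le (z - c) (q - c)
          linarith)
        (fun z hz => (interior_subset (s := {z | u z = 0}))
          (hrs (ball_subset_ball (min_le_left _ _) hz)))
      exact mem_interior.2 ⟨ball c d, hz, isOpen_ball, hqc⟩
  intro z hz
  exact (interior_subset (s := {z | u z = 0})) (hsub hz)
end

section
/- There exist a C^∞-smooth map u : D → ℂ² and a function ε : D → [0,∞) with ε(z) → 0 as z → 0, such that: (i) ‖∂u/∂z̄(z)‖ ≤ ε(z)·‖∂u/∂z(z)‖ for all z ∈ D; (ii) u vanishes to infinite order at 0; (iii) 0 is a non-isolated zero of u, i.e. 0 is an accumulation point of the set {z ∈ D \ {0} : u(z) = 0}; (iv) u is not identically 0 on any neighborhood of 0. -/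
open Complex MeasureTheory Metric Filter Asymptotics Topology

/-- The Wirtinger derivative `∂u/∂z = (1/2)(∂u/∂x - i • ∂u/∂y)`. -/
noncomputable def dz {E : Type*} [NormedAddCommGroup E] [NormedSpace ℂ E]
    (u : ℂ → E) (z : ℂ) : E :=
  (2⁻¹ : ℝ) • (fderiv ℝ u z 1 - Complex.I • fderiv ℝ u z Complex.I)

namespace SN

abbrev E2 := EuclideanSpace ℂ (Fin 2)

structure Cut (χ : ℂ → ℂ) : Prop where
  smooth : ContDiff ℝ (⊤ : ℕ∞) χ
  inner : ∀ w : ℂ, ‖w‖ ≤ 1/2 → χ =ᶠ[𝓝 w] fun _ => 0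
  outer : ∀ w : ℂ, 32 ≤ ‖w‖ → χ =ᶠ[𝓝 w] fun _ => 0
  plateau : ∀ w : ℂ, 1 ≤ ‖w‖ → ‖w‖ ≤ 16 → χ =ᶠ[𝓝 w] fun _ => 1

lemma exists_cut : ∃ χ : ℂ → ℂ, Cut χ := by
  let f : ContDiffBump (0 : ℂ) := ⟨20, 31, by norm_num, by norm_num⟩
  let g : ContDiffBump (0 : ℂ) := ⟨5/8, 3/4, by norm_num, by norm_num⟩
  have ho : ∀ (h : ContDiffBump (0 : ℂ)) (w : ℂ), h.rOut < ‖w‖ → ∀ᶠ x in 𝓝 w, h x = 0 := by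
    intro h w hw
    have : ∀ᶠ x in 𝓝 w, h.rOut < ‖x‖ := continuous_norm.continuousAt.eventually_const_lt hw
    filter_upwards [this] with x hx
    exact h.zero_of_le_dist (by simpa using hx.le)
  have hi : ∀ (h : ContDiffBump (0 : ℂ)) (w : ℂ), ‖w‖ < h.rIn → ∀ᶠ x in 𝓝 w, h x = 1 := by
    intro h w hw
    exact h.eventuallyEq_one_of_mem_ball (by simpa using hw)
  refine ⟨fun w => ((f w * (1 - g w) : ℝ) : ℂ), ?_, ?_, ?_, ?_⟩
  · exact Complex.ofRealCLM.contDiff.comp (f.contDiff.mul (contDiff_const.sub g.contDiff))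
  · intro w hw
    filter_upwards [hi g w (by show ‖w‖ < 5/8; linarith)] with x hx
    simp [hx]
  · intro w hw
    filter_upwards [ho f w (by show 31 < ‖w‖; linarith)] with x hx
    simp [hx]
  · intro w hw hw'
    filter_upwards [ho g w (by show 3/4 < ‖w‖; linarith), hi f w (by show ‖w‖ < 20; linarith)]
      with x hx hx'
    simp [hx, hx']

noncomputable def c : ℕ → ℝ
  | 0 => 1
  | (i+1) => c i / 16 ^ (i+2)

lemma c_pos (i : ℕ) : 0 < c i := by
  induction i with
  | zero => simp [c]
  | succ i ih => rw [c]; positivity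

lemma c_summable (B : ℝ) (hB : 0 < B) : Summable fun i => c i * B ^ i := by
  refine summable_of_ratio_test_tendsto_lt_one (l := 0) (by norm_num)
    (Eventually.of_forall fun i => (mul_pos (c_pos i) (pow_pos hB i)).ne') ?_
  have h1 : Tendsto (fun i : ℕ => (B / 256) * (1/16 : ℝ) ^ i) atTop (𝓝 ((B/256) * 0)) :=
    (tendsto_pow_atTop_nhds_zero_of_lt_one (by norm_num) (by norm_num)).const_mul _
  rw [mul_zero] at h1
  refine h1.congr fun i => ?_
  have hc := c_pos i
  rw [Real.norm_of_nonneg (mul_pos (c_pos _) (pow_pos hB _)).le,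
    Real.norm_of_nonneg (mul_pos (c_pos _) (pow_pos hB _)).le, c]
  have : (0:ℝ) < 16 ^ i := by positivity
  rw [one_div, inv_pow]
  field_simp
  ring

noncomputable def e (i : ℕ) : E2 := EuclideanSpace.single (Fin.ofNat 2 i) 1

noncomputable def psi (χ : ℂ → ℂ) (i : ℕ) (w : ℂ) : ℂ := (χ w * w^2 * (w - 4)) * w ^ i

noncomputable def phi (χ : ℂ → ℂ) (i : ℕ) (z : ℂ) : ℂ := (c i : ℂ) * psi χ i ((16 ^ i : ℝ) • z)

noncomputable def T (χ : ℂ → ℂ) (i : ℕ) (z : ℂ) : E2 := phi χ i z • e i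

noncomputable def U (χ : ℂ → ℂ) (z : ℂ) : E2 := ∑' i, T χ i z

lemma norm_e (i : ℕ) : ‖e i‖ = 1 := by simp [e]

variable {χ : ℂ → ℂ}

lemma psi_smooth (h : Cut χ) (i : ℕ) : ContDiff ℝ (⊤ : ℕ∞) (psi χ i) := by
  have := h.smooth
  unfold psi
  fun_prop

lemma phi_smooth (h : Cut χ) (i : ℕ) : ContDiff ℝ (⊤ : ℕ∞) (phi χ i) := by
  have := psi_smooth h i
  unfold phi
  fun_prop

lemma T_smooth (h : Cut χ) (i : ℕ) : ContDiff ℝ (⊤ : ℕ∞) (T χ i) := by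
  have := phi_smooth h i
  unfold T
  fun_prop

lemma bound_ball {f : ℂ → ℂ} (hf : ContDiff ℝ (⊤ : ℕ∞) f) (m : ℕ) :
    ∃ C : ℝ, 0 < C ∧ ∀ j ≤ m, ∀ w : ℂ, ‖w‖ ≤ 32 → ‖iteratedFDeriv ℝ j f w‖ ≤ C := by
  have h1 : ∀ j : ℕ, ∃ C : ℝ, ∀ w ∈ closedBall (0:ℂ) 32, ‖iteratedFDeriv ℝ j f w‖ ≤ C := by
    intro j
    exact (isCompact_closedBall (0:ℂ) 32).exists_bound_of_continuousOn
      (hf.continuous_iteratedFDeriv (by exact_mod_cast le_top)).continuousOn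
  choose C hC using h1
  refine ⟨1 + ∑ j ∈ Finset.range (m+1), |C j|, ?_, ?_⟩
  · have : 0 ≤ ∑ j ∈ Finset.range (m+1), |C j| := Finset.sum_nonneg fun _ _ => abs_nonneg _
    linarith
  · intro j hj w hw
    have h2 := hC j w (by simpa using hw)
    have h3 : |C j| ≤ ∑ j ∈ Finset.range (m+1), |C j| :=
      Finset.single_le_sum (f := fun j => |C j|) (fun _ _ => abs_nonneg _)
        (Finset.mem_range.2 (by omega))
    have := le_abs_self (C j)
    linarith

lemma psi_bound (h : Cut χ) (m : ℕ) :
    ∃ A B : ℝ, 0 < A ∧ 0 < B ∧ ∀ i, ∀ j ≤ m, ∀ w : ℂ, ‖iteratedFDeriv ℝ j (psi χ i) w‖ ≤ A * B ^ i := by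
  have hs := h.smooth
  obtain ⟨A, hA, hA'⟩ := bound_ball (psi_smooth h 0) m
  obtain ⟨C, hC, hC'⟩ := bound_ball (f := fun w : ℂ => w) contDiff_id m
  refine ⟨A, 2 ^ m * C, hA, by positivity, ?_⟩
  intro i j hj w
  rcases le_or_gt ‖w‖ 32 with hw | hw
  · induction i generalizing j with
    | zero => simpa using hA' j hj w hw
    | succ i ih =>
      have e1 : psi χ (i+1) = fun y => psi χ i y * (fun w : ℂ => w) y := by
        funext y; simp only [psi]; ring
      rw [e1]
      refine (norm_iteratedFDeriv_mul_le (psi_smooth h i) contDiff_id w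
        (n := j) (by exact_mod_cast le_top)).trans ?_
      have : ∀ l ∈ Finset.range (j+1), (j.choose l : ℝ) * ‖iteratedFDeriv ℝ l (psi χ i) w‖ *
          ‖iteratedFDeriv ℝ (j - l) (fun w : ℂ => w) w‖ ≤
          (j.choose l : ℝ) * (A * (2 ^ m * C) ^ i * C) := by
        intro l hl
        rw [Finset.mem_range] at hl
        rw [mul_assoc]
        have a1 := ih l (by omega)
        have a2 := hC' (j-l) (by omega) w hw
        gcongr
      refine (Finset.sum_le_sum this).trans ?_
      rw [← Finset.sum_mul]
      have : ∑ l ∈ Finset.range (j+1), (j.choose l : ℝ) = 2 ^ j := by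
        exact_mod_cast Nat.sum_range_choose j
      rw [this]
      have : (2:ℝ) ^ j ≤ 2 ^ m := pow_le_pow_right₀ (by norm_num) hj
      calc (2:ℝ)^j * (A * (2 ^ m * C) ^ i * C) ≤ 2^m * (A * (2 ^ m * C) ^ i * C) := by gcongr
        _ = _ := by ring
  · have : psi χ i =ᶠ[𝓝 w] fun _ => 0 := by
      filter_upwards [h.outer w hw.le] with x hx
      simp [psi, hx]
    rw [(this.iteratedFDeriv ℝ j).eq_of_nhds]
    have : iteratedFDeriv ℝ j (fun _ : ℂ => (0:ℂ)) w = 0 := by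
      simp
    rw [this, norm_zero]; positivity

lemma T_bound (h : Cut χ) (m : ℕ) :
    ∃ v : ℕ → ℝ, Summable v ∧ ∀ i z, ‖iteratedFDeriv ℝ m (T χ i) z‖ ≤ v i := by
  obtain ⟨A, B, hA, hB, hb⟩ := psi_bound h m
  refine ⟨fun i => A * (c i * (B * 16 ^ m) ^ i), (c_summable _ (by positivity)).mul_left _, ?_⟩
  intro i z
  let L : ℂ →L[ℝ] E2 := (ContinuousLinearMap.toSpanSingleton ℂ ((c i : ℂ) • e i)).restrictScalars ℝ
  have hL : ‖L‖ ≤ c i := by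
    refine ContinuousLinearMap.opNorm_le_bound _ (c_pos i).le fun x => ?_
    simp [L, norm_smul, norm_e, abs_of_pos (c_pos i), mul_comm]
  have e1 : T χ i = L ∘ fun z => psi χ i ((16 ^ i : ℝ) • z) := by
    funext y
    simp only [T, phi, L, Function.comp]
    rw [ContinuousLinearMap.coe_restrictScalars', ContinuousLinearMap.toSpanSingleton_apply,
      smul_smul, mul_comm]
  have hps : ContDiff ℝ (⊤ : ℕ∞) fun z => psi χ i ((16 ^ i : ℝ) • z) := by
    have := psi_smooth h i
    fun_prop
  rw [e1]
  refine (L.norm_iteratedFDeriv_comp_left (n := m) (N := (⊤ : ℕ∞)) hps.contDiffAt (by exact_mod_cast le_top)).trans ?_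
  have e2 := iteratedFDeriv_comp_const_smul (𝕜 := ℝ) (i := m) (16 ^ i : ℝ) ((psi_smooth h i).of_le (by exact_mod_cast le_top))
  rw [e2]
  simp only [norm_smul, norm_pow, Real.norm_ofNat]
  calc ‖L‖ * (((16:ℝ) ^ i) ^ m * ‖iteratedFDeriv ℝ m (psi χ i) ((16 ^ i : ℝ) • z)‖)
      ≤ c i * ((16 ^ i) ^ m * (A * B ^ i)) := by
        have := hb i m le_rfl ((16 ^ i : ℝ) • z)
        have := c_pos i
        gcongr
    _ = _ := by rw [mul_pow, ← pow_mul, ← pow_mul, mul_comm i m]; ring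

lemma U_smooth (h : Cut χ) : ContDiff ℝ (⊤ : ℕ∞) (U χ) := by
  choose v hv hv' using T_bound h
  exact contDiff_tsum (v := v) (fun i => T_smooth h i) (fun k _ => hv k) (fun k i x _ => hv' k i x)

lemma T_summable (h : Cut χ) (z : ℂ) : Summable fun i => T χ i z := by
  obtain ⟨v, hv, hv'⟩ := T_bound h 0
  exact Summable.of_norm_bounded hv fun i => by simpa using hv' i z

lemma fderiv_U (h : Cut χ) (z : ℂ) : fderiv ℝ (U χ) z = ∑' i, fderiv ℝ (T χ i) z := by
  obtain ⟨v, hv, hv'⟩ := T_bound h 1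
  have := fderiv_tsum (𝕜 := ℝ) (f := T χ) (x₀ := 0) hv
    (fun i => (T_smooth h i).differentiable (by simp))
    (fun i x => by rw [← norm_iteratedFDeriv_one]; exact hv' i x) (T_summable h 0)
  exact congrFun this z

lemma psi_zero (h : Cut χ) (i : ℕ) (w : ℂ) (hw : ‖w‖ ≤ 1/2 ∨ 32 ≤ ‖w‖) : psi χ i w = 0 := by
  have : χ w = 0 := by
    rcases hw with hw | hw
    · exact (h.inner w hw).eq_of_nhds
    · exact (h.outer w hw).eq_of_nhds
  simp [psi, this]

lemma norm_sc (i : ℕ) (z : ℂ) : ‖(16 ^ i : ℝ) • z‖ = 16 ^ i * ‖z‖ := by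
  simp [norm_smul]

lemma T_zero (h : Cut χ) (i : ℕ) (z : ℂ) (hw : 16 ^ i * ‖z‖ ≤ 1/2 ∨ 32 ≤ 16 ^ i * ‖z‖) :
    T χ i z = 0 := by
  rw [← norm_sc] at hw
  rw [T, phi, psi_zero h i _ hw]; simp

lemma U_flat (h : Cut χ) (N : ℕ) : U χ =O[𝓝 (0 : ℂ)] fun z : ℂ => ‖z‖ ^ N := by
  obtain ⟨A, B, hA, hB, hb⟩ := psi_bound h 0
  have hs := ((c_summable (B * 16 ^ N) (by positivity)).mul_left (A * 2 ^ N))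
  refine IsBigO.of_bound (∑' i, (A * 2 ^ N) * (c i * (B * 16 ^ N) ^ i)) (Eventually.of_forall fun z => ?_)
  rw [norm_pow, norm_norm]
  refine tsum_of_norm_bounded (hs.hasSum.mul_right (‖z‖ ^ N)) fun i => ?_
  have hc := c_pos i
  rcases le_or_gt (16 ^ i * ‖z‖) (1/2) with hz | hz
  · rw [T_zero h i z (Or.inl hz), norm_zero]; positivity
  · have h1 : ‖psi χ i ((16 ^ i : ℝ) • z)‖ ≤ A * B ^ i := by
      simpa using hb i 0 le_rfl ((16 ^ i : ℝ) • z)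
    have h2 : (1:ℝ) ≤ (2 * (16 ^ i * ‖z‖)) ^ N := one_le_pow₀ (by linarith)
    calc ‖T χ i z‖ = c i * ‖psi χ i ((16 ^ i : ℝ) • z)‖ := by
          simp [T, phi, norm_smul, norm_e, abs_of_pos hc]
      _ ≤ c i * (A * B ^ i) * 1 := by rw [mul_one]; gcongr
      _ ≤ c i * (A * B ^ i) * (2 * (16 ^ i * ‖z‖)) ^ N := by gcongr
      _ = _ := by rw [mul_pow, mul_pow, mul_pow, ← pow_mul, ← pow_mul, mul_comm i N]; ring

lemma U_val (h : Cut χ) (k : ℕ) (z : ℂ) (h1 : 2 ≤ 16 ^ k * ‖z‖) (h2 : 16 ^ k * ‖z‖ ≤ 8) :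
    U χ z = T χ k z := by
  refine tsum_eq_single k fun i hi => T_zero h i z ?_
  rcases lt_or_gt_of_ne hi with hi | hi
  · left
    obtain ⟨d, rfl⟩ := Nat.exists_eq_add_of_lt hi
    have : (1:ℝ) ≤ 16 ^ d := one_le_pow₀ (by norm_num)
    have e1 : (16:ℝ) ^ (i + d + 1) * ‖z‖ = 16 * 16 ^ d * (16 ^ i * ‖z‖) := by ring
    rw [e1] at h2
    have : 0 ≤ 16 ^ i * ‖z‖ := by positivity
    nlinarith
  · right
    obtain ⟨d, rfl⟩ := Nat.exists_eq_add_of_lt hi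
    have : (1:ℝ) ≤ 16 ^ d := one_le_pow₀ (by norm_num)
    have e1 : (16:ℝ) ^ (k + d + 1) * ‖z‖ = 16 * 16 ^ d * (16 ^ k * ‖z‖) := by ring
    rw [e1]
    nlinarith

lemma pt (k : ℕ) (a : ℝ) : (16 ^ k : ℝ) • ((a / 16 ^ k : ℝ) : ℂ) = a := by
  have : (16:ℝ) ^ k * (a / 16 ^ k) = a := by field_simp
  rw [Complex.real_smul, ← Complex.ofReal_mul, this]

lemma U_four (h : Cut χ) (k : ℕ) : U χ ((4 / 16 ^ k : ℝ) : ℂ) = 0 := by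
  have e1 := norm_sc k ((4 / 16 ^ k : ℝ) : ℂ)
  rw [pt] at e1
  simp only [Complex.norm_real] at e1
  norm_num at e1
  rw [U_val h k]
  · simp only [T, phi, pt]; simp [psi]
  all_goals simp only [Complex.norm_real]; norm_num; linarith

lemma U_three (h : Cut χ) (k : ℕ) : U χ ((3 / 16 ^ k : ℝ) : ℂ) ≠ 0 := by
  have e1 := norm_sc k ((3 / 16 ^ k : ℝ) : ℂ)
  rw [pt] at e1
  simp only [Complex.norm_real] at e1
  norm_num at e1
  rw [U_val h k]
  · have h3 : χ ((3:ℝ):ℂ) = 1 := (h.plateau _ (by simp) (by simp; norm_num)).eq_of_nhds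
    have he : e k ≠ 0 := by
      rw [← norm_pos_iff, norm_e]; norm_num
    have := (c_pos k).ne'
    simp only [T, phi, pt, psi, h3]
    norm_num [he, this]
  all_goals simp only [Complex.norm_real]; norm_num; linarith

lemma pt_tendsto (a : ℝ) : Tendsto (fun k : ℕ => ((a / 16 ^ k : ℝ) : ℂ)) atTop (𝓝 0) := by
  have h1 : Tendsto (fun i : ℕ => a * (1/16 : ℝ) ^ i) atTop (𝓝 (a * 0)) :=
    (tendsto_pow_atTop_nhds_zero_of_lt_one (by norm_num) (by norm_num)).const_mul _
  have h2 := (Complex.continuous_ofReal.tendsto _).comp h1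
  simp only [mul_zero, Complex.ofReal_zero] at h2
  refine h2.congr fun k => ?_
  simp [div_eq_mul_inv]

noncomputable def H (i : ℕ) (z : ℂ) : ℂ :=
  (c i : ℂ) * ((16 ^ i : ℝ) • z) ^ (i + 2) * ((16 ^ i : ℝ) • z - 4)

noncomputable def H' (i : ℕ) (z : ℂ) : ℂ :=
  (c i : ℂ) * 16 ^ i * ((16 ^ i : ℝ) • z) ^ (i + 1) * ((i + 3) * ((16 ^ i : ℝ) • z) - 4 * (i + 2))

lemma H_deriv (i : ℕ) (z : ℂ) : HasDerivAt (H i) (H' i z) z := by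
  have h0 : HasDerivAt (fun z : ℂ => (16 ^ i : ℝ) • z) ((16 ^ i : ℝ) • 1) z :=
    (hasDerivAt_id z).const_smul (16 ^ i : ℝ)
  have h1 := ((h0.pow (i+2)).const_mul (c i : ℂ)).mul (h0.sub_const 4)
  refine h1.congr_deriv ?_
  simp only [H', Complex.real_smul]
  push_cast
  simp only [Pi.pow_apply]
  ring

lemma phi_fderiv (h : Cut χ) (i : ℕ) (z v : ℂ) : fderiv ℝ (phi χ i) z v =
    (16 ^ i : ℝ) * fderiv ℝ χ ((16 ^ i : ℝ) • z) v * H i z + χ ((16 ^ i : ℝ) • z) * (H' i z * v) := by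
  have e1 : phi χ i = fun z => χ ((16 ^ i : ℝ) • z) * H i z := by
    funext y
    simp only [phi, psi, H]
    ring
  have h0 : HasFDerivAt (fun z : ℂ => (16 ^ i : ℝ) • z) ((16 ^ i : ℝ) • ContinuousLinearMap.id ℝ ℂ) z :=
    (hasFDerivAt_id z).const_smul (16 ^ i : ℝ)
  have h1 : HasFDerivAt χ (fderiv ℝ χ ((16 ^ i : ℝ) • z)) ((16 ^ i : ℝ) • z) :=
    ((h.smooth.differentiable (by simp)) _).hasFDerivAt
  have h2 := (h1.comp z h0).mul ((H_deriv i z).hasFDerivAt.restrictScalars ℝ)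
  rw [e1]
  refine (congrArg (fun L => L v) h2.fderiv).trans ?_
  simp
  ring

lemma phi_dbar (h : Cut χ) (i : ℕ) (z : ℂ) :
    dbar (phi χ i) z = (16 ^ i : ℝ) * dbar χ ((16 ^ i : ℝ) • z) * H i z := by
  simp only [dbar, phi_fderiv h, smul_eq_mul, Complex.real_smul]
  linear_combination (2⁻¹ : ℝ) * χ ((16 ^ i : ℝ) • z) * H' i z * Complex.I_mul_I

lemma phi_dz (h : Cut χ) (i : ℕ) (z : ℂ) (h1 : 1 ≤ ‖(16 ^ i : ℝ) • z‖) (h2 : ‖(16 ^ i : ℝ) • z‖ ≤ 16) :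
    dz (phi χ i) z = H' i z := by
  have hp := h.plateau _ h1 h2
  have hf : fderiv ℝ χ ((16 ^ i : ℝ) • z) = 0 := by rw [hp.fderiv_eq]; simp
  have hv : χ ((16 ^ i : ℝ) • z) = 1 := hp.eq_of_nhds
  simp only [dz, phi_fderiv h, hf, hv]
  simp
  linear_combination (-2⁻¹) * H' i z * Complex.I_mul_I

lemma dbar_chi_zero (h : Cut χ) (w : ℂ) (hw : ‖w‖ ≤ 1/2 ∨ (1 ≤ ‖w‖ ∧ ‖w‖ ≤ 16) ∨ 32 ≤ ‖w‖) :
    dbar χ w = 0 := by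
  have hf : fderiv ℝ χ w = 0 := by
    rcases hw with hw | hw | hw
    · rw [(h.inner w hw).fderiv_eq]; simp
    · rw [(h.plateau w hw.1 hw.2).fderiv_eq]; simp
    · rw [(h.outer w hw).fderiv_eq]; simp
  simp [dbar, hf]

lemma dbar_chi_bound (h : Cut χ) : ∃ M : ℝ, 0 < M ∧ ∀ w, ‖dbar χ w‖ ≤ M := by
  obtain ⟨C, hC, hC'⟩ := bound_ball h.smooth 1
  refine ⟨C, hC, fun w => ?_⟩
  rcases le_or_gt ‖w‖ 32 with hw | hw
  · have h1 := hC' 1 le_rfl w hw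
    rw [norm_iteratedFDeriv_one] at h1
    have a1 := (fderiv ℝ χ w).le_opNorm 1
    have a2 := (fderiv ℝ χ w).le_opNorm Complex.I
    have a3 := norm_add_le (fderiv ℝ χ w 1) (Complex.I • fderiv ℝ χ w Complex.I)
    rw [norm_smul] at a3
    simp only [norm_one, Complex.norm_I, mul_one, one_mul, smul_eq_mul] at a1 a2 a3
    rw [dbar, norm_smul]
    norm_num
    linarith
  · rw [dbar_chi_zero h w (by right; right; exact hw.le)]; simpa using hC.le

lemma T_fderiv (h : Cut χ) (i : ℕ) (z v : ℂ) : fderiv ℝ (T χ i) z v = fderiv ℝ (phi χ i) z v • e i := by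
  have h1 : DifferentiableAt ℝ (phi χ i) z := ((phi_smooth h i).differentiable (by simp)) z
  have := h1.hasFDerivAt.smul_const (e i)
  have e1 : T χ i = fun y => phi χ i y • e i := rfl
  rw [e1, this.fderiv]
  simp

lemma T_fderiv_zero (h : Cut χ) (i : ℕ) (z : ℂ)
    (hw : 16 ^ i * ‖z‖ ≤ 1/2 ∨ 32 ≤ 16 ^ i * ‖z‖) : fderiv ℝ (T χ i) z = 0 := by
  rw [← norm_sc] at hw
  have hχ : χ =ᶠ[𝓝 ((16 ^ i : ℝ) • z)] fun _ => 0 := by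
    rcases hw with hw | hw
    · exact h.inner _ hw
    · exact h.outer _ hw
  ext1 v
  rw [T_fderiv h, phi_fderiv h, hχ.fderiv_eq, hχ.eq_of_nhds]
  simp

lemma U_fderiv_three (h : Cut χ) (j : ℕ) (z : ℂ) (h1 : 1 ≤ 16 ^ (j+1) * ‖z‖)
    (h2 : 16 ^ (j+1) * ‖z‖ ≤ 16) (v : ℂ) :
    fderiv ℝ (U χ) z v = fderiv ℝ (phi χ j) z v • e j + fderiv ℝ (phi χ (j+1)) z v • e (j+1) +
      fderiv ℝ (phi χ (j+2)) z v • e (j+2) := by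
  have : ∑' i, fderiv ℝ (T χ i) z = ∑ i ∈ {j, j+1, j+2}, fderiv ℝ (T χ i) z := by
    refine tsum_eq_sum fun i hi => T_fderiv_zero h i z ?_
    simp only [Finset.mem_insert, Finset.mem_singleton, not_or] at hi
    rcases lt_or_ge i j with hij | hij
    · left
      obtain ⟨d, rfl⟩ := Nat.exists_eq_add_of_lt hij
      have : (1:ℝ) ≤ 16 ^ d := one_le_pow₀ (by norm_num)
      have e1 : (16:ℝ) ^ (i + d + 1 + 1) * ‖z‖ = 256 * 16 ^ d * (16 ^ i * ‖z‖) := by ring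
      rw [e1] at h2
      have : 0 ≤ 16 ^ i * ‖z‖ := by positivity
      nlinarith
    · right
      obtain ⟨d, rfl⟩ := Nat.exists_eq_add_of_le (show j + 3 ≤ i by omega)
      have : (1:ℝ) ≤ 16 ^ d := one_le_pow₀ (by norm_num)
      have e1 : (16:ℝ) ^ (j + 3 + d) * ‖z‖ = 256 * 16 ^ d * (16 ^ (j+1) * ‖z‖) := by ring
      rw [e1]
      nlinarith
  rw [fderiv_U h, this, Finset.sum_insert (by simp), Finset.sum_insert (by simp), Finset.sum_singleton]
  simp only [add_apply, T_fderiv h]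
  abel

lemma e_ne (i : ℕ) : (e i) (Fin.ofNat 2 (i+1)) = 0 := by
  simp only [e, PiLp.single_apply, Fin.ext_iff, Fin.val_ofNat]
  rw [if_neg (by omega)]

lemma e_ne' (i : ℕ) : (e (i+2)) (Fin.ofNat 2 (i+1)) = 0 := by
  simp only [e, PiLp.single_apply, Fin.ext_iff, Fin.val_ofNat]
  rw [if_neg (by omega)]

lemma e_eq (i : ℕ) : (e i) (Fin.ofNat 2 i) = 1 := by
  simp [e]

lemma U_dbar (h : Cut χ) (j : ℕ) (z : ℂ) (h1 : 1 ≤ 16 ^ (j+1) * ‖z‖)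
    (h2 : 16 ^ (j+1) * ‖z‖ ≤ 16) :
    ‖dbar (U χ) z‖ ≤ ‖dbar (phi χ j) z‖ + ‖dbar (phi χ (j+2)) z‖ := by
  have e0 : dbar (phi χ (j+1)) z = 0 := by
    rw [phi_dbar h, dbar_chi_zero h]
    · simp
    · right; left; rw [norm_sc]; exact ⟨h1, h2⟩
  have e1 : dbar (U χ) z = dbar (phi χ j) z • e j + dbar (phi χ (j+1)) z • e (j+1) +
      dbar (phi χ (j+2)) z • e (j+2) := by
    simp only [dbar, U_fderiv_three h j z h1 h2, ← Complex.coe_smul, smul_eq_mul]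
    module
  rw [e1, e0, zero_smul, add_zero]
  refine (norm_add_le _ _).trans ?_
  simp [norm_smul, norm_e]

lemma U_dz (h : Cut χ) (j : ℕ) (z : ℂ) (h1 : 1 ≤ 16 ^ (j+1) * ‖z‖)
    (h2 : 16 ^ (j+1) * ‖z‖ ≤ 16) :
    ‖H' (j+1) z‖ ≤ ‖dz (U χ) z‖ := by
  have e1 : dz (U χ) z = dz (phi χ j) z • e j + dz (phi χ (j+1)) z • e (j+1) +
      dz (phi χ (j+2)) z • e (j+2) := by
    simp only [dz, U_fderiv_three h j z h1 h2, ← Complex.coe_smul, smul_eq_mul]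
    module
  have e2 : (dz (U χ) z) (Fin.ofNat 2 (j+1)) = H' (j+1) z := by
    rw [← phi_dz h (j+1) z (by rwa [norm_sc]) (by rwa [norm_sc]), e1]
    simp only [PiLp.add_apply, PiLp.smul_apply, e_ne, e_ne', e_eq]
    simp
  rw [← e2]
  exact PiLp.norm_apply_le _ _

lemma H_bound (i : ℕ) (z : ℂ) :
    ‖H i z‖ ≤ c i * (16 ^ i * ‖z‖) ^ (i+2) * (16 ^ i * ‖z‖ + 4) := by
  have hc := c_pos i
  rw [H, norm_mul, norm_mul, norm_pow, norm_sc, Complex.norm_real, Real.norm_of_nonneg hc.le]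
  have := norm_sub_le ((16 ^ i : ℝ) • z) 4
  rw [norm_sc] at this
  norm_num at this
  gcongr
  simpa using this

lemma dbar_phi_bound (h : Cut χ) {M : ℝ} (hM : ∀ w, ‖dbar χ w‖ ≤ M) (i : ℕ) (z : ℂ) :
    ‖dbar (phi χ i) z‖ ≤ M * (16 ^ i * (c i * (16 ^ i * ‖z‖) ^ (i+2) * (16 ^ i * ‖z‖ + 4))) := by
  rw [phi_dbar h, norm_mul, norm_mul, Complex.norm_real, Real.norm_of_nonneg (by positivity),
    mul_comm ((16:ℝ)^i), mul_assoc]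
  have h1 := hM ((16 ^ i : ℝ) • z)
  have h2 := H_bound i z
  have : 0 ≤ M := (norm_nonneg _).trans h1
  gcongr

lemma dbar_phi_zero (h : Cut χ) (i : ℕ) (z : ℂ)
    (hw : 16 ^ i * ‖z‖ ≤ 1/2 ∨ 32 ≤ 16 ^ i * ‖z‖) : dbar (phi χ i) z = 0 := by
  rw [phi_dbar h, dbar_chi_zero h]
  · simp
  · rw [norm_sc]; tauto

lemma key (h : Cut χ) : ∃ C : ℝ, 0 < C ∧ ∀ (j : ℕ) (z : ℂ), 1 ≤ 16 ^ (j+1) * ‖z‖ →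
    16 ^ (j+1) * ‖z‖ ≤ 16 → ‖dbar (U χ) z‖ ≤ C / (j+1) * ‖dz (U χ) z‖ := by
  obtain ⟨M, hM, hM'⟩ := dbar_chi_bound h
  refine ⟨36864 * M, by positivity, fun j z h1 h2 => ?_⟩
  have hdb := U_dbar h j z h1 h2
  have hdz := U_dz h j z h1 h2
  have hj0 : (0:ℝ) ≤ j := Nat.cast_nonneg j
  refine hdb.trans ?_
  rw [div_mul_eq_mul_div, le_div_iff₀ (by positivity)]
  refine le_trans ?_ (mul_le_mul_of_nonneg_left hdz (by positivity))
  have b1 := dbar_phi_bound h hM' j z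
  have b2 := dbar_phi_bound h hM' (j+2) z
  have z1 := dbar_phi_zero h j z
  have z2 := dbar_phi_zero h (j+2) z
  have hn : ‖H' (j+1) z‖ = c (j+1) * 16 ^ (j+1) * (16 ^ (j+1) * ‖z‖) ^ (j+2) *
      ‖((j:ℂ) + 4) * ((16 ^ (j+1) : ℝ) • z) - 4 * (j + 3)‖ := by
    rw [H', norm_mul, norm_mul, norm_mul, norm_pow, norm_pow, norm_sc, Complex.norm_real,
      Real.norm_of_nonneg (c_pos _).le]
    push_cast
    norm_num
    ring_nf
    exact Or.inl trivial
  have n1 : ‖((j:ℂ) + 4) * ((16 ^ (j+1) : ℝ) • z)‖ = (j + 4) * (16 ^ (j+1) * ‖z‖) := by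
    rw [norm_mul, norm_sc]
    congr 1
    exact_mod_cast Complex.norm_natCast (j + 4)
  have n2 : ‖(4 * ((j:ℂ) + 3))‖ = 4 * (j + 3) := by
    rw [norm_mul]
    congr 1
    · norm_num
    · exact_mod_cast Complex.norm_natCast (j + 3)
  have t1 := norm_sub_norm_le (((j:ℂ) + 4) * ((16 ^ (j+1) : ℝ) • z)) (4 * ((j:ℂ) + 3))
  have t2 := norm_sub_norm_le (4 * ((j:ℂ) + 3)) (((j:ℂ) + 4) * ((16 ^ (j+1) : ℝ) • z))
  rw [norm_sub_rev] at t2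
  rw [n1, n2] at t1 t2
  rw [hn]
  generalize ‖((j:ℂ) + 4) * ((16 ^ (j+1) : ℝ) • z) - 4 * (j + 3)‖ = Q at *
  have hc := c_pos (j+1)
  have c1 : c j = c (j+1) * 16 ^ (j+2) := by rw [c]; field_simp
  have c2 : c (j+2) = c (j+1) / 16 ^ (j+3) := rfl
  have r1 : (16:ℝ) ^ j * ‖z‖ = (16 ^ (j+1) * ‖z‖) / 16 := by rw [pow_succ]; ring
  have r2 : (16:ℝ) ^ (j+2) * ‖z‖ = 16 * (16 ^ (j+1) * ‖z‖) := by ring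
  rw [r1] at b1 z1
  rw [r2] at b2 z2
  generalize 16 ^ (j+1) * ‖z‖ = R at *
  have b1' : ‖dbar (phi χ j) z‖ ≤ M * (c (j+1) * 16 ^ (j+1) * R ^ (j+2)) * ((R/16+4)/16) := by
    refine b1.trans (le_of_eq ?_)
    rw [c1, div_pow]
    field_simp
    ring
  have b2' : ‖dbar (phi χ (j+2)) z‖ ≤
      M * (c (j+1) * 16 ^ (j+1) * R ^ (j+2)) * (256 * R^2 * (16 * R + 4)) := by
    refine b2.trans (le_of_eq ?_)
    rw [c2, mul_pow]
    field_simp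
    ring
  have hP : 0 < c (j+1) * 16 ^ (j+1) * R ^ (j+2) := by positivity
  generalize c (j+1) * 16 ^ (j+1) * R ^ (j+2) = P at *
  have hMP : 0 < M * P := by positivity
  rcases lt_or_ge R 2 with hR | hR
  · rw [z1 (by left; linarith), norm_zero, zero_add]
    have q : (j:ℝ) + 1 ≤ Q := by nlinarith
    have : 256 * R^2 * (16 * R + 4) ≤ 36864 := by
      have : R^2 ≤ 4 := by nlinarith
      nlinarith [sq_nonneg R]
    calc ‖dbar (phi χ (j+2)) z‖ * ((j:ℝ)+1) ≤ (M * P * 36864) * Q := by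
          refine mul_le_mul (b2'.trans ?_) q (by positivity) (by positivity)
          gcongr
      _ = _ := by ring
  · rw [z2 (by right; linarith), norm_zero, add_zero]
    rcases le_or_gt R 8 with hR8 | hR8
    · rw [z1 (by left; linarith), norm_zero, zero_mul]
      have : 0 ≤ Q := by
        rcases le_total (((j:ℝ) + 4) * R) (4 * (j + 3)) with hh | hh <;> linarith
      positivity
    · have q : (j:ℝ) + 1 ≤ Q := by nlinarith
      calc ‖dbar (phi χ j) z‖ * ((j:ℝ)+1) ≤ (M * P * 36864) * Q := by
            refine mul_le_mul (b1'.trans ?_) q (by positivity) (by positivity)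
            gcongr
            linarith
        _ = _ := by ring

lemma scale (J : ℕ) (z : ℂ) (hz : z ≠ 0) (hz' : ‖z‖ < 1 / 16 ^ J) :
    ∃ j : ℕ, J ≤ j ∧ 1 ≤ 16 ^ (j+1) * ‖z‖ ∧ 16 ^ (j+1) * ‖z‖ ≤ 16 := by
  have hp : 0 < ‖z‖ := norm_pos_iff.2 hz
  have h1J : (1:ℝ) ≤ 16 ^ J := one_le_pow₀ (by norm_num)
  have hlt : 16 ^ J < ‖z‖⁻¹ := by
    rw [lt_inv_comm₀ (by positivity) hp, ← one_div]; exact hz'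
  obtain ⟨j, hj1, hj2⟩ := exists_nat_pow_near (x := ‖z‖⁻¹) (y := (16:ℝ)) (by linarith) (by norm_num)
  refine ⟨j, ?_, ?_, ?_⟩
  · have : (16:ℝ) ^ J < 16 ^ (j+1) := hlt.trans hj2
    have := (pow_lt_pow_iff_right₀ (by norm_num : (1:ℝ) < 16)).1 this
    omega
  · have := mul_le_mul_of_nonneg_right hj2.le hp.le
    rwa [inv_mul_cancel₀ hp.ne'] at this
  · have := mul_le_mul_of_nonneg_right hj1 hp.le
    rw [inv_mul_cancel₀ hp.ne'] at this
    rw [pow_succ]; linarith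

lemma dbar_U_zero (h : Cut χ) : dbar (U χ) 0 = 0 := by
  have h1 : HasFDerivAt (U χ) (0 : ℂ →L[ℝ] E2) 0 :=
    IsBigO.hasFDerivAt (n := 2) (by simpa using U_flat h 2) (by norm_num)
  simp [dbar, h1.fderiv]

end SN

/-- There exist a smooth map `u : D → ℂ²` and `ε : D → [0,∞)` with
`ε(z) → 0` as `z → 0`, such that `‖∂u/∂z̄‖ ≤ ε(z)·‖∂u/∂z‖` on `D`, `u` vanishes to
infinite order at `0`, `0` is a non-isolated zero of `u`, but `u` is not identically
`0` on any neighborhood of `0`. -/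
theorem example_smooth_nonunique :
    ∃ (u : ℂ → EuclideanSpace ℂ (Fin 2)) (ε : ℂ → ℝ),
      ContDiffOn ℝ (⊤ : ℕ∞) u (ball (0 : ℂ) 1) ∧
      (∀ z, 0 ≤ ε z) ∧
      Filter.Tendsto ε (𝓝[≠] (0 : ℂ)) (𝓝 0) ∧
      (∀ z ∈ ball (0 : ℂ) 1, ‖dbar u z‖ ≤ ε z * ‖dz u z‖) ∧
      (∀ N : ℕ, 0 < N →
        (fun z : ℂ => ‖u z‖) =O[𝓝 (0 : ℂ)] fun z : ℂ => ‖z‖ ^ N) ∧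
      AccPt (0 : ℂ) (𝓟 {z : ℂ | z ∈ ball (0 : ℂ) 1 ∧ z ≠ 0 ∧ u z = 0}) ∧
      (∀ V ∈ 𝓝 (0 : ℂ), ∃ z ∈ V, u z ≠ 0) := by
  obtain ⟨χ, h⟩ := SN.exists_cut
  obtain ⟨C, hC, hkey⟩ := SN.key h
  refine ⟨SN.U χ, fun z => ‖dbar (SN.U χ) z‖ / ‖dz (SN.U χ) z‖, (SN.U_smooth h).contDiffOn,
    fun z => by positivity, ?_, ?_, fun N _ => (SN.U_flat h N).norm_left, ?_, ?_⟩
  · rw [Metric.tendsto_nhdsWithin_nhds]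
    intro δ hδ
    obtain ⟨J, hJ⟩ := exists_nat_gt (C / δ)
    refine ⟨1 / 16 ^ J, by positivity, fun z hz hz' => ?_⟩
    rw [dist_zero_right] at hz'
    obtain ⟨j, hj, h1, h2⟩ := SN.scale J z hz hz'
    have h3 := hkey j z h1 h2
    rw [dist_zero_right, Real.norm_of_nonneg (by positivity)]
    have h4 : ‖dbar (SN.U χ) z‖ / ‖dz (SN.U χ) z‖ ≤ C / (j+1) :=
      div_le_of_le_mul₀ (norm_nonneg _) (by positivity) h3
    refine h4.trans_lt ?_
    rw [div_lt_iff₀ hδ] at hJ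
    rw [div_lt_iff₀ (by positivity)]
    have : (J:ℝ) ≤ j := by exact_mod_cast hj
    nlinarith
  · intro z hz
    rcases eq_or_ne z 0 with rfl | hz0
    · rw [SN.dbar_U_zero h, norm_zero]; positivity
    · obtain ⟨j, hj, h1, h2⟩ := SN.scale 0 z hz0 (by simpa using hz)
      have h3 := hkey j z h1 h2
      rcases eq_or_ne ‖dz (SN.U χ) z‖ 0 with h0 | h0
      · rw [h0, mul_zero] at h3 ⊢; exact h3
      · rw [div_mul_cancel₀ _ h0]
  · rw [accPt_iff_frequently]
    have h1 := (SN.pt_tendsto 4)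
    refine h1.frequently (Eventually.frequently ?_)
    have h2 : ∀ᶠ k : ℕ in atTop, ((4 / 16 ^ k : ℝ) : ℂ) ∈ ball (0:ℂ) 1 :=
      h1.eventually (ball_mem_nhds _ one_pos)
    filter_upwards [h2] with k hk
    have hne : ((4 / 16 ^ k : ℝ) : ℂ) ≠ 0 := by
      rw [Complex.ofReal_ne_zero]; positivity
    exact ⟨hne, hk, hne, SN.U_four h k⟩
  · intro V hV
    obtain ⟨k, hk⟩ := ((SN.pt_tendsto 3).eventually hV).exists
    exact ⟨_, hk, SN.U_three h k⟩
end

section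
/- There exist a C^∞-smooth map u : ℂ → ℂ² and a constant C > 0 such that: (i) u vanishes to infinite order at 0; (ii) u is not identically 0 on any neighborhood of 0; (iii) for all z with 0 < |z| < 1/2, ‖∂u/∂z̄(z)‖ ≤ (C / log(1/|z|))·‖∂u/∂z(z)‖. -/
open Complex MeasureTheory Metric Filter Asymptotics Topology

lemma aux_bump : ∃ φ ψ : ℂ → ℂ, ContDiff ℝ (⊤ : ℕ∞) φ ∧ HasCompactSupport φ ∧
    ContDiff ℝ (⊤ : ℕ∞) ψ ∧ HasCompactSupport ψ ∧ (∀ w, ‖φ w‖ ≤ 1) ∧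
    (∀ w, Real.exp (-0.6) ≤ ‖w‖ → ‖w‖ ≤ Real.exp 0.6 → φ w = 1) ∧
    (∀ w, ‖w‖ ≤ Real.exp (-0.9) → φ w = 0) ∧
    (∀ w, Real.exp (0.9) ≤ ‖w‖ → φ w = 0) ∧
    (∀ w, ‖w‖ ≤ Real.exp (0.9) → ψ w = 1) := by
  let b1 : ContDiffBump (0 : ℂ) := ⟨Real.exp 0.6, Real.exp 0.9, Real.exp_pos _,
    Real.exp_lt_exp.2 (by norm_num)⟩
  let b2 : ContDiffBump (0 : ℂ) := ⟨Real.exp (-0.9), Real.exp (-0.6), Real.exp_pos _,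
    Real.exp_lt_exp.2 (by norm_num)⟩
  let b3 : ContDiffBump (0 : ℂ) := ⟨Real.exp 0.9, Real.exp 1, Real.exp_pos _,
    Real.exp_lt_exp.2 (by norm_num)⟩
  have h1 : ∀ w, ‖w‖ ≤ Real.exp 0.6 → b1 w = 1 := fun w hw =>
    b1.one_of_mem_closedBall (by simpa [b1] using hw)
  have h1' : ∀ w, Real.exp 0.9 ≤ ‖w‖ → b1 w = 0 := fun w hw =>
    b1.zero_of_le_dist (by simpa [b1] using hw)
  have h2 : ∀ w, ‖w‖ ≤ Real.exp (-0.9) → b2 w = 1 := fun w hw =>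
    b2.one_of_mem_closedBall (by simpa [b2] using hw)
  have h2' : ∀ w, Real.exp (-0.6) ≤ ‖w‖ → b2 w = 0 := fun w hw =>
    b2.zero_of_le_dist (by simpa [b2] using hw)
  have h3 : ∀ w, ‖w‖ ≤ Real.exp 0.9 → b3 w = 1 := fun w hw =>
    b3.one_of_mem_closedBall (by simpa [b3] using hw)
  have e1 : Real.exp (-0.9) ≤ Real.exp 0.6 := Real.exp_le_exp.2 (by norm_num)
  have e2 : Real.exp (-0.6) ≤ Real.exp 0.9 := Real.exp_le_exp.2 (by norm_num)
  refine ⟨fun w => ((b1 w - b2 w : ℝ) : ℂ), fun w => ((b3 w : ℝ) : ℂ), ?_, ?_, ?_, ?_, ?_, ?_, ?_, ?_, ?_⟩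
  · exact Complex.ofRealCLM.contDiff.comp (b1.contDiff.sub b2.contDiff)
  · exact (b1.hasCompactSupport.sub b2.hasCompactSupport).comp_left (g := fun x : ℝ => (x : ℂ)) (by simp)
  · exact Complex.ofRealCLM.contDiff.comp b3.contDiff
  · exact b3.hasCompactSupport.comp_left (g := fun x : ℝ => (x : ℂ)) (by simp)
  · intro w
    rw [Complex.norm_real, Real.norm_eq_abs, abs_le]
    have := b1.nonneg' w; have := b2.nonneg' w
    have := b1.le_one (x := w); have := b2.le_one (x := w)
    constructor <;> linarith
  · intro w ha hb
    simp [h1 w hb, h2' w ha]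
  · intro w ha
    simp [h1 w (ha.trans e1), h2 w ha]
  · intro w ha
    simp [h1' w ha, h2' w (e2.trans ha)]
  · intro w ha
    simp [h3 w ha]

lemma aux_bdd {φ : ℂ → ℂ} (h : ContDiff ℝ (⊤ : ℕ∞) φ) (hc : HasCompactSupport φ) (m : ℕ) :
    ∃ A : ℝ, 0 ≤ A ∧ ∀ i ≤ m, ∀ w, ‖iteratedFDeriv ℝ i φ w‖ ≤ A := by
  have : ∀ i : ℕ, ∃ A : ℝ, ∀ w, ‖iteratedFDeriv ℝ i φ w‖ ≤ A := fun i =>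
    (hc.iteratedFDeriv i).exists_bound_of_continuous
      (h.continuous_iteratedFDeriv (by exact_mod_cast le_top))
  choose A hA using this
  have hA0 : ∀ i, 0 ≤ A i := fun i => (norm_nonneg _).trans (hA i 0)
  refine ⟨∑ i ∈ Finset.range (m+1), A i, Finset.sum_nonneg fun i _ => hA0 i, fun i hi w => ?_⟩
  exact (hA i w).trans (Finset.single_le_sum (f := A) (fun i _ => hA0 i) (by simp; omega))

lemma aux_pow {φ g : ℂ → ℂ} (h : ContDiff ℝ (⊤ : ℕ∞) φ) (hc : HasCompactSupport φ)
    (hg : ContDiff ℝ (⊤ : ℕ∞) g) (hgc : HasCompactSupport g) (m : ℕ) :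
    ∃ B K : ℝ, 0 ≤ B ∧ 0 < K ∧ ∀ k : ℕ, ∀ i ≤ m, ∀ w,
      ‖iteratedFDeriv ℝ i (fun w => φ w * g w ^ k) w‖ ≤ B * K ^ k := by
  obtain ⟨B, hB0, hB⟩ := aux_bdd h hc m
  obtain ⟨A, hA0, hA⟩ := aux_bdd hg hgc m
  refine ⟨B, 2 ^ m * A + 1, hB0, by positivity, fun k => ?_⟩
  induction k with
  | zero => intro i hi w; simpa using hB i hi w
  | succ k ih =>
    intro i hi w
    have e : (fun w => φ w * g w ^ (k+1)) = fun w => g w * (φ w * g w ^ k) := by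
      ext w; ring
    rw [e]
    refine (norm_iteratedFDeriv_mul_le (N := ((⊤ : ℕ∞) : WithTop ℕ∞)) hg (h.mul (hg.pow k)) w
      (by exact_mod_cast le_top)).trans ?_
    have h2 : ∑ j ∈ Finset.range (i + 1), (i.choose j : ℝ) = 2 ^ i := by
      exact_mod_cast Nat.sum_range_choose i
    calc _ ≤ ∑ j ∈ Finset.range (i + 1), (i.choose j : ℝ) * (A * (B * (2 ^ m * A + 1) ^ k)) := by
          refine Finset.sum_le_sum fun j hj => ?_
          have hj' : j ≤ i := by simp at hj; omega
          rw [mul_assoc]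
          gcongr
          · exact hA j (hj'.trans hi) w
          · exact ih (i - j) (by omega) w
      _ = 2 ^ i * A * (B * (2 ^ m * A + 1) ^ k) := by rw [← Finset.sum_mul, h2]; ring
      _ ≤ (2 ^ m * A + 1) * (B * (2 ^ m * A + 1) ^ k) := by
          have : (2:ℝ) ^ i ≤ 2 ^ m := pow_le_pow_right₀ (by norm_num) hi
          gcongr
          nlinarith
      _ = _ := by ring

lemma aux_summable (B K : ℝ) (hB : 0 ≤ B) (hK : 0 < K) :
    Summable fun k : ℕ => Real.exp (-(k:ℝ)^2/2) * (B * K ^ k) := by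
  have hs := (Real.summable_exp_neg_nat).mul_left (Real.exp ((Real.log K + 1)^2/2) * B)
  refine Summable.of_nonneg_of_le (fun k => by positivity) (fun k => ?_) hs
  have : K ^ k = Real.exp (k * Real.log K) := by
    rw [mul_comm, Real.exp_mul, Real.exp_log hK, Real.rpow_natCast]
  rw [this]
  have : Real.exp (-(k:ℝ)^2/2) * Real.exp (k * Real.log K) ≤
     Real.exp ((Real.log K + 1)^2/2) * Real.exp (-k) := by
    rw [← Real.exp_add, ← Real.exp_add, Real.exp_le_exp]
    nlinarith [sq_nonneg (Real.log K + 1 - k)]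
  nlinarith

/-- the building block -/
noncomputable def FF (φ : ℂ → ℂ) (k : ℕ) (z : ℂ) : ℂ :=
  (Real.exp (-(k:ℝ)^2/2) : ℂ) * (φ (Real.exp k • z) * (Real.exp k • z) ^ k)

def ix (k : ℕ) : Fin 2 := if k % 2 = 0 then 0 else 1

noncomputable def vv (k : ℕ) : EuclideanSpace ℂ (Fin 2) := EuclideanSpace.single (ix k) 1

noncomputable def uu (φ : ℂ → ℂ) (z : ℂ) : EuclideanSpace ℂ (Fin 2) := ∑' k : ℕ, FF φ k z • vv k

lemma vv_norm (k : ℕ) : ‖vv k‖ = 1 := by simp [vv]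

lemma FF_eq {φ ψ : ℂ → ℂ} (h0 : ∀ w, Real.exp (0.9) ≤ ‖w‖ → φ w = 0)
    (h1 : ∀ w, ‖w‖ ≤ Real.exp (0.9) → ψ w = 1) (k : ℕ) (z : ℂ) :
    FF φ k z = Real.exp (-(k:ℝ)^2/2) •
      (fun w => φ w * (ψ w * w) ^ k) (Real.exp k • z) := by
  rw [FF, ← Complex.real_smul (x := Real.exp (-(k:ℝ)^2/2))]
  congr 1
  simp only
  rcases le_total ‖Real.exp k • z‖ (Real.exp 0.9) with h | h
  · rw [h1 _ h, one_mul]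
  · rw [h0 _ h]; simp

lemma uu_smooth {φ ψ : ℂ → ℂ} (h : ContDiff ℝ (⊤ : ℕ∞) φ) (hc : HasCompactSupport φ)
    (hψ : ContDiff ℝ (⊤ : ℕ∞) ψ) (hψc : HasCompactSupport ψ)
    (h0 : ∀ w, Real.exp (0.9) ≤ ‖w‖ → φ w = 0)
    (h1 : ∀ w, ‖w‖ ≤ Real.exp (0.9) → ψ w = 1) : ContDiff ℝ (⊤ : ℕ∞) (uu φ) := by
  have hg : ContDiff ℝ (⊤ : ℕ∞) fun w => ψ w * w := hψ.mul contDiff_id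
  have hgc : HasCompactSupport fun w => ψ w * w := hψc.mul_right
  have hF : ∀ k, FF φ k = fun z => Real.exp (-(k:ℝ)^2/2) •
      (fun w => φ w * (ψ w * w) ^ k) (Real.exp k • z) := fun k => funext (FF_eq h0 h1 k)
  have hG : ∀ k : ℕ, ContDiff ℝ (⊤ : ℕ∞) (fun w => φ w * (ψ w * w) ^ k) := fun k => h.mul (hg.pow k)
  have hs : ∀ k : ℕ, ContDiff ℝ (⊤ : ℕ∞)
      (fun z : ℂ => (fun w => φ w * (ψ w * w) ^ k) (Real.exp k • z)) := fun k =>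
    (hG k).comp (contDiff_id.const_smul (Real.exp k))
  have hFs : ∀ k, ContDiff ℝ (⊤ : ℕ∞) (FF φ k) := fun k => by
    rw [hF]; exact (hs k).const_smul _
  have key : ∀ m : ℕ, ∃ v : ℕ → ℝ, Summable v ∧ ∀ k z,
      ‖iteratedFDeriv ℝ m (fun z => FF φ k z • vv k) z‖ ≤ v k := by
    intro m
    obtain ⟨B, K, hB, hK, hb⟩ := aux_pow h hc hg hgc m
    refine ⟨_, aux_summable B (Real.exp m * K) hB (by positivity), fun k z => ?_⟩
    let L : ℂ →L[ℝ] EuclideanSpace ℂ (Fin 2) :=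
      ((ContinuousLinearMap.id ℂ ℂ).smulRight (vv k)).restrictScalars ℝ
    have hL : ‖L‖ ≤ 1 := by
      refine ContinuousLinearMap.opNorm_le_bound _ zero_le_one fun x => ?_
      simp [L, norm_smul, vv_norm]
    have e : (fun z => FF φ k z • vv k) = L ∘ FF φ k := by ext z; simp [L]
    rw [e]
    refine (L.norm_iteratedFDeriv_comp_left (hFs k).contDiffAt (by exact_mod_cast le_top)).trans ?_
    refine (mul_le_of_le_one_left (norm_nonneg _) hL).trans ?_
    rw [hF, iteratedFDeriv_const_smul_apply' ((hs k).contDiffAt.of_le (by exact_mod_cast le_top)),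
      iteratedFDeriv_comp_const_smul _ ((hG k).of_le (by exact_mod_cast le_top)), norm_smul, norm_smul]
    simp only [norm_pow, Real.norm_eq_abs, Real.abs_exp]
    refine mul_le_mul_of_nonneg_left ?_ (Real.exp_pos _).le
    calc _ ≤ Real.exp k ^ m * (B * K ^ k) := by
          gcongr; exact hb k m le_rfl _
      _ = _ := by
          rw [mul_pow, ← Real.exp_nat_mul, ← Real.exp_nat_mul, mul_comm (m:ℝ)]; ring
  choose v hv hv' using key
  exact contDiff_tsum (fun k => (hFs k).smul contDiff_const) (fun m _ => hv m)
    (fun m k z _ => hv' m k z)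

lemma norm_scale {z : ℂ} (hz : z ≠ 0) (k : ℕ) :
    ‖Real.exp k • z‖ = Real.exp (k - Real.log (1/‖z‖)) := by
  rw [norm_smul, Real.norm_eq_abs, Real.abs_exp, one_div, Real.log_inv, sub_neg_eq_add, Real.exp_add,
    Real.exp_log (norm_pos_iff.2 hz)]

lemma FF_zero {φ : ℂ → ℂ} (h0 : ∀ w, ‖w‖ ≤ Real.exp (-0.9) → φ w = 0)
    (h0' : ∀ w, Real.exp (0.9) ≤ ‖w‖ → φ w = 0) {z : ℂ} (hz : z ≠ 0) (k : ℕ)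
    (hk : 0.9 ≤ |Real.log (1/‖z‖) - k|) : FF φ k z = 0 := by
  have : φ (Real.exp k • z) = 0 := by
    rcases le_abs.1 hk with h | h
    · apply h0; rw [norm_scale hz, Real.exp_le_exp]; linarith
    · apply h0'; rw [norm_scale hz, Real.exp_le_exp]; linarith
  rw [FF, this]; simp

lemma FF_le {φ : ℂ → ℂ} (h : ∀ w, ‖φ w‖ ≤ 1) (h0 : ∀ w, ‖w‖ ≤ Real.exp (-0.9) → φ w = 0)
    (h0' : ∀ w, Real.exp (0.9) ≤ ‖w‖ → φ w = 0) {z : ℂ} (hz : z ≠ 0) (k : ℕ) :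
    ‖FF φ k z‖ ≤ Real.exp (1 - Real.log (1/‖z‖) ^ 2 / 2) := by
  by_cases hk : 0.9 ≤ |Real.log (1/‖z‖) - k|
  · rw [FF_zero h0 h0' hz k hk, norm_zero]; positivity
  · push Not at hk
    rw [abs_lt] at hk
    rw [FF, norm_mul, norm_mul, norm_pow, norm_scale hz, Complex.norm_real,
      Real.norm_eq_abs, Real.abs_exp, ← Real.exp_nat_mul]
    have := mul_le_of_le_one_left (Real.exp_pos (k * (k - Real.log (1/‖z‖)))).le (h (Real.exp k • z))
    refine (mul_le_mul_of_nonneg_left this (Real.exp_pos _).le).trans ?_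
    rw [← Real.exp_add, Real.exp_le_exp]
    nlinarith

lemma uu_local {φ : ℂ → ℂ} (hone : ∀ w, Real.exp (-0.6) ≤ ‖w‖ → ‖w‖ ≤ Real.exp 0.6 → φ w = 1)
    (h0 : ∀ w, ‖w‖ ≤ Real.exp (-0.9) → φ w = 0)
    (h0' : ∀ w, Real.exp (0.9) ≤ ‖w‖ → φ w = 0) {z : ℂ} (hz : z ≠ 0) (n : ℕ)
    (hk : |Real.log (1/‖z‖) - (n+1:ℕ)| < 0.6) :
    uu φ z = (FF φ n z + FF φ (n+2) z) • vv n +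
      FF (fun _ => 1) (n+1) z • vv (n+1) := by
  have hv : vv (n+2) = vv n := by
    simp only [vv]; congr 1; simp [ix]
  have h1 : FF φ (n+1) z = FF (fun _ => 1) (n+1) z := by
    rw [abs_lt] at hk
    simp only [FF]
    rw [hone]
    · rw [norm_scale hz, Real.exp_le_exp]; linarith
    · rw [norm_scale hz, Real.exp_le_exp]; linarith
  rw [uu, tsum_eq_sum (s := {n, n+1, n+2})]
  · rw [Finset.sum_insert (by simp), Finset.sum_insert (by simp), Finset.sum_singleton, hv, h1]
    module
  · intro j hj
    simp only [Finset.mem_insert, Finset.mem_singleton, not_or] at hj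
    rw [FF_zero h0 h0' hz, zero_smul]
    rw [abs_lt] at hk
    push_cast at hk
    rcases lt_or_ge j n with h | h
    · have : (j:ℝ) + 1 ≤ n := by exact_mod_cast h
      apply le_abs.2; left; linarith
    · have : (n:ℝ) + 3 ≤ j := by exact_mod_cast (by omega : n + 3 ≤ j)
      apply le_abs.2; right; linarith

lemma dbar_mul {P Q : ℂ → ℂ} {p z : ℂ} (hP : HasDerivAt P p z) (hQ : DifferentiableAt ℝ Q z) :
    dbar (fun z => P z * Q z) z = P z * dbar Q z := by
  have h := hP.complexToReal_fderiv.fun_mul hQ.hasFDerivAt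
  rw [dbar, h.fderiv, dbar]
  simp
  ring_nf
  simp

lemma dz_holo {P : ℂ → ℂ} {p z : ℂ} (hP : HasDerivAt P p z) : dz P z = p := by
  rw [dz, hP.complexToReal_fderiv.fderiv]
  simp
  ring_nf
  simp
  ring

lemma dbar_holo {P : ℂ → ℂ} {p z : ℂ} (hP : HasDerivAt P p z) : dbar P z = 0 := by
  rw [dbar, hP.complexToReal_fderiv.fderiv]
  simp
  ring_nf
  simp

lemma dbar_comb {G H : ℂ → ℂ} {z : ℂ} (hG : DifferentiableAt ℝ G z) (hH : DifferentiableAt ℝ H z)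
    (a b : EuclideanSpace ℂ (Fin 2)) :
    dbar (fun z => G z • a + H z • b) z = dbar G z • a + dbar H z • b := by
  have h := (hG.hasFDerivAt.smul_const a).fun_add (hH.hasFDerivAt.smul_const b)
  rw [dbar, h.fderiv, dbar, dbar]
  ext i
  simp
  ring

lemma dz_comb {G H : ℂ → ℂ} {z : ℂ} (hG : DifferentiableAt ℝ G z) (hH : DifferentiableAt ℝ H z)
    (a b : EuclideanSpace ℂ (Fin 2)) :
    dz (fun z => G z • a + H z • b) z = dz G z • a + dz H z • b := by
  have h := (hG.hasFDerivAt.smul_const a).fun_add (hH.hasFDerivAt.smul_const b)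
  rw [dz, h.fderiv, dz, dz]
  ext i
  simp
  ring

lemma dbar_add {G H : ℂ → ℂ} {z : ℂ} (hG : DifferentiableAt ℝ G z) (hH : DifferentiableAt ℝ H z) :
    dbar (fun z => G z + H z) z = dbar G z + dbar H z := by
  have h := hG.hasFDerivAt.fun_add hH.hasFDerivAt
  rw [dbar, h.fderiv, dbar, dbar]
  simp
  ring

lemma dbar_scale {φ : ℂ → ℂ} (h : Differentiable ℝ φ) (a : ℝ) (z : ℂ) :
    dbar (fun z => φ (a • z)) z = a • dbar φ (a • z) := by
  have h := (h (a • z)).hasFDerivAt.comp z ((hasFDerivAt_id (𝕜 := ℝ) z).const_smul a)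
  have h2 : HasFDerivAt (fun z => φ (a • z)) _ z := h
  rw [dbar, h2.fderiv, dbar]
  simp
  ring

lemma mono_deriv (k : ℕ) (z : ℂ) :
    HasDerivAt (fun z : ℂ => (Real.exp (-(k:ℝ)^2/2) : ℂ) * (Real.exp k • z) ^ k)
      ((Real.exp (-(k:ℝ)^2/2) : ℂ) * (k * (Real.exp k • z) ^ (k-1) * (Real.exp k : ℂ))) z := by
  have h : HasDerivAt (fun z : ℂ => Real.exp k • z) (Real.exp k : ℂ) z := by
    have := (hasDerivAt_id z).const_smul (Real.exp k)
    rw [Complex.real_smul, mul_one] at this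
    exact this
  exact (h.pow k).const_mul _

lemma FF_diff {φ : ℂ → ℂ} (h : Differentiable ℝ φ) (k : ℕ) : Differentiable ℝ (FF φ k) := by
  unfold FF
  have : Differentiable ℝ fun z : ℂ => φ (Real.exp k • z) :=
    h.comp (differentiable_id.const_smul (Real.exp k))
  fun_prop

lemma dbar_FF_le {φ : ℂ → ℂ} (h : Differentiable ℝ φ) {M : ℝ} (hM : ∀ w, ‖dbar φ w‖ ≤ M)
    {z : ℂ} (hz : z ≠ 0) (k : ℕ) (hk : |Real.log (1/‖z‖) - k| ≤ 1.6) :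
    ‖dbar (FF φ k) z‖ ≤
      M * Real.exp 3 * Real.exp (Real.log (1/‖z‖) - Real.log (1/‖z‖)^2/2) := by
  have e : FF φ k = fun z => ((Real.exp (-(k:ℝ)^2/2) : ℂ) * (Real.exp k • z) ^ k) *
      φ (Real.exp k • z) := by ext z; rw [FF]; ring
  have hd : DifferentiableAt ℝ (fun z : ℂ => φ (Real.exp k • z)) z :=
    h.comp (differentiable_id.const_smul (Real.exp k)) z
  rw [e, dbar_mul (mono_deriv k z) hd, dbar_scale h, norm_mul, norm_mul, norm_pow, norm_scale hz,
    Complex.norm_real, Real.norm_eq_abs, Real.abs_exp, ← Real.exp_nat_mul,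
    norm_smul, Real.norm_eq_abs, Real.abs_exp]
  set t := Real.log (1/‖z‖)
  have hM0 : 0 ≤ M := (norm_nonneg _).trans (hM 0)
  calc _ ≤ Real.exp (-(k:ℝ)^2/2) * Real.exp (k * (k - t)) * (Real.exp k * M) := by
        gcongr; exact hM _
    _ = M * Real.exp (-(k:ℝ)^2/2 + k * (k - t) + k) := by
        rw [Real.exp_add, Real.exp_add]; ring
    _ ≤ M * Real.exp (3 + (t - t^2/2)) := by
        rw [abs_le] at hk
        refine mul_le_mul_of_nonneg_left (Real.exp_le_exp.2 ?_) hM0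
        nlinarith
    _ = _ := by rw [Real.exp_add]; ring

lemma dz_mono_ge {z : ℂ} (hz : z ≠ 0) (n : ℕ) :
    (n + 1) * Real.exp (Real.log (1/‖z‖) - Real.log (1/‖z‖)^2/2) ≤
      ‖dz (FF (fun _ => 1) (n+1)) z‖ := by
  have e : FF (fun _ => 1) (n+1) = fun z => ((Real.exp (-((n+1:ℕ):ℝ)^2/2) : ℂ) *
     (Real.exp (n+1:ℕ) • z) ^ (n+1)) := by ext z; rw [FF]; ring
  rw [e, dz_holo (mono_deriv (n+1) z), norm_mul, norm_mul, norm_mul, norm_pow, norm_scale hz,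
    Complex.norm_real, Complex.norm_real,
    Real.norm_eq_abs, Real.abs_exp, ← Real.exp_nat_mul, Real.norm_eq_abs, Real.abs_exp,
    Complex.norm_natCast]
  set t := Real.log (1/‖z‖)
  simp only [Nat.add_sub_cancel]
  push_cast
  calc _ ≤ ((n:ℝ)+1) * Real.exp (-((n:ℝ)+1)^2/2 + n * (n + 1 - t) + (n + 1)) := by
        gcongr
        nlinarith [sq_nonneg (n + 1 - t)]
    _ = _ := by rw [Real.exp_add, Real.exp_add]; ring

lemma vv_succ (n : ℕ) : (vv n) (ix (n+1)) = 0 := by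
  have : ix (n+1) ≠ ix n := by
    unfold ix
    rcases Nat.mod_two_eq_zero_or_one n with h | h <;> simp [h, Nat.add_mod]
  simp [vv, this]

lemma vv_self (n : ℕ) : (vv n) (ix n) = 1 := by simp [vv]

lemma norm_comb_ge (a b : ℂ) (n : ℕ) : ‖b‖ ≤ ‖a • vv n + b • vv (n+1)‖ := by
  have := PiLp.norm_apply_le (a • vv n + b • vv (n+1)) (ix (n+1))
  simpa [vv_succ, vv_self] using this

lemma exists_n {t : ℝ} (ht : 1/2 < t) : ∃ n : ℕ, |t - (n+1:ℕ)| ≤ 1/2 ∧ 2 * t ≤ 3 * (n+1) := by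
  have h1 := Nat.floor_le (show 0 ≤ t - 1/2 by linarith)
  have h2 := Nat.lt_floor_add_one (t - 1/2)
  refine ⟨⌊t - 1/2⌋₊, ?_, ?_⟩
  · push_cast
    rw [abs_le]; constructor <;> linarith
  · rcases Nat.eq_zero_or_pos ⌊t - 1/2⌋₊ with h | h
    · rw [h] at h2 ⊢; push_cast at h2 ⊢; linarith
    · have : (1:ℝ) ≤ (⌊t - 1/2⌋₊ : ℝ) := by exact_mod_cast h
      linarith

/-- There are a smooth `u : ℂ → ℂ²` and `C > 0` with: `u` vanishes to
infinite order at `0`, `u` is not identically `0` near `0`, and for `0 < |z| < 1/2`,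
`‖∂u/∂z̄(z)‖ ≤ (C / log(1/|z|)) · ‖∂u/∂z(z)‖`. -/
theorem example_log_gain :
    ∃ (u : ℂ → EuclideanSpace ℂ (Fin 2)) (C : ℝ), 0 < C ∧
      ContDiff ℝ (⊤ : ℕ∞) u ∧
      (∀ N : ℕ, 0 < N →
        (fun z : ℂ => ‖u z‖) =O[𝓝 (0 : ℂ)] fun z : ℂ => ‖z‖ ^ N) ∧
      (∀ V ∈ 𝓝 (0 : ℂ), ∃ z ∈ V, u z ≠ 0) ∧
      (∀ z : ℂ, 0 < ‖z‖ → ‖z‖ < 1 / 2 →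
        ‖dbar u z‖ ≤ (C / Real.log (1 / ‖z‖)) * ‖dz u z‖) := by
  obtain ⟨φ, ψ, hφ, hφc, hψ, hψc, hle, hone, h0, h0', hψ1⟩ := aux_bump
  have hd : Differentiable ℝ φ := hφ.differentiable (by simp)
  obtain ⟨M, hM0, hM⟩ : ∃ M : ℝ, 0 < M ∧ ∀ w, ‖dbar φ w‖ ≤ M := by
    obtain ⟨A, hA⟩ := (hφc.fderiv (𝕜 := ℝ)).exists_bound_of_continuous
      (hφ.continuous_fderiv (by simp))
    refine ⟨A + 1, by linarith [(norm_nonneg _).trans (hA 0)], fun w => ?_⟩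
    have h1 := (fderiv ℝ φ w).le_opNorm 1
    have h2 := (fderiv ℝ φ w).le_opNorm I
    have h3 := hA w
    rw [norm_one, mul_one] at h1
    rw [norm_I, mul_one] at h2
    rw [dbar, norm_smul]
    have h4 := norm_add_le (fderiv ℝ φ w 1) (I • fderiv ℝ φ w I)
    rw [norm_smul, norm_I, one_mul] at h4
    have h5 : ‖(2⁻¹ : ℝ)‖ = 1/2 := by norm_num
    rw [h5]
    linarith
  have hlog : ∀ z : ℂ, 0 < ‖z‖ → ‖z‖ < 1/2 → 1/2 < Real.log (1/‖z‖) := by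
    intro z hz hz2
    have : (2:ℝ) < 1/‖z‖ := by rw [lt_div_iff₀ hz]; linarith
    have h1 := Real.log_lt_log (by norm_num) this
    have h2 := Real.log_two_gt_d9
    linarith
  refine ⟨uu φ, 3 * M * Real.exp 3, by positivity, uu_smooth hφ hφc hψ hψc h0' hψ1, ?_, ?_, ?_⟩
  · intro N hN
    refine IsBigO.of_bound (3 * Real.exp (1 + (N:ℝ)^2/2)) ?_
    filter_upwards [Metric.ball_mem_nhds (0:ℂ) (show (0:ℝ) < 1/2 by norm_num)] with z hz
    rw [mem_ball_zero_iff] at hz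
    rw [norm_norm, norm_pow, norm_norm]
    by_cases hz0 : z = 0
    · have : uu φ z = 0 := by
        have h : ∀ k, FF φ k z = 0 := fun k => by
          rw [FF, hz0, smul_zero, h0 0 (by rw [norm_zero]; positivity)]; simp
        simp [uu, h]
      rw [this, norm_zero]; positivity
    · have hzp := norm_pos_iff.2 hz0
      obtain ⟨n, hn, -⟩ := exists_n (hlog z hzp hz)
      have hn' : |Real.log (1/‖z‖) - (n+1:ℕ)| < 0.6 := lt_of_le_of_lt hn (by norm_num)
      have hmon : FF (fun _ => 1) (n+1) z = FF φ (n+1) z := by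
        rw [abs_lt] at hn'
        simp only [FF]
        rw [hone]
        · rw [norm_scale hz0, Real.exp_le_exp]; linarith
        · rw [norm_scale hz0, Real.exp_le_exp]; linarith
      rw [uu_local hone h0 h0' hz0 n hn', hmon]
      have b := fun k => FF_le hle h0 h0' hz0 k
      have h1 := norm_add_le ((FF φ n z + FF φ (n+2) z) • vv n) (FF φ (n+1) z • vv (n+1))
      rw [norm_smul, norm_smul, vv_norm, vv_norm, mul_one, mul_one] at h1
      have h2 := norm_add_le (FF φ n z) (FF φ (n+2) z)
      have h3 : Real.exp (1 - Real.log (1/‖z‖) ^ 2 / 2) ≤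
          Real.exp (1 + (N:ℝ)^2/2) * ‖z‖ ^ N := by
        have : ‖z‖ ^ N = Real.exp (N * (- Real.log (1/‖z‖))) := by
          rw [one_div, Real.log_inv, neg_neg, Real.exp_nat_mul, Real.exp_log hzp]
        rw [this, ← Real.exp_add, Real.exp_le_exp]
        nlinarith [sq_nonneg (Real.log (1/‖z‖) - N)]
      linarith [b n, b (n+1), b (n+2)]
  · intro V hV
    have ht : Tendsto (fun n : ℕ => ((Real.exp (-((n:ℝ)+1)) : ℝ) : ℂ)) atTop (𝓝 0) := by
      have h1 : Tendsto (fun n : ℕ => Real.exp (-((n:ℝ)+1))) atTop (𝓝 0) :=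
        Real.tendsto_exp_neg_atTop_nhds_zero.comp
          (tendsto_atTop_add_const_right _ _ tendsto_natCast_atTop_atTop)
      have h2 := (Complex.continuous_ofReal.tendsto 0).comp h1
      rw [Complex.ofReal_zero] at h2
      exact h2
    obtain ⟨n, hn⟩ := (ht.eventually hV).exists
    refine ⟨_, hn, ?_⟩
    set z : ℂ := ((Real.exp (-((n:ℝ)+1)) : ℝ) : ℂ) with hz
    have hzn : ‖z‖ = Real.exp (-((n:ℝ)+1)) := by
      rw [hz, Complex.norm_real, Real.norm_eq_abs, Real.abs_exp]
    have hz0 : z ≠ 0 := by rw [← norm_pos_iff, hzn]; positivity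
    have hl : Real.log (1/‖z‖) = (n+1:ℕ) := by
      rw [one_div, Real.log_inv, hzn, Real.log_exp]; push_cast; ring
    rw [uu_local hone h0 h0' hz0 n (by rw [hl]; norm_num), ← norm_pos_iff]
    refine lt_of_lt_of_le ?_ (norm_comb_ge _ _ n)
    rw [norm_pos_iff, FF, one_mul]
    refine mul_ne_zero (by exact_mod_cast (Real.exp_pos _).ne') (pow_ne_zero _ ?_)
    exact smul_ne_zero (Real.exp_pos _).ne' hz0
  · intro z hzp hz
    have hz0 := norm_pos_iff.1 hzp
    have hl := hlog z hzp hz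
    obtain ⟨n, hn, hn3⟩ := exists_n hl
    have hev : uu φ =ᶠ[𝓝 z] fun z => (FF φ n z + FF φ (n+2) z) • vv n +
        FF (fun _ => 1) (n+1) z • vv (n+1) := by
      have hc : ContinuousAt (fun z : ℂ => |Real.log (1/‖z‖) - (n+1:ℕ)|) z := by
        have : ContinuousAt (fun z : ℂ => Real.log (1/‖z‖)) z :=
          ContinuousAt.log (continuousAt_const.div continuous_norm.continuousAt hzp.ne')
            (by positivity)
        exact (this.sub continuousAt_const).abs
      filter_upwards [hc.eventually (gt_mem_nhds (lt_of_le_of_lt hn (by norm_num : (1/2:ℝ) < 0.6))),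
        isOpen_ne.mem_nhds hz0] with y hy hy0
      exact uu_local hone h0 h0' hy0 n hy
    have d1 := FF_diff hd n z
    have d2 := FF_diff hd (n+2) z
    have d3 := FF_diff (φ := fun _ => 1) (differentiable_const _) (n+1) z
    have hb : dbar (FF (fun _ => 1) (n+1)) z = 0 := by
      have e : FF (fun _ => 1) (n+1) = fun z => ((Real.exp (-((n+1:ℕ):ℝ)^2/2) : ℂ) *
        (Real.exp (n+1:ℕ) • z) ^ (n+1)) := by ext z; rw [FF]; ring
      rw [e]; exact dbar_holo (mono_deriv (n+1) z)
    have e1' : dbar (uu φ) z = (dbar (FF φ n) z + dbar (FF φ (n+2)) z) • vv n := by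
      rw [← dbar_add d1 d2]
      refine Eq.trans ?_ ((dbar_comb (d1.fun_add d2) d3 (vv n) (vv (n+1))).trans ?_)
      · rw [dbar, hev.fderiv_eq]; rfl
      · rw [hb, zero_smul, add_zero]
    have e2' : dz (uu φ) z = dz (fun z => FF φ n z + FF φ (n+2) z) z • vv n +
        dz (FF (fun _ => 1) (n+1)) z • vv (n+1) := by
      rw [← dz_comb (d1.fun_add d2) d3 (vv n) (vv (n+1))]
      rw [dz, hev.fderiv_eq]; rfl
    have g1 : ‖dz (FF (fun _ => 1) (n+1)) z‖ ≤ ‖dz (uu φ) z‖ := by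
      rw [e2']; exact norm_comb_ge _ _ n
    have g2 := dz_mono_ge hz0 n
    rw [abs_le] at hn
    push_cast at hn
    have f1 := dbar_FF_le hd hM hz0 n (by rw [abs_le]; constructor <;> linarith)
    have f2 := dbar_FF_le hd hM hz0 (n+2) (by
      push_cast; rw [abs_le]; constructor <;> linarith)
    rw [e1', norm_smul, vv_norm, mul_one]
    refine (norm_add_le _ _).trans ((add_le_add f1 f2).trans ?_)
    set t := Real.log (1/‖z‖)
    set X := Real.exp (t - t^2/2)
    have ht0 : 0 < t := by linarith
    have hX : 0 < X := Real.exp_pos _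
    calc M * Real.exp 3 * X + M * Real.exp 3 * X
        = M * Real.exp 3 * X * (2 * t) / t := by field_simp; ring
      _ ≤ M * Real.exp 3 * X * (3 * (n+1)) / t := by gcongr
      _ = 3 * M * Real.exp 3 / t * ((n+1) * X) := by ring
      _ ≤ _ := by
        gcongr
        exact g2.trans g1
end

section
/- Let u : D → ℂⁿ be a C¹ map such that for some constant K > 0, ‖∂u/∂z̄(z)‖ ≤ K·‖u(z)‖^{1/2}·‖∂u/∂z(z)‖ for all z ∈ D. If u vanishes on some nonempty open subset of D, then u ≡ 0 on D. -/
open Complex MeasureTheory Metric Filter Asymptotics Topology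

open scoped Real Interval

noncomputable def fcK (k : ℤ) (g : ℝ → ℂ) : ℂ := fourierCoeffOn Real.two_pi_pos g k

lemma fcK_eq (k : ℤ) (g : ℝ → ℂ) :
    fcK k g = ((2 * π)⁻¹ : ℝ) • ∫ θ in (0:ℝ)..(2 * π), Complex.exp (-(I * k * θ)) * g θ := by
  unfold fcK
  rw [fourierCoeffOn_eq_integral]
  simp only [sub_zero, one_div, smul_eq_mul]
  congr 1
  apply intervalIntegral.integral_congr
  intro θ _
  simp only
  congr 1
  have h := fourier_coe_apply (T := 2 * π - 0) (n := -k) (x := θ)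
  simp only [sub_zero] at h
  rw [h]
  congr 1
  have : (π : ℂ) ≠ 0 := by exact_mod_cast Real.pi_ne_zero
  push_cast
  field_simp

lemma fcK_parseval {g : ℝ → ℂ} (hg : Continuous g) :
    HasSum (fun k : ℤ => ‖fcK k g‖ ^ 2) ((2 * π)⁻¹ * ∫ θ in (0:ℝ)..(2 * π), ‖g θ‖ ^ 2) := by
  have h : MemLp g 2 (volume.restrict (Set.Ioc 0 (2 * π))) := by
    obtain ⟨C, hC⟩ := (isCompact_Icc (a := (0:ℝ)) (b := 2 * π)).exists_bound_of_continuousOn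
      hg.continuousOn
    refine MemLp.of_bound hg.aestronglyMeasurable C ?_
    refine (ae_restrict_iff' measurableSet_Ioc).2 (ae_of_all _ fun x hx => ?_)
    exact hC x (Set.Ioc_subset_Icc_self hx)
  have := hasSum_sq_fourierCoeffOn Real.two_pi_pos h
  simpa [fcK] using this

lemma fcK_deriv {g g' : ℝ → ℂ} (hg : ∀ x, HasDerivAt g (g' x) x) (hg' : Continuous g')
    (hper : g (2 * π) = g 0) (k : ℤ) : fcK k g' = I * k * fcK k g := by
  rw [fcK_eq, fcK_eq]
  have hE : ∀ x : ℝ, HasDerivAt (fun θ : ℝ => Complex.exp (-(I * k * θ)))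
      (Complex.exp (-(I * k * x)) * (-(I * k))) x := by
    intro x
    have h1 : HasDerivAt (fun θ : ℝ => -(I * k * (θ : ℂ))) (-(I * k)) x := by
      have h2 := ((((hasDerivAt_id x).ofReal_comp).const_mul (I * k)).fun_neg)
      simpa using h2
    exact h1.cexp
  have hc : Continuous g := continuous_iff_continuousAt.2 fun x => (hg x).continuousAt
  have := intervalIntegral.integral_mul_deriv_eq_deriv_mul (a := 0) (b := 2 * π)
    (u := fun θ : ℝ => Complex.exp (-(I * k * θ))) (v := g) (v' := g')
    (u' := fun x : ℝ => Complex.exp (-(I * k * x)) * (-(I * k)))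
    (fun x _ => hE x) (fun x _ => hg x)
    (Continuous.intervalIntegrable (by fun_prop) _ _)
    (hg'.intervalIntegrable _ _)
  rw [this]
  have e1 : Complex.exp (-(I * k * ((2 * π : ℝ) : ℂ))) = 1 := by
    have := Complex.exp_int_mul_two_pi_mul_I (-k)
    rw [← this]; congr 1; push_cast; ring
  rw [e1, hper]
  have e2 : ∫ x in (0:ℝ)..(2 * π), Complex.exp (-(I * k * x)) * (-(I * k)) * g x
      = -(I * k) * ∫ x in (0:ℝ)..(2 * π), Complex.exp (-(I * k * x)) * g x := by
    rw [← intervalIntegral.integral_const_mul]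
    congr 1; ext x; ring
  rw [e2]
  simp
  ring

lemma fcK_cont {G : ℝ → ℝ → ℂ} (hG : Continuous (Function.uncurry G)) (k : ℤ) :
    Continuous (fun x => fcK k (G x)) := by
  simp_rw [fcK_eq]
  refine Continuous.fun_const_smul ?_ _
  apply intervalIntegral.continuous_parametric_intervalIntegral_of_continuous'
  have : Continuous (fun p : ℝ × ℝ => G p.1 p.2) := hG
  unfold Function.uncurry
  fun_prop

lemma fcK_lin {f g : ℝ → ℂ} (hf : Continuous f) (hg : Continuous g) (c : ℂ) (k : ℤ) :
    fcK k (fun x => f x + c * g x) = fcK k f + c * fcK k g := by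
  simp_rw [fcK_eq]
  rw [mul_smul_comm, ← smul_add, ← intervalIntegral.integral_const_mul,
    ← intervalIntegral.integral_add]
  · congr 2; ext x; ring
  · exact Continuous.intervalIntegrable (by fun_prop) _ _
  · exact Continuous.intervalIntegrable (by fun_prop) _ _

lemma fcK_hasDeriv {G G' : ℝ → ℝ → ℂ} (hG : Continuous (Function.uncurry G))
    (hG' : Continuous (Function.uncurry G'))
    (h : ∀ x θ, HasDerivAt (fun y => G y θ) (G' x θ) x) (k : ℤ) (x : ℝ) :
    HasDerivAt (fun x => fcK k (G x)) (fcK k (G' x)) x := by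
  simp_rw [fcK_eq]
  have hGc : Continuous (fun p : ℝ × ℝ => G p.1 p.2) := hG
  have hGc' : Continuous (fun p : ℝ × ℝ => G' p.1 p.2) := hG'
  have hE : Continuous (fun p : ℝ × ℝ => Complex.exp (-(I * k * p.2)) * G' p.1 p.2) := by fun_prop
  obtain ⟨C, hC⟩ := ((isCompact_Icc (a := x - 1) (b := x + 1)).prod
    (isCompact_Icc (a := (0:ℝ)) (b := 2 * π))).exists_bound_of_continuousOn hE.continuousOn
  have := intervalIntegral.hasDerivAt_integral_of_dominated_loc_of_deriv_le
    (μ := volume) (a := 0) (b := 2 * π) (x₀ := x) (s := Set.Icc (x - 1) (x + 1))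
    (F := fun x θ => Complex.exp (-(I * k * θ)) * G x θ)
    (F' := fun x θ => Complex.exp (-(I * k * θ)) * G' x θ) (bound := fun _ => C)
    (Icc_mem_nhds (by linarith) (by linarith))
    (Eventually.of_forall fun y => (Continuous.aestronglyMeasurable (by fun_prop)))
    (Continuous.intervalIntegrable (by fun_prop) _ _)
    (Continuous.aestronglyMeasurable (by fun_prop))
    (ae_of_all _ fun θ hθ y hy => by
      rw [Set.uIoc_of_le Real.two_pi_pos.le] at hθ
      exact hC (y, θ) ⟨hy, Set.Ioc_subset_Icc_self hθ⟩)
    (intervalIntegrable_const)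
    (ae_of_all _ fun θ hθ y hy => (h y θ).const_mul _)
  exact this.2.fun_const_smul ((2 * π)⁻¹ : ℝ)

lemma parseval2 {G : ℝ → ℝ → ℂ} (hG : Continuous (Function.uncurry G)) {W : ℝ → ℝ}
    (hW : Continuous W) (hW0 : ∀ x, 0 ≤ W x) (t : ℝ) :
    HasSum (fun k : ℤ => ∫ x in (0:ℝ)..t, W x * ‖fcK k (G x)‖ ^ 2)
      (∫ x in (0:ℝ)..t, W x * ((2 * π)⁻¹ * ∫ θ in (0:ℝ)..(2 * π), ‖G x θ‖ ^ 2)) := by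
  have hGc : Continuous (fun p : ℝ × ℝ => G p.1 p.2) := hG
  have hs : ∀ x, HasSum (fun k : ℤ => W x * ‖fcK k (G x)‖ ^ 2)
      (W x * ((2 * π)⁻¹ * ∫ θ in (0:ℝ)..(2 * π), ‖G x θ‖ ^ 2)) := fun x =>
    (fcK_parseval (g := G x) (by fun_prop)).mul_left (W x)
  have hc : Continuous (fun x => ∫ θ in (0:ℝ)..(2 * π), ‖G x θ‖ ^ 2) := by
    apply intervalIntegral.continuous_parametric_intervalIntegral_of_continuous'
    unfold Function.uncurry
    fun_prop
  have hk := fun k => fcK_cont hG k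
  apply intervalIntegral.hasSum_integral_of_dominated_convergence
    (fun (k : ℤ) x => W x * ‖fcK k (G x)‖ ^ 2)
  · intro k
    exact Continuous.aestronglyMeasurable (by have := hk k; fun_prop)
  · intro k
    refine ae_of_all _ fun x _ => ?_
    rw [Real.norm_of_nonneg]
    have := hW0 x
    positivity
  · exact ae_of_all _ fun x _ => (hs x).summable
  · have : (fun x => ∑' k : ℤ, W x * ‖fcK k (G x)‖ ^ 2) =
      fun x => W x * ((2 * π)⁻¹ * ∫ θ in (0:ℝ)..(2 * π), ‖G x θ‖ ^ 2) := by
      ext x; exact (hs x).tsum_eq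
    rw [this]
    exact Continuous.intervalIntegrable (by fun_prop) _ _
  · exact ae_of_all _ fun x _ => hs x

/-- one-dimensional weighted estimate -/
lemma oneD {v v' : ℝ → ℂ} (hv : ∀ x, HasDerivAt v (v' x) x) (hv' : Continuous v')
    (h0 : v 0 = 0) {τ t : ℝ} (hτ : 0 < τ) (ht : 0 < t) (k : ℤ) :
    ∫ x in (0:ℝ)..t, Real.exp (2 * τ * (-2 * x + x ^ 2 / (2 * t))) *
      (((k + τ * (-2 + x / t)) ^ 2 + τ / t) * ‖v x‖ ^ 2) ≤
    (∫ x in (0:ℝ)..t, Real.exp (2 * τ * (-2 * x + x ^ 2 / (2 * t))) * ‖v' x - k * v x‖ ^ 2) +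
      Real.exp (2 * τ * (-2 * t + t ^ 2 / (2 * t))) * (k ^ 2 * ‖v t‖ ^ 2) := by
  have hvc : Continuous v := continuous_iff_continuousAt.2 fun x => (hv x).continuousAt
  set W : ℝ → ℝ := fun x => Real.exp (2 * τ * (-2 * x + x ^ 2 / (2 * t))) with hW
  set a : ℝ → ℝ := fun x => k + τ * (-2 + x / t) with ha
  have hWc : Continuous W := by fun_prop
  have hac : Continuous a := by fun_prop
  have hWd : ∀ x, HasDerivAt W (W x * (2 * τ * (-2 + x / t))) x := by
    intro x
    have h1 : HasDerivAt (fun x : ℝ => 2 * τ * (-2 * x + x ^ 2 / (2 * t)))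
        (2 * τ * (-2 + x / t)) x := by
      have := ((((hasDerivAt_id' x).const_mul (-2)).fun_add
        (((hasDerivAt_id' x).fun_pow 2).div_const (2 * t))).const_mul (2 * τ))
      refine this.congr_deriv ?_
      field_simp
      push_cast
      ring
    exact h1.exp
  have had : ∀ x, HasDerivAt a (τ / t) x := by
    intro x
    have := ((((hasDerivAt_id' x).div_const t).const_add (-2)).const_mul τ).const_add (k : ℝ)
    refine this.congr_deriv ?_
    field_simp
  have hnd : ∀ x, HasDerivAt (fun y => ‖v y‖ ^ 2) (2 * inner ℝ (v x) (v' x)) x :=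
    fun x => (hv x).norm_sq
  set P : ℝ → ℝ := fun x => W x * (a x * ‖v x‖ ^ 2) with hP
  set P' : ℝ → ℝ := fun x => W x * (2 * τ * (-2 + x / t)) * (a x * ‖v x‖ ^ 2) +
    W x * (τ / t * ‖v x‖ ^ 2 + a x * (2 * inner ℝ (v x) (v' x))) with hP'
  have hPd : ∀ x, HasDerivAt P (P' x) x := fun x => (hWd x).mul ((had x).mul (hnd x))
  have hP'c : Continuous P' := by
    have : Continuous fun x => (inner ℝ (v x) (v' x) : ℝ) := hvc.inner hv'
    fun_prop
  have hint : ∫ x in (0:ℝ)..t, P' x = P t - P 0 :=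
    intervalIntegral.integral_eq_sub_of_hasDerivAt (fun x _ => hPd x) (hP'c.intervalIntegrable _ _)
  have hP0 : P 0 = 0 := by simp [hP, h0]
  have hPt : P t ≤ W t * (k ^ 2 * ‖v t‖ ^ 2) := by
    have : a t ≤ (k:ℝ) ^ 2 := by
      have h1 : (k : ℝ) ≤ (k:ℝ) ^ 2 := by exact_mod_cast Int.le_self_sq k
      have : a t = k - τ := by simp only [ha]; field_simp; ring
      linarith
    have := (Real.exp_pos (2 * τ * (-2 * t + t ^ 2 / (2 * t)))).le
    simp only [hP, hW]; gcongr
  have hmono : ∫ x in (0:ℝ)..t, W x * (((a x) ^ 2 + τ / t) * ‖v x‖ ^ 2) ≤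
      ∫ x in (0:ℝ)..t, (W x * ‖v' x - k * v x‖ ^ 2 + P' x) := by
    apply intervalIntegral.integral_mono_on ht.le
    · exact Continuous.intervalIntegrable (by fun_prop) _ _
    · exact Continuous.intervalIntegrable (by fun_prop) _ _
    · intro x _
      simp only [hP']
      have hWp : 0 < W x := Real.exp_pos _
      have key : ((a x) ^ 2 + τ / t) * ‖v x‖ ^ 2 ≤ ‖v' x - k * v x‖ ^ 2 +
        ((2 * τ * (-2 + x / t)) * (a x * ‖v x‖ ^ 2) +
          (τ / t * ‖v x‖ ^ 2 + a x * (2 * inner ℝ (v x) (v' x)))) := by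
        have e0 : τ * (-2 + x / t) = a x - k := by simp [ha]
        rw [show 2 * τ * (-2 + x / t) = 2 * (a x - k) by rw [← e0]; ring]
        generalize a x = A
        generalize τ / t = B
        have e1 : inner ℝ (v x) (v' x) = (v x).re * (v' x).re + (v x).im * (v' x).im := by
          rw [Complex.inner]; simp; ring
        have e2 : ‖v x‖ ^ 2 = (v x).re ^ 2 + (v x).im ^ 2 := by
          rw [Complex.sq_norm, Complex.normSq_apply]; ring
        have e3 : ‖v' x - k * v x‖ ^ 2 = ((v' x).re - k * (v x).re) ^ 2 +
          ((v' x).im - k * (v x).im) ^ 2 := by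
          rw [Complex.sq_norm, Complex.normSq_apply]; simp; ring
        rw [e1, e2, e3]
        nlinarith [sq_nonneg ((v' x).re - k * (v x).re + A * (v x).re),
          sq_nonneg ((v' x).im - k * (v x).im + A * (v x).im)]
      nlinarith [mul_le_mul_of_nonneg_left key hWp.le]
  rw [intervalIntegral.integral_add, hint, hP0] at hmono
  · show ∫ x in (0:ℝ)..t, W x * (((a x) ^ 2 + τ / t) * ‖v x‖ ^ 2) ≤
      (∫ x in (0:ℝ)..t, W x * ‖v' x - k * v x‖ ^ 2) + W t * (k ^ 2 * ‖v t‖ ^ 2)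
    linarith
  · exact Continuous.intervalIntegrable (by fun_prop) _ _
  · exact Continuous.intervalIntegrable (by fun_prop) _ _


noncomputable def wgt (τ t x : ℝ) : ℝ := Real.exp (2 * τ * (-2 * x + x ^ 2 / (2 * t)))

lemma wgt_pos (τ t x : ℝ) : 0 < wgt τ t x := Real.exp_pos _

lemma wgt_cont (τ t : ℝ) : Continuous (wgt τ t) := by unfold wgt; fun_prop

/-- weighted `L²` mass -/
noncomputable def wX {E : Type*} [NormedAddCommGroup E] (τ t : ℝ) (H : ℝ → ℝ → E) : ℝ :=
  ∫ x in (0:ℝ)..t, wgt τ t x * ((2 * π)⁻¹ * ∫ θ in (0:ℝ)..(2 * π), ‖H x θ‖ ^ 2)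

lemma slice_cont {E : Type*} [NormedAddCommGroup E] {H : ℝ → ℝ → E}
    (hH : Continuous (Function.uncurry H)) :
    Continuous (fun x => ∫ θ in (0:ℝ)..(2 * π), ‖H x θ‖ ^ 2) := by
  have hGc : Continuous (fun p : ℝ × ℝ => H p.1 p.2) := hH
  apply intervalIntegral.continuous_parametric_intervalIntegral_of_continuous'
  unfold Function.uncurry
  fun_prop

lemma carleman_scalar {G Gx Gθ : ℝ → ℝ → ℂ} (hG : Continuous (Function.uncurry G))
    (hGx : Continuous (Function.uncurry Gx)) (hGθ : Continuous (Function.uncurry Gθ))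
    (dx : ∀ x θ, HasDerivAt (fun y => G y θ) (Gx x θ) x)
    (dθ : ∀ x θ, HasDerivAt (fun y => G x y) (Gθ x θ) θ)
    (hper : ∀ x, G x (2 * π) = G x 0) (h0 : ∀ θ, G 0 θ = 0)
    {τ t : ℝ} (hτ : 0 < τ) (ht : 0 < t) (hτt : 1 ≤ 4 * (τ * t)) :
    wX τ t Gθ ≤ 16 * (τ * t) * (wX τ t (fun x θ => Gx x θ + I * Gθ x θ) +
      wgt τ t t * ((2 * π)⁻¹ * ∫ θ in (0:ℝ)..(2 * π), ‖Gθ t θ‖ ^ 2)) ∧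
    (τ / t) * wX τ t G ≤ (wX τ t (fun x θ => Gx x θ + I * Gθ x θ) +
      wgt τ t t * ((2 * π)⁻¹ * ∫ θ in (0:ℝ)..(2 * π), ‖Gθ t θ‖ ^ 2)) := by
  have hGc : Continuous (fun p : ℝ × ℝ => G p.1 p.2) := hG
  have hGxc : Continuous (fun p : ℝ × ℝ => Gx p.1 p.2) := hGx
  have hGθc : Continuous (fun p : ℝ × ℝ => Gθ p.1 p.2) := hGθ
  have hf : Continuous (Function.uncurry (fun x θ => Gx x θ + I * Gθ x θ)) := by
    unfold Function.uncurry; fun_prop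
  have hWc := wgt_cont τ t
  have hW0 : ∀ x, 0 ≤ wgt τ t x := fun x => (wgt_pos τ t x).le
  have S1 := parseval2 hG hWc hW0 t
  have S2 := parseval2 hGθ hWc hW0 t
  have S3 := parseval2 hf hWc hW0 t
  have S4 := (fcK_parseval (g := Gθ t) (by fun_prop)).mul_left (wgt τ t t)
  have S := S3.add S4
  have kθ : ∀ (k : ℤ) x, ‖fcK k (Gθ x)‖ ^ 2 = (k : ℝ) ^ 2 * ‖fcK k (G x)‖ ^ 2 := by
    intro k x
    rw [fcK_deriv (dθ x) (by fun_prop) (hper x) k, norm_mul, norm_mul, mul_pow, mul_pow]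
    simp
  have kf : ∀ (k : ℤ) x, fcK k (fun θ => Gx x θ + I * Gθ x θ)
      = fcK k (Gx x) - k * fcK k (G x) := by
    intro k x
    rw [fcK_lin (by fun_prop) (by fun_prop), fcK_deriv (dθ x) (by fun_prop) (hper x) k]
    linear_combination (k * fcK k (G x)) * I_mul_I
  have z0 : ∀ k, fcK k (G 0) = 0 := by
    intro k; rw [fcK_eq]; simp [h0]
  have main := fun k : ℤ => oneD (v := fun x => fcK k (G x)) (v' := fun x => fcK k (Gx x))
    (fun x => fcK_hasDeriv hG hGx dx k x) (fcK_cont hGx k) (z0 k) hτ ht k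
  have hvc := fun k => fcK_cont hG k
  have main' : ∀ k : ℤ, ∫ x in (0:ℝ)..t, wgt τ t x *
      (((k + τ * (-2 + x / t)) ^ 2 + τ / t) * ‖fcK k (G x)‖ ^ 2) ≤
      (∫ x in (0:ℝ)..t, wgt τ t x * ‖fcK k (fun θ => Gx x θ + I * Gθ x θ)‖ ^ 2) +
      wgt τ t t * ‖fcK k (Gθ t)‖ ^ 2 := by
    intro k
    simp_rw [kf, kθ]
    exact main k
  have hnn : ∀ x, x ∈ Set.Icc 0 t → ∀ k : ℤ,
      (k:ℝ) ^ 2 ≤ 16 * (τ * t) * ((k + τ * (-2 + x / t)) ^ 2 + τ / t) := by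
    intro x hx k
    have hy0 : 0 ≤ x / t := div_nonneg hx.1 ht.le
    have hy1 : x / t ≤ 1 := (div_le_one ht).2 hx.2
    generalize x / t = y at *
    have e : 16 * (τ * t) * ((k + τ * (-2 + y)) ^ 2 + τ / t)
      = 16 * (τ * t) * (k + τ * (-2 + y)) ^ 2 + 16 * τ ^ 2 := by field_simp
    rw [e]
    have h1 : 4 * (k + τ * (-2 + y)) ^ 2 ≤ 16 * (τ * t) * (k + τ * (-2 + y)) ^ 2 := by
      nlinarith [sq_nonneg (k + τ * (-2 + y))]
    have h2 : (τ * (-2 + y)) ^ 2 ≤ 4 * τ ^ 2 := by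
      rw [mul_pow]
      have h3 : (-2 + y) ^ 2 ≤ 4 := by nlinarith
      nlinarith [sq_nonneg τ]
    nlinarith [sq_nonneg ((k + τ * (-2 + y)) + (τ * (-2 + y)))]
  constructor
  · refine hasSum_le (fun k => ?_) S2 (S.mul_left (16 * (τ * t)))
    refine le_trans ?_ (mul_le_mul_of_nonneg_left (main' k) (by positivity))
    rw [← intervalIntegral.integral_const_mul]
    apply intervalIntegral.integral_mono_on ht.le
    · have := fcK_cont hGθ k
      exact Continuous.intervalIntegrable (by fun_prop) _ _
    · have := hvc k
      exact Continuous.intervalIntegrable (by fun_prop) _ _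
    · intro x hx
      rw [kθ]
      have := mul_le_mul_of_nonneg_left (mul_le_mul_of_nonneg_right (hnn x hx k)
        (sq_nonneg ‖fcK k (G x)‖)) (hW0 x)
      linarith
  · refine hasSum_le (fun k => ?_) (S1.mul_left (τ / t)) S
    refine le_trans ?_ (main' k)
    rw [← intervalIntegral.integral_const_mul]
    apply intervalIntegral.integral_mono_on ht.le
    · have := hvc k
      exact Continuous.intervalIntegrable (by fun_prop) _ _
    · have := hvc k
      exact Continuous.intervalIntegrable (by fun_prop) _ _
    · intro x hx
      have := mul_nonneg (hW0 x) (mul_nonneg (sq_nonneg (k + τ * (-2 + x / t)))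
        (sq_nonneg ‖fcK k (G x)‖))
      linarith

lemma slice_sum {n : ℕ} {g : ℝ → EuclideanSpace ℂ (Fin n)} (hg : Continuous g) :
    ∫ θ in (0:ℝ)..(2 * π), ‖g θ‖ ^ 2 = ∑ j, ∫ θ in (0:ℝ)..(2 * π), ‖g θ j‖ ^ 2 := by
  rw [← intervalIntegral.integral_finsetSum]
  · simp_rw [EuclideanSpace.norm_sq_eq]
  · intro j _
    exact Continuous.intervalIntegrable (by fun_prop) _ _

lemma wX_sum {n : ℕ} {H : ℝ → ℝ → EuclideanSpace ℂ (Fin n)}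
    (hH : Continuous (Function.uncurry H)) (τ t : ℝ) :
    wX τ t H = ∑ j, wX τ t (fun x θ => H x θ j) := by
  have hGc : Continuous (fun p : ℝ × ℝ => H p.1 p.2) := hH
  have hWc := wgt_cont τ t
  unfold wX
  rw [← intervalIntegral.integral_finsetSum]
  · congr 1; ext x
    rw [slice_sum (by fun_prop), Finset.mul_sum, Finset.mul_sum]
  · intro j _
    have := slice_cont (H := fun x θ => H x θ j) (by unfold Function.uncurry; fun_prop)
    exact Continuous.intervalIntegrable (by fun_prop) _ _

lemma carleman_vec {n : ℕ} {G Gx Gθ : ℝ → ℝ → EuclideanSpace ℂ (Fin n)}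
    (hG : Continuous (Function.uncurry G))
    (hGx : Continuous (Function.uncurry Gx)) (hGθ : Continuous (Function.uncurry Gθ))
    (dx : ∀ x θ, HasDerivAt (fun y => G y θ) (Gx x θ) x)
    (dθ : ∀ x θ, HasDerivAt (fun y => G x y) (Gθ x θ) θ)
    (hper : ∀ x, G x (2 * π) = G x 0) (h0 : ∀ θ, G 0 θ = 0)
    {τ t : ℝ} (hτ : 0 < τ) (ht : 0 < t) (hτt : 1 ≤ 4 * (τ * t)) :
    wX τ t Gθ ≤ 16 * (τ * t) * (wX τ t (fun x θ => Gx x θ + I • Gθ x θ) +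
      wgt τ t t * ((2 * π)⁻¹ * ∫ θ in (0:ℝ)..(2 * π), ‖Gθ t θ‖ ^ 2)) ∧
    (τ / t) * wX τ t G ≤ (wX τ t (fun x θ => Gx x θ + I • Gθ x θ) +
      wgt τ t t * ((2 * π)⁻¹ * ∫ θ in (0:ℝ)..(2 * π), ‖Gθ t θ‖ ^ 2)) := by
  have hGc : Continuous (fun p : ℝ × ℝ => G p.1 p.2) := hG
  have hGxc : Continuous (fun p : ℝ × ℝ => Gx p.1 p.2) := hGx
  have hGθc : Continuous (fun p : ℝ × ℝ => Gθ p.1 p.2) := hGθ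
  have P : ∀ j : Fin n, ∀ {f : ℝ → EuclideanSpace ℂ (Fin n)} {f' : EuclideanSpace ℂ (Fin n)}
      {x : ℝ}, HasDerivAt f f' x → HasDerivAt (fun y => f y j) (f' j) x := by
    intro j f f' x h
    exact ((EuclideanSpace.proj (𝕜 := ℂ) j).restrictScalars ℝ).hasFDerivAt.comp_hasDerivAt x h
  have C := fun j : Fin n => carleman_scalar (G := fun x θ => G x θ j)
    (Gx := fun x θ => Gx x θ j) (Gθ := fun x θ => Gθ x θ j)
    (by unfold Function.uncurry; fun_prop) (by unfold Function.uncurry; fun_prop)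
    (by unfold Function.uncurry; fun_prop)
    (fun x θ => P j (dx x θ)) (fun x θ => P j (dθ x θ)) (fun x => by simp only [hper x])
    (fun θ => by simp [h0]) hτ ht hτt
  rw [wX_sum hG, wX_sum hGθ, wX_sum (H := fun x θ => Gx x θ + I • Gθ x θ)
    (by unfold Function.uncurry; fun_prop), slice_sum (g := Gθ t) (by fun_prop),
    Finset.mul_sum, Finset.mul_sum, ← Finset.sum_add_distrib, Finset.mul_sum, Finset.mul_sum]
  exact ⟨Finset.sum_le_sum fun j _ => (C j).1, Finset.sum_le_sum fun j _ => (C j).2⟩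

lemma box_est {n : ℕ} {G Gx Gθ : ℝ → ℝ → EuclideanSpace ℂ (Fin n)}
    (hG : Continuous (Function.uncurry G))
    (hGx : Continuous (Function.uncurry Gx)) (hGθ : Continuous (Function.uncurry Gθ))
    (dx : ∀ x θ, HasDerivAt (fun y => G y θ) (Gx x θ) x)
    (dθ : ∀ x θ, HasDerivAt (fun y => G x y) (Gθ x θ) θ)
    (hper : ∀ x, G x (2 * π) = G x 0) (h0 : ∀ θ, G 0 θ = 0)
    {τ t : ℝ} (hτ : 0 < τ) (ht : 0 < t) (hτt : 1 ≤ 4 * (τ * t))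
    {δ M : ℝ} (hδ0 : 0 ≤ δ) (hδ : 32 * (τ * t) * δ ≤ 1)
    (hineq : ∀ x ∈ Set.Icc 0 t, ∀ θ, ‖Gx x θ + I • Gθ x θ‖ ^ 2 ≤ δ * ‖Gθ x θ‖ ^ 2)
    (hM : ∀ θ, ‖Gθ t θ‖ ≤ M)
    {s σ μ : ℝ} (hs : s ≤ t) (hσ0 : 0 ≤ σ) (hσs : σ ≤ s) (hσπ : σ ≤ 2 * π) (hμ : 0 ≤ μ)
    (hlow : ∀ x ∈ Set.Icc (s - σ) s, ∀ θ ∈ Set.Icc 0 σ, μ ≤ ‖G x θ‖) :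
    (τ / t) * (Real.exp (2 * (τ * (t - s))) * (σ ^ 2 * μ ^ 2)) ≤ 4 * π * M ^ 2 := by
  have hGc : Continuous (fun p : ℝ × ℝ => G p.1 p.2) := hG
  have hGxc : Continuous (fun p : ℝ × ℝ => Gx p.1 p.2) := hGx
  have hGθc : Continuous (fun p : ℝ × ℝ => Gθ p.1 p.2) := hGθ
  have hπ := Real.pi_pos
  have hWc := wgt_cont τ t
  have hf : Continuous (Function.uncurry (fun x θ => Gx x θ + I • Gθ x θ)) := by
    unfold Function.uncurry; fun_prop
  obtain ⟨c1, c2⟩ := carleman_vec hG hGx hGθ dx dθ hper h0 hτ ht hτt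
  have hQ : (2 * π)⁻¹ * ∫ θ in (0:ℝ)..(2 * π), ‖Gθ t θ‖ ^ 2 ≤ M ^ 2 := by
    have : ∫ θ in (0:ℝ)..(2 * π), ‖Gθ t θ‖ ^ 2 ≤ ∫ θ in (0:ℝ)..(2 * π), M ^ 2 := by
      apply intervalIntegral.integral_mono_on (by positivity)
      · exact Continuous.intervalIntegrable (by fun_prop) _ _
      · exact intervalIntegrable_const
      · intro θ _
        have := hM θ
        gcongr
    rw [intervalIntegral.integral_const, sub_zero, smul_eq_mul] at this
    rw [inv_mul_le_iff₀ (by positivity)]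
    exact this
  have hX : wX τ t (fun x θ => Gx x θ + I • Gθ x θ) ≤ δ * wX τ t Gθ := by
    unfold wX
    rw [← intervalIntegral.integral_const_mul]
    have i1 := slice_cont hf
    have i2 := slice_cont hGθ
    apply intervalIntegral.integral_mono_on ht.le
    · exact Continuous.intervalIntegrable (by fun_prop) _ _
    · exact Continuous.intervalIntegrable (by fun_prop) _ _
    · intro x hx
      have : ∫ θ in (0:ℝ)..(2 * π), ‖Gx x θ + I • Gθ x θ‖ ^ 2 ≤
          ∫ θ in (0:ℝ)..(2 * π), δ * ‖Gθ x θ‖ ^ 2 := by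
        apply intervalIntegral.integral_mono_on (by positivity)
        · exact Continuous.intervalIntegrable (by fun_prop) _ _
        · exact Continuous.intervalIntegrable (by fun_prop) _ _
        · intro θ _
          exact hineq x hx θ
      rw [intervalIntegral.integral_const_mul] at this
      have := mul_le_mul_of_nonneg_left this
        (mul_nonneg (wgt_pos τ t x).le (inv_nonneg.2 (mul_pos two_pos hπ).le))
      linarith
  have hXlow : wgt τ t s * ((2 * π)⁻¹ * (σ ^ 2 * μ ^ 2)) ≤ wX τ t G := by
    unfold wX
    have i1 := slice_cont hG
    have hcont : Continuous fun x => wgt τ t x *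
      ((2 * π)⁻¹ * ∫ θ in (0:ℝ)..(2 * π), ‖G x θ‖ ^ 2) := by fun_prop
    have step : ∫ x in (s - σ)..s, wgt τ t x *
        ((2 * π)⁻¹ * ∫ θ in (0:ℝ)..(2 * π), ‖G x θ‖ ^ 2) ≤
        ∫ x in (0:ℝ)..t, wgt τ t x * ((2 * π)⁻¹ * ∫ θ in (0:ℝ)..(2 * π), ‖G x θ‖ ^ 2) := by
      apply intervalIntegral.integral_mono_interval (by linarith) (by linarith) hs
      · refine ae_of_all _ fun x => ?_
        have : 0 ≤ ∫ θ in (0:ℝ)..(2 * π), ‖G x θ‖ ^ 2 :=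
          intervalIntegral.integral_nonneg (by positivity) fun _ _ => by positivity
        have := (wgt_pos τ t x).le
        simp only [Pi.zero_apply]
        positivity
      · exact hcont.intervalIntegrable _ _
    refine le_trans ?_ step
    have step2 : ∫ x in (s - σ)..s, wgt τ t s * ((2 * π)⁻¹ * (σ * μ ^ 2)) ≤ ∫ x in (s - σ)..s,
        wgt τ t x * ((2 * π)⁻¹ * ∫ θ in (0:ℝ)..(2 * π), ‖G x θ‖ ^ 2) := by
      apply intervalIntegral.integral_mono_on (by linarith)
      · exact intervalIntegrable_const
      · exact hcont.intervalIntegrable _ _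
      · intro x hx
        have w1 : wgt τ t s ≤ wgt τ t x := by
          unfold wgt
          apply Real.exp_le_exp.2
          apply mul_le_mul_of_nonneg_left _ (by positivity)
          have : s ^ 2 / (2 * t) - x ^ 2 / (2 * t) ≤ s - x := by
            rw [← sub_div, div_le_iff₀ (by positivity)]
            nlinarith [hx.1, hx.2]
          linarith [hx.2]
        have w2 : σ * μ ^ 2 ≤ ∫ θ in (0:ℝ)..(2 * π), ‖G x θ‖ ^ 2 := by
          have a1 : ∫ θ in (0:ℝ)..σ, ‖G x θ‖ ^ 2 ≤ ∫ θ in (0:ℝ)..(2 * π), ‖G x θ‖ ^ 2 := by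
            apply intervalIntegral.integral_mono_interval le_rfl hσ0 hσπ
            · exact ae_of_all _ fun x => by simp only [Pi.zero_apply]; positivity
            · exact Continuous.intervalIntegrable (by fun_prop) _ _
          have a2 : ∫ θ in (0:ℝ)..σ, μ ^ 2 ≤ ∫ θ in (0:ℝ)..σ, ‖G x θ‖ ^ 2 := by
            apply intervalIntegral.integral_mono_on hσ0
            · exact intervalIntegrable_const
            · exact Continuous.intervalIntegrable (by fun_prop) _ _
            · intro θ hθ
              have := hlow x hx θ hθ
              gcongr
          rw [intervalIntegral.integral_const, sub_zero, smul_eq_mul] at a2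
          exact a2.trans a1
        have := (wgt_pos τ t x).le
        gcongr
    rw [intervalIntegral.integral_const, smul_eq_mul] at step2
    refine le_trans (le_of_eq ?_) step2
    ring
  have hws : wgt τ t t * Real.exp (2 * (τ * (t - s))) ≤ wgt τ t s := by
    unfold wgt
    rw [← Real.exp_add]
    apply Real.exp_le_exp.2
    have e : 2 * τ * (-2 * s + s ^ 2 / (2 * t)) -
      (2 * τ * (-2 * t + t ^ 2 / (2 * t)) + 2 * (τ * (t - s))) = τ * (t - s) ^ 2 / t := by
      field_simp; ring
    have : 0 ≤ τ * (t - s) ^ 2 / t := by positivity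
    linarith
  have hWt := wgt_pos τ t t
  set Q := wgt τ t t * ((2 * π)⁻¹ * ∫ θ in (0:ℝ)..(2 * π), ‖Gθ t θ‖ ^ 2) with hQd
  have hQ' : Q ≤ wgt τ t t * M ^ 2 := mul_le_mul_of_nonneg_left hQ hWt.le
  set A := wX τ t Gθ
  have hτt0 : 0 < τ * t := by positivity
  have hA : A ≤ 32 * (τ * t) * Q := by
    have hA0 : 0 ≤ A := by
      refine intervalIntegral.integral_nonneg ht.le fun x _ => ?_
      have : 0 ≤ ∫ θ in (0:ℝ)..(2 * π), ‖Gθ x θ‖ ^ 2 :=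
          intervalIntegral.integral_nonneg (by positivity) fun _ _ => by positivity
      have := (wgt_pos τ t x).le
      positivity
    have h1 : A ≤ 16 * (τ * t) * (δ * A + Q) :=
      c1.trans (mul_le_mul_of_nonneg_left (by linarith) (by positivity))
    have h2 : 32 * (τ * t) * δ * A ≤ 1 * A := mul_le_mul_of_nonneg_right hδ hA0
    linarith
  have hQ0 : 0 ≤ Q := by
    have : 0 ≤ ∫ θ in (0:ℝ)..(2 * π), ‖Gθ t θ‖ ^ 2 :=
          intervalIntegral.integral_nonneg (by positivity) fun _ _ => by positivity
    positivity
  have hδA : δ * A ≤ Q := by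
    have h1 := mul_le_mul_of_nonneg_left hA hδ0
    have h2 := mul_le_mul_of_nonneg_right hδ hQ0
    linarith
  have h3 : τ / t * wX τ t G ≤ 2 * (wgt τ t t * M ^ 2) := by linarith
  have h4 : τ / t * (wgt τ t t * Real.exp (2 * (τ * (t - s))) * ((2 * π)⁻¹ * (σ ^ 2 * μ ^ 2)))
      ≤ 2 * (wgt τ t t * M ^ 2) := by
    refine le_trans ?_ h3
    apply mul_le_mul_of_nonneg_left _ (by positivity)
    refine le_trans ?_ hXlow
    apply mul_le_mul_of_nonneg_right hws (by positivity)
  have h5 : wgt τ t t * (τ / t * (Real.exp (2 * (τ * (t - s))) * (σ ^ 2 * μ ^ 2))) ≤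
      wgt τ t t * (4 * π * M ^ 2) := by
    have e : wgt τ t t * (τ / t * (Real.exp (2 * (τ * (t - s))) * (σ ^ 2 * μ ^ 2))) = (2 * π) *
      (τ / t * (wgt τ t t * Real.exp (2 * (τ * (t - s))) * ((2 * π)⁻¹ * (σ ^ 2 * μ ^ 2)))) := by
      field_simp
    rw [e]
    have := mul_le_mul_of_nonneg_left h4 (mul_pos two_pos hπ).le
    linarith
  exact le_of_mul_le_mul_left h5 hWt


lemma step_est {n : ℕ} {G Gx Gθ : ℝ → ℝ → EuclideanSpace ℂ (Fin n)}
    (hG : Continuous (Function.uncurry G))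
    (hGx : Continuous (Function.uncurry Gx)) (hGθ : Continuous (Function.uncurry Gθ))
    (dx : ∀ x θ, HasDerivAt (fun y => G y θ) (Gx x θ) x)
    (dθ : ∀ x θ, HasDerivAt (fun y => G x y) (Gθ x θ) θ)
    (hper : ∀ x θ, G x (θ + 2 * π) = G x θ) (h0 : ∀ θ, G 0 θ = 0)
    {t0 M L : ℝ} (ht1 : t0 ≤ 1) (hM0 : 0 < M) (hL : 0 < L)
    (hMx : ∀ x ∈ Set.Icc 0 t0, ∀ θ, ‖Gx x θ‖ ≤ M)
    (hMθ : ∀ x ∈ Set.Icc 0 t0, ∀ θ, ‖Gθ x θ‖ ≤ M) :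
    ∃ C > 0, ∀ t m : ℝ, 0 < t → t ≤ t0 → 0 < m → m * (8 * L) ≤ 1 →
      (∀ x ∈ Set.Icc 0 t, ∀ θ, ‖Gx x θ + I • Gθ x θ‖ ^ 2 ≤ L * m * ‖Gθ x θ‖ ^ 2) →
      ∀ s, s < t → ∀ x ∈ Set.Icc 0 s, ∀ θ, ‖G x θ‖ ≤ C * m ^ 2 * (t / (t - s)) ^ 2 := by
  have hGc : Continuous (fun p : ℝ × ℝ => G p.1 p.2) := hG
  have hGxc : Continuous (fun p : ℝ × ℝ => Gx p.1 p.2) := hGx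
  have hGθc : Continuous (fun p : ℝ × ℝ => Gθ p.1 p.2) := hGθ
  have hπ := Real.pi_pos
  set C0 : ℝ := 256 * π * M ^ 4 * (32 * L) * 5040 * (16 * L) ^ 7 with hC0
  have hC0p : 0 < C0 := by positivity
  refine ⟨1 + C0, by positivity, ?_⟩
  intro t m ht htt0 hm hmL hineq s hst x0 hx0 θ0
  have lipx : ∀ θ, ∀ x ∈ Set.Icc 0 t0, ∀ y ∈ Set.Icc 0 t0, ‖G y θ - G x θ‖ ≤ M * ‖y - x‖ := by
    intro θ x hx y hy
    exact (convex_Icc 0 t0).norm_image_sub_le_of_norm_hasDerivWithin_le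
      (f := fun y => G y θ) (f' := fun y => Gx y θ)
      (fun z _ => (dx z θ).hasDerivWithinAt) (fun z hz => hMx z hz θ) hx hy
  have lipθ : ∀ x ∈ Set.Icc 0 t0, ∀ θ θ', ‖G x θ' - G x θ‖ ≤ M * ‖θ' - θ‖ := by
    intro x hx θ θ'
    exact convex_univ.norm_image_sub_le_of_norm_hasDerivWithin_le
      (f := fun y => G x y) (f' := fun y => Gθ x y)
      (fun z _ => (dθ x z).hasDerivWithinAt) (fun z _ => hMθ x hx z) trivial trivial
  have hx0t : x0 < t := lt_of_le_of_lt hx0.2 hst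
  have hx0m : x0 ∈ Set.Icc 0 t0 := ⟨hx0.1, by linarith⟩
  set μ := ‖G x0 θ0‖ with hμ
  have hμ0 : 0 ≤ μ := norm_nonneg _
  have hμx : μ ≤ M * x0 := by
    have := lipx θ0 0 ⟨le_rfl, by linarith⟩ x0 hx0m
    simpa [h0, abs_of_nonneg hx0.1] using this
  set σ := μ / (4 * M) with hσ
  have hσ0 : 0 ≤ σ := by positivity
  have hMσ : M * σ = μ / 4 := by rw [hσ]; field_simp
  have hσx : σ ≤ x0 := by nlinarith
  set τ := 1 / (32 * L * m * t) with hτ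
  have hτ0 : 0 < τ := by positivity
  have hτt : τ * t = 1 / (32 * L * m) := by rw [hτ]; field_simp
  have box := box_est (G := fun x θ => G x (θ + θ0)) (Gx := fun x θ => Gx x (θ + θ0))
    (Gθ := fun x θ => Gθ x (θ + θ0)) (by unfold Function.uncurry; fun_prop)
    (by unfold Function.uncurry; fun_prop) (by unfold Function.uncurry; fun_prop)
    (fun x θ => dx x (θ + θ0)) (fun x θ => (dθ x (θ + θ0)).comp_add_const θ θ0)
    (fun x => by rw [add_comm, hper, zero_add]) (fun θ => h0 _) hτ0 ht
    (by rw [hτt, mul_one_div, le_div_iff₀ (by positivity)]; linarith)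
    (δ := L * m) (M := M) (by positivity)
    (by rw [hτt]; apply le_of_eq; field_simp)
    (fun x hx θ => hineq x hx _) (fun θ => hMθ t ⟨ht.le, htt0⟩ _) hx0t.le hσ0 hσx
    (by linarith [Real.pi_gt_three]) (μ := μ / 2) (by positivity)
    (by
      intro x hx θ hθ
      have hxm : x ∈ Set.Icc 0 t0 := ⟨by linarith [hx.1], by linarith [hx.2]⟩
      have l1 := lipx (θ + θ0) x hxm x0 hx0m
      have l2 := lipθ x0 hx0m (θ + θ0) θ0
      have n1 : ‖x0 - x‖ ≤ σ := by
        rw [Real.norm_eq_abs, abs_le]; constructor <;> linarith [hx.1, hx.2]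
      have n2 : ‖θ0 - (θ + θ0)‖ ≤ σ := by
        rw [Real.norm_eq_abs, abs_le]; constructor <;> linarith [hθ.1, hθ.2]
      have m1 := mul_le_mul_of_nonneg_left n1 hM0.le
      have m2 := mul_le_mul_of_nonneg_left n2 hM0.le
      have tri : μ ≤ ‖G x0 θ0 - G x0 (θ + θ0)‖ + ‖G x0 (θ + θ0) - G x (θ + θ0)‖ +
          ‖G x (θ + θ0)‖ := by
        have e : G x0 θ0 = (G x0 θ0 - G x0 (θ + θ0)) + (G x0 (θ + θ0) - G x (θ + θ0)) +
          G x (θ + θ0) := by abel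
        rw [hμ]
        conv_lhs => rw [e]
        exact norm_add₃_le
      linarith)
  have hts : 0 < t - s := by linarith
  set b := t / (t - s) with hb
  have hb0 : 0 < b := by positivity
  have hb1 : 1 ≤ b := by
    rw [hb, le_div_iff₀ hts]; linarith [hx0.1, hx0.2]
  set y := 1 / (16 * L * m * b) with hy
  have hy0 : 0 < y := by positivity
  have hyle : y ≤ 2 * (τ * (t - x0)) := by
    have : y = 2 * (τ * (t - s)) := by rw [hy, hb, hτ]; field_simp; norm_num
    rw [this]
    have := hx0.2
    gcongr
  have hexp : y ^ 7 / 5040 ≤ Real.exp (2 * (τ * (t - x0))) := by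
    have h1 := Real.pow_div_factorial_le_exp y hy0.le 7
    have h2 : ((Nat.factorial 7 : ℕ) : ℝ) = 5040 := by norm_num [Nat.factorial]
    rw [h2] at h1
    exact h1.trans (Real.exp_le_exp.2 hyle)
  have hfin : τ / t * (y ^ 7 / 5040 * (σ ^ 2 * (μ / 2) ^ 2)) ≤ 4 * π * M ^ 2 := by
    refine le_trans ?_ box
    gcongr
  have hpow : μ ^ 4 ≤ C0 * m ^ 8 * (b ^ 7 * t ^ 2) := by
    have e : τ / t * (y ^ 7 / 5040 * (σ ^ 2 * (μ / 2) ^ 2)) =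
        μ ^ 4 * (1 / (32 * L * m * t ^ 2) * (1 / (16 * L * m * b) ^ 7 / 5040) / (64 * M ^ 2)) := by
      rw [hτ, hy, hσ]; field_simp; ring
    rw [e] at hfin
    have hp : 0 < (32 * L * m * t ^ 2) * ((16 * L * m * b) ^ 7 * 5040) * (64 * M ^ 2) := by
      positivity
    have := mul_le_mul_of_nonneg_right hfin hp.le
    have e1 : μ ^ 4 * (1 / (32 * L * m * t ^ 2) * (1 / (16 * L * m * b) ^ 7 / 5040) / (64 * M ^ 2))
      * ((32 * L * m * t ^ 2) * ((16 * L * m * b) ^ 7 * 5040) * (64 * M ^ 2)) = μ ^ 4 := by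
      field_simp
    rw [e1] at this
    refine this.trans (le_of_eq ?_)
    rw [hC0]; ring
  have hbt : b ^ 7 * t ^ 2 ≤ b ^ 8 := by
    have : t ^ 2 ≤ b := by nlinarith
    calc b ^ 7 * t ^ 2 ≤ b ^ 7 * b := by gcongr
      _ = b ^ 8 := by ring
  have hC4 : C0 ≤ (1 + C0) ^ 4 := by
    have : 1 + C0 ≤ (1 + C0) ^ 4 := le_self_pow₀ (by linarith) (by norm_num)
    linarith
  have : μ ^ 4 ≤ ((1 + C0) * m ^ 2 * b ^ 2) ^ 4 := by
    calc μ ^ 4 ≤ C0 * m ^ 8 * (b ^ 7 * t ^ 2) := hpow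
      _ ≤ (1 + C0) ^ 4 * m ^ 8 * b ^ 8 := by gcongr
      _ = _ := by ring
  exact le_of_pow_le_pow_left₀ (by norm_num) (by positivity) this

lemma iter_est {n : ℕ} {G Gx Gθ : ℝ → ℝ → EuclideanSpace ℂ (Fin n)}
    (hG : Continuous (Function.uncurry G))
    (hGx : Continuous (Function.uncurry Gx)) (hGθ : Continuous (Function.uncurry Gθ))
    (dx : ∀ x θ, HasDerivAt (fun y => G y θ) (Gx x θ) x)
    (dθ : ∀ x θ, HasDerivAt (fun y => G x y) (Gθ x θ) θ)
    (hper : ∀ x θ, G x (θ + 2 * π) = G x θ) (h0 : ∀ θ, G 0 θ = 0)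
    {t0 M L : ℝ} (ht0 : 0 < t0) (ht1 : t0 ≤ 1) (hM0 : 0 < M) (hL : 0 < L)
    (hMx : ∀ x ∈ Set.Icc 0 t0, ∀ θ, ‖Gx x θ‖ ≤ M)
    (hMθ : ∀ x ∈ Set.Icc 0 t0, ∀ θ, ‖Gθ x θ‖ ≤ M)
    (hineq : ∀ m, 0 < m → m * (8 * L) ≤ 1 → ∀ x ∈ Set.Icc 0 t0, ∀ θ, ‖G x θ‖ ≤ m →
      ‖Gx x θ + I • Gθ x θ‖ ^ 2 ≤ L * m * ‖Gθ x θ‖ ^ 2) :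
    ∃ s > 0, ∀ x ∈ Set.Icc 0 s, ∀ θ, G x θ = 0 := by
  obtain ⟨C, hC, step⟩ := step_est hG hGx hGθ dx dθ hper h0 ht1 hM0 hL hMx hMθ
  obtain ⟨ε, hε0, hε1, hε2, hε3⟩ : ∃ ε > 0, ε * (8 * L) ≤ 1 ∧ ε * (128 * C) ≤ 1 ∧ ε ≤ M * t0 := by
    refine ⟨min (1 / (8 * L)) (min (1 / (128 * C)) (M * t0)), by positivity, ?_, ?_, ?_⟩
    · rw [← le_div_iff₀ (by positivity)]; exact min_le_left _ _
    · rw [← le_div_iff₀ (by positivity)]; exact (min_le_right _ _).trans (min_le_left _ _)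
    · exact (min_le_right _ _).trans (min_le_right _ _)
  set t1 := ε / M with ht1d
  have ht1p : 0 < t1 := by positivity
  have ht10 : t1 ≤ t0 := by rw [ht1d, div_le_iff₀ hM0]; linarith
  have hMt : M * t1 = ε := by rw [ht1d]; field_simp
  have key : ∀ j : ℕ, ∀ x ∈ Set.Icc 0 (t1 * (1 + (1 / 2) ^ j) / 2), ∀ θ,
      ‖G x θ‖ ≤ ε * (1 / 8) ^ j := by
    intro j
    induction j with
    | zero =>
      intro x hx θ
      have hx' : x ∈ Set.Icc 0 t0 := ⟨hx.1, by have := hx.2; norm_num at this; linarith⟩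
      have := (convex_Icc 0 t0).norm_image_sub_le_of_norm_hasDerivWithin_le
        (f := fun y => G y θ) (f' := fun y => Gx y θ)
        (fun z _ => (dx z θ).hasDerivWithinAt) (fun z hz => hMx z hz θ)
        (⟨le_rfl, ht0.le⟩ : (0:ℝ) ∈ Set.Icc 0 t0) hx'
      simp only [h0, sub_zero, Real.norm_eq_abs, abs_of_nonneg hx.1] at this
      have h2 : x ≤ t1 := by have := hx.2; norm_num at this; linarith
      simp only [pow_zero, mul_one]
      calc _ ≤ M * x := this
        _ ≤ M * t1 := by gcongr
        _ = ε := hMt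
    | succ j ih =>
      set q : ℝ := (1 / 2) ^ j with hq
      have hq0 : 0 < q := by positivity
      have hq1 : q ≤ 1 := pow_le_one₀ (by norm_num) (by norm_num)
      have h8 : ((1:ℝ) / 8) ^ j = q ^ 3 := by
        rw [hq, ← pow_mul, mul_comm j 3, pow_mul]; norm_num
      have htj0 : 0 < t1 * (1 + q) / 2 := by positivity
      have htj : t1 * (1 + q) / 2 ≤ t0 := by nlinarith
      intro x hx θ
      rw [pow_succ, ← hq] at hx
      rw [h8] at ih
      rw [pow_succ, h8]
      have hmL : ε * q ^ 3 * (8 * L) ≤ 1 := by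
        have : q ^ 3 ≤ 1 := pow_le_one₀ hq0.le hq1
        have h3 : ε * (8 * L) * q ^ 3 ≤ ε * (8 * L) * 1 := by gcongr
        linarith
      have := step (t1 * (1 + q) / 2) (ε * q ^ 3) htj0 htj (by positivity) hmL
        (fun x hx θ => hineq _ (by positivity) hmL x ⟨hx.1, hx.2.trans htj⟩ θ (ih x hx θ))
        (t1 * (1 + q * (1 / 2)) / 2) (by nlinarith) x hx θ
      refine this.trans ?_
      have e : t1 * (1 + q) / 2 / (t1 * (1 + q) / 2 - t1 * (1 + q * (1 / 2)) / 2)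
          = 2 * (1 + q) / q := by
        have : t1 * (1 + q) / 2 - t1 * (1 + q * (1 / 2)) / 2 = t1 * q / 4 := by ring
        rw [this]; field_simp; norm_num
      rw [e]
      have e2 : C * (ε * q ^ 3) ^ 2 * (2 * (1 + q) / q) ^ 2
          = 4 * C * ε ^ 2 * (1 + q) ^ 2 * q * q ^ 3 := by field_simp; norm_num
      rw [e2]
      have e3 : (1 + q) ^ 2 * q ≤ 4 := by
        have : (1 + q) ^ 2 ≤ 4 := by nlinarith
        nlinarith
      have e4 : 4 * C * ε ^ 2 * (1 + q) ^ 2 * q ≤ ε * (1 / 8) := by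
        calc 4 * C * ε ^ 2 * (1 + q) ^ 2 * q = 4 * C * ε ^ 2 * ((1 + q) ^ 2 * q) := by ring
          _ ≤ 4 * C * ε ^ 2 * 4 := by gcongr
          _ = ε * (ε * (128 * C)) / 8 := by ring
          _ ≤ ε * 1 / 8 := by gcongr
          _ = _ := by ring
      calc _ ≤ ε * (1 / 8) * q ^ 3 := by gcongr
        _ = _ := by ring
  refine ⟨t1 / 2, by positivity, fun x hx θ => ?_⟩
  have hk : ∀ j : ℕ, ‖G x θ‖ ≤ ε * (1 / 8) ^ j := by
    intro j
    refine key j x ⟨hx.1, hx.2.trans ?_⟩ θ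
    have : (0:ℝ) < (1 / 2) ^ j := by positivity
    nlinarith
  have hlim : Tendsto (fun j : ℕ => ε * (1 / 8 : ℝ) ^ j) atTop (𝓝 (ε * 0)) :=
    (tendsto_pow_atTop_nhds_zero_of_lt_one (by norm_num) (by norm_num)).const_mul ε
  have := ge_of_tendsto' hlim hk
  rw [mul_zero] at this
  exact norm_le_zero_iff.1 this


lemma wirt_alg {n : ℕ} (T : ℂ →L[ℝ] EuclideanSpace ℂ (Fin n)) (ζ : ℂ) :
    T ζ + I • T (ζ * I) = (2 : ℂ) • (starRingEnd ℂ ζ) • ((2⁻¹ : ℝ) • (T 1 + I • T I)) ∧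
    I • T (ζ * I) = (starRingEnd ℂ ζ) • ((2⁻¹ : ℝ) • (T 1 + I • T I)) -
      ζ • ((2⁻¹ : ℝ) • (T 1 - I • T I)) := by
  have h1 : T ζ = (ζ.re : ℂ) • T 1 + (ζ.im : ℂ) • T I := by
    have : ζ = ζ.re • (1:ℂ) + ζ.im • I := by
      apply Complex.ext <;> simp
    conv_lhs => rw [this]
    rw [map_add, map_smul, map_smul]
    simp
  have h2 : T (ζ * I) = (-ζ.im : ℂ) • T 1 + (ζ.re : ℂ) • T I := by
    have : ζ * I = (-ζ.im) • (1:ℂ) + ζ.re • I := by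
      apply Complex.ext <;> simp
    rw [this, map_add, map_smul, map_smul]
    ext i; simp
  rw [h1, h2]
  have hc : (starRingEnd ℂ ζ) = (ζ.re : ℂ) - ζ.im * I := by apply Complex.ext <;> simp
  have hz : ζ = (ζ.re : ℂ) + ζ.im * I := by apply Complex.ext <;> simp
  constructor
  · rw [hc]
    ext i
    simp
    linear_combination ((ζ.im : ℂ) * (T I).ofLp i) * I_mul_I
  · rw [hc]
    generalize hp : (ζ.re : ℂ) = p at *
    generalize hq : (ζ.im : ℂ) = q at *
    rw [hz]
    ext i
    simp
    ring

lemma local_ext {n : ℕ} {u : ℂ → EuclideanSpace ℂ (Fin n)} (hu : ContDiff ℝ 1 u)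
    {K : ℝ} (hK : 0 < K) {a : ℂ} {r R : ℝ} (hr : 0 < r) (hrR : r < R)
    (hineq : ∀ z ∈ ball a R, ‖dbar u z‖ ≤ K * ‖u z‖ ^ ((1 : ℝ) / 2) * ‖dz u z‖)
    (hz : ∀ z ∈ ball a r, u z = 0) :
    ∃ r' > r, ∀ z ∈ ball a r', u z = 0 := by
  have huc : Continuous u := hu.continuous
  have hfd : Continuous (fderiv ℝ u) := hu.continuous_fderiv one_ne_zero
  have hud : ∀ z, HasFDerivAt u (fderiv ℝ u z) z :=
    fun z => (hu.differentiable one_ne_zero z).hasFDerivAt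
  set Z : ℝ → ℝ → ℂ := fun x θ => r * Complex.exp (x + θ * I) with hZ
  have hZc : Continuous (fun p : ℝ × ℝ => Z p.1 p.2) := by simp only [hZ]; fun_prop
  have hZn : ∀ x θ, ‖Z x θ‖ = r * Real.exp x := by
    intro x θ
    simp only [hZ, norm_mul, Complex.norm_exp, Complex.norm_real, Real.norm_of_nonneg hr.le]
    simp
  have dZx : ∀ x θ, HasDerivAt (fun y => a + Z y θ) (Z x θ) x := by
    intro x θ
    have h1 : HasDerivAt (fun y : ℝ => (y : ℂ) + θ * I) 1 x := by
      have := (hasDerivAt_id' x).ofReal_comp.add_const (θ * I : ℂ)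
      simpa using this
    have := ((h1.cexp).const_mul (r : ℂ)).const_add a
    refine this.congr_deriv ?_
    simp [hZ]
  have dZθ : ∀ x θ, HasDerivAt (fun y => a + Z x y) (Z x θ * I) θ := by
    intro x θ
    have h1 : HasDerivAt (fun y : ℝ => (x : ℂ) + y * I) I θ := by
      have := ((hasDerivAt_id' θ).ofReal_comp.mul_const I).const_add (x : ℂ)
      simpa using this
    have := ((h1.cexp).const_mul (r : ℂ)).const_add a
    refine this.congr_deriv ?_
    simp only [hZ]; ring
  obtain ⟨t0, ht0, ht1, htR⟩ : ∃ t0 > 0, t0 ≤ 1 ∧ r * Real.exp t0 < R := by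
    have hl : 0 < Real.log (R / r) := Real.log_pos ((one_lt_div hr).2 hrR)
    refine ⟨min 1 (Real.log (R / r) / 2), by positivity, min_le_left _ _, ?_⟩
    have : Real.exp (min 1 (Real.log (R / r) / 2)) < Real.exp (Real.log (R / r)) :=
      Real.exp_lt_exp.2 (lt_of_le_of_lt (min_le_right _ _) (by linarith))
    rw [Real.exp_log (div_pos (hr.trans hrR) hr)] at this
    calc _ < r * (R / r) := by gcongr
      _ = R := by field_simp
  have hZR : ∀ x ∈ Set.Icc 0 t0, ∀ θ, ‖Z x θ‖ < R := by
    intro x hx θ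
    rw [hZn]
    refine lt_of_le_of_lt ?_ htR
    have := Real.exp_le_exp.2 hx.2
    gcongr
  obtain ⟨M1, hM1⟩ := (isCompact_closedBall a R).exists_bound_of_continuousOn hfd.continuousOn
  have hR0 : 0 < R := hr.trans hrR
  have hM10 : 0 ≤ M1 := (norm_nonneg _).trans (hM1 a (mem_closedBall_self hR0.le))
  have hball : ∀ x ∈ Set.Icc 0 t0, ∀ θ, a + Z x θ ∈ ball a R := by
    intro x hx θ
    rw [mem_ball_iff_norm, add_sub_cancel_left]
    exact hZR x hx θ
  have hcl : ∀ z ∈ closedBall a r, u z = 0 := by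
    intro z hzz
    rw [← closure_ball a hr.ne'] at hzz
    have : closure (ball a r) ⊆ {z | u z = 0} :=
      closure_minimal hz (isClosed_eq huc continuous_const)
    exact this hzz
  obtain ⟨s, hs, hzero⟩ := iter_est (G := fun x θ => u (a + Z x θ))
    (Gx := fun x θ => fderiv ℝ u (a + Z x θ) (Z x θ))
    (Gθ := fun x θ => fderiv ℝ u (a + Z x θ) (Z x θ * I))
    (t0 := t0) (M := (M1 + 1) * R) (L := 16 * K ^ 2)
    (by unfold Function.uncurry; fun_prop)
    (by
      unfold Function.uncurry
      exact (hfd.comp (continuous_const.add hZc)).clm_apply hZc)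
    (by
      unfold Function.uncurry
      exact (hfd.comp (continuous_const.add hZc)).clm_apply (hZc.mul continuous_const))
    (fun x θ => (hud _).comp_hasDerivAt x (dZx x θ))
    (fun x θ => (hud _).comp_hasDerivAt θ (dZθ x θ))
    (by
      intro x θ
      have : Z x (θ + 2 * π) = Z x θ := by
        simp only [hZ]
        congr 1
        have : (x : ℂ) + ((θ + 2 * π : ℝ) : ℂ) * I = (x + θ * I) + 2 * π * I := by
          push_cast; ring
        rw [this, Complex.exp_periodic]
      rw [this])
    (by
      intro θ
      apply hcl
      rw [mem_closedBall_iff_norm, add_sub_cancel_left, hZn]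
      simp)
    ht0 ht1 (by positivity) (by positivity)
    (by
      intro x hx θ
      refine (ContinuousLinearMap.le_opNorm _ _).trans ?_
      have h1 := hM1 _ (ball_subset_closedBall (hball x hx θ))
      have h2 := (hZR x hx θ).le
      have h3 : ‖fderiv ℝ u (a + Z x θ)‖ ≤ M1 + 1 := by linarith
      gcongr)
    (by
      intro x hx θ
      refine (ContinuousLinearMap.le_opNorm _ _).trans ?_
      have h1 := hM1 _ (ball_subset_closedBall (hball x hx θ))
      have h2 : ‖Z x θ * I‖ ≤ R := by
        rw [norm_mul, Complex.norm_I, mul_one]; exact (hZR x hx θ).le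
      have h3 : ‖fderiv ℝ u (a + Z x θ)‖ ≤ M1 + 1 := by linarith
      gcongr)
    (by
      intro m hm hmL x hx θ hum
      obtain ⟨e1, e2⟩ := wirt_alg (fderiv ℝ u (a + Z x θ)) (Z x θ)
      have hi := hineq _ (hball x hx θ)
      change _ = (2 : ℂ) • (starRingEnd ℂ (Z x θ)) • dbar u (a + Z x θ) at e1
      change _ = (starRingEnd ℂ (Z x θ)) • dbar u (a + Z x θ) - Z x θ • dz u (a + Z x θ) at e2
      set Q := dbar u (a + Z x θ)
      set P := dz u (a + Z x θ)
      set B := fderiv ℝ u (a + Z x θ) (Z x θ * I)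
      rw [e1]
      have n1 : ‖(2 : ℂ) • (starRingEnd ℂ (Z x θ)) • Q‖ = 2 * (‖Z x θ‖ * ‖Q‖) := by
        rw [norm_smul, norm_smul, RCLike.norm_conj]; simp
      rw [n1]
      have n2 : ‖Z x θ‖ * ‖P‖ ≤ ‖B‖ + ‖Z x θ‖ * ‖Q‖ := by
        have e3 : Z x θ • P = (starRingEnd ℂ (Z x θ)) • Q - I • B := by rw [e2]; abel
        have := norm_sub_le ((starRingEnd ℂ (Z x θ)) • Q) (I • B)
        rw [← e3, norm_smul, norm_smul, norm_smul, RCLike.norm_conj, Complex.norm_I] at this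
        linarith
      have hroot : ‖u (a + Z x θ)‖ ^ ((1:ℝ) / 2) ≤ √m := by
        rw [← Real.sqrt_eq_rpow]
        exact Real.sqrt_le_sqrt hum
      have hc2 : (K * √m) ^ 2 = K ^ 2 * m := by rw [mul_pow, Real.sq_sqrt hm.le]
      have hc0 : 0 ≤ K * √m := by positivity
      have hQ : ‖Q‖ ≤ K * √m * ‖P‖ := by
        refine hi.trans ?_
        gcongr
      generalize K * √m = c at *
      have hc1 : c ≤ 1 / 2 := by nlinarith
      have hzn := norm_nonneg (Z x θ)
      generalize ‖Z x θ‖ = z at *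
      have hP0 := norm_nonneg P
      have hQ1 : z * ‖Q‖ ≤ c * (z * ‖P‖) := by
        have := mul_le_mul_of_nonneg_left hQ hzn
        linarith
      have hzP : 0 ≤ z * ‖P‖ := by positivity
      have hzP2 : z * ‖P‖ ≤ 2 * ‖B‖ := by nlinarith
      have hfin : 2 * (z * ‖Q‖) ≤ 4 * c * ‖B‖ := by nlinarith
      calc (2 * (z * ‖Q‖)) ^ 2 ≤ (4 * c * ‖B‖) ^ 2 := by gcongr
        _ = 16 * c ^ 2 * ‖B‖ ^ 2 := by ring
        _ = 16 * K ^ 2 * m * ‖B‖ ^ 2 := by rw [hc2]; ring)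
  refine ⟨r * Real.exp s, ?_, ?_⟩
  · have : 1 < Real.exp s := Real.one_lt_exp_iff.2 hs
    show r < r * Real.exp s
    nlinarith
  · intro z hzz
    rcases le_or_gt ‖z - a‖ r with h | h
    · exact hcl z (by rw [mem_closedBall_iff_norm]; exact h)
    · have hza : 0 < ‖z - a‖ := hr.trans h
      rw [mem_ball_iff_norm] at hzz
      have := hzero (Real.log (‖z - a‖ / r)) ⟨Real.log_nonneg ((one_le_div hr).2 h.le), ?_⟩
        (Complex.arg (z - a))
      · have e : a + Z (Real.log (‖z - a‖ / r)) (Complex.arg (z - a)) = z := by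
          simp only [hZ]
          rw [Complex.exp_add, ← Complex.ofReal_exp, Real.exp_log (by positivity)]
          have h1 := Complex.norm_mul_exp_arg_mul_I (z - a)
          have h2 : (r : ℂ) ≠ 0 := by exact_mod_cast hr.ne'
          push_cast
          rw [← mul_assoc, mul_div_cancel₀ _ h2, h1]
          ring
        simpa only [e] using this
      · rw [Real.log_le_iff_le_exp (by positivity), div_le_iff₀ hr]
        linarith

lemma disc_ext {n : ℕ} {u : ℂ → EuclideanSpace ℂ (Fin n)} (hu : ContDiff ℝ 1 u)
    {K : ℝ} (hK : 0 < K) {a : ℂ} {r R : ℝ} (hr : 0 < r)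
    (hineq : ∀ z ∈ ball a R, ‖dbar u z‖ ≤ K * ‖u z‖ ^ ((1 : ℝ) / 2) * ‖dz u z‖)
    (hz : ∀ z ∈ ball a r, u z = 0) :
    ∀ z ∈ ball a R, u z = 0 := by
  by_contra hcon
  set S : Set ℝ := {ρ | ∀ z ∈ ball a ρ, u z = 0} with hS
  have hRS : R ∉ S := hcon
  have hdown : ∀ ρ ∈ S, ∀ ρ' ≤ ρ, ρ' ∈ S := fun ρ hρ ρ' h z hzz => hρ z (ball_subset_ball h hzz)
  have hub : ∀ ρ ∈ S, ρ ≤ R := by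
    intro ρ hρ
    by_contra h
    exact hRS (hdown ρ hρ R (not_le.1 h).le)
  have hbdd : BddAbove S := ⟨R, hub⟩
  have hne : S.Nonempty := ⟨r, hz⟩
  have hsup : sSup S ∈ S := by
    intro z hzz
    obtain ⟨ρ, hρ, hlt⟩ := exists_lt_of_lt_csSup hne (mem_ball.1 hzz)
    exact hρ z (mem_ball.2 hlt)
  have hlt : sSup S < R := lt_of_le_of_ne (hub _ hsup) fun h => hRS (h ▸ hsup)
  have hpos : 0 < sSup S := hr.trans_le (le_csSup hbdd hz)
  obtain ⟨r', hr', h⟩ := local_ext hu hK hpos hlt hineq hsup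
  exact absurd (le_csSup hbdd h) (not_le.2 hr')


/-- If a `C¹` map `u : D → ℂⁿ` satisfies
`‖∂u/∂z̄‖ ≤ K·‖u‖^{1/2}·‖∂u/∂z‖` on `D` and vanishes on a nonempty open subset
of `D`, then `u ≡ 0` on `D`. -/
theorem uniqueness_sqrt_inequality (n : ℕ)
    (u : ℂ → EuclideanSpace ℂ (Fin n))
    (hu : ContDiffOn ℝ 1 u (ball (0 : ℂ) 1))
    (K : ℝ) (hK : 0 < K)
    (hineq : ∀ z ∈ ball (0 : ℂ) 1,
      ‖dbar u z‖ ≤ K * ‖u z‖ ^ ((1 : ℝ) / 2) * ‖dz u z‖)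
    (V : Set ℂ) (hVopen : IsOpen V) (hVne : V.Nonempty)
    (hVD : V ⊆ ball (0 : ℂ) 1) (hUV : ∀ z ∈ V, u z = 0) :
    ∀ z ∈ ball (0 : ℂ) 1, u z = 0 := by
  have hsub : ball (0:ℂ) 1 ⊆ interior {z | u z = 0} := by
    apply (convex_ball (0:ℂ) 1).isPreconnected.subset_of_closure_inter_subset isOpen_interior
    · obtain ⟨v, hv⟩ := hVne
      exact ⟨v, hVD hv, interior_maximal hUV hVopen hv⟩
    · rintro z0 ⟨hz0, hz1⟩
      rw [mem_ball_zero_iff] at hz1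
      set d := 1 - ‖z0‖ with hd
      have hd0 : 0 < d := by linarith
      have hd1 : d ≤ 1 := by linarith [norm_nonneg z0]
      obtain ⟨a, ha, haz⟩ := Metric.mem_closure_iff.1 hz0 (d / 4) (by positivity)
      obtain ⟨r, hr, hra⟩ := Metric.mem_nhds_iff.1 (mem_interior_iff_mem_nhds.1 ha)
      let χ : ContDiffBump (0:ℂ) := ⟨1 - d / 4, 1 - d / 8, by linarith, by linarith⟩
      have hin : ball a (d / 2) ⊆ ball (0:ℂ) (1 - d / 4) := by
        intro z hz
        rw [mem_ball] at *
        have h1 := dist_triangle z a 0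
        have h2 := dist_triangle a z0 0
        rw [dist_comm a z0] at h2
        simp only [dist_zero_right] at h1 h2 ⊢
        linarith
      have hw : ContDiff ℝ 1 (fun z => χ z • u z) := by
        rw [contDiff_iff_contDiffAt]
        intro z
        by_cases hz : z ∈ ball (0:ℂ) 1
        · exact χ.contDiff.contDiffAt.smul (hu.contDiffAt (isOpen_ball.mem_nhds hz))
        · have hnear : (fun z => χ z • u z) =ᶠ[𝓝 z] fun _ => 0 := by
            have hmem : (closedBall (0:ℂ) (1 - d / 8))ᶜ ∈ 𝓝 z := by
              apply isClosed_closedBall.isOpen_compl.mem_nhds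
              simp only [mem_ball, not_lt] at hz
              simp only [Set.mem_compl_iff, mem_closedBall, not_le]
              linarith
            filter_upwards [hmem] with y hy
            have : χ y = 0 := by
              apply χ.zero_of_le_dist
              simp only [Set.mem_compl_iff, mem_closedBall, not_le] at hy
              exact hy.le
            rw [this, zero_smul]
          exact contDiffAt_const.congr_of_eventuallyEq hnear
      have hone : ∀ y ∈ ball (0:ℂ) (1 - d / 4), χ y • u y = u y := by
        intro y hy
        rw [χ.one_of_mem_closedBall (ball_subset_closedBall hy), one_smul]
      have heq : ∀ z ∈ ball a (d / 2), (fun z => χ z • u z) =ᶠ[𝓝 z] u := by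
        intro z hz
        filter_upwards [isOpen_ball.mem_nhds (hin hz)] with y hy using hone y hy
      have hall := disc_ext hw hK (a := a) (r := min r (d / 2)) (R := d / 2) (by positivity)
        (by
          intro z hz
          have e1 := (heq z hz).fderiv_eq (𝕜 := ℝ)
          have e2 : dbar (fun z => χ z • u z) z = dbar u z := by unfold dbar; rw [e1]
          have e3 : dz (fun z => χ z • u z) z = dz u z := by unfold dz; rw [e1]
          rw [e2, e3, hone z (hin hz)]
          exact hineq z (ball_subset_ball (by linarith) (hin hz)))
        (by
          intro z hz
          have : u z = 0 := hra (ball_subset_ball (min_le_left _ _) hz)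
          simp only [this, smul_zero])
      have hz0a : z0 ∈ ball a (d / 2) := mem_ball.2 (by linarith)
      have hsb : ball a (d / 2) ⊆ {z | u z = 0} := by
        intro z hz
        have h5 := hall z hz
        have h6 := hone z (hin hz)
        exact h6.symm.trans h5
      exact interior_maximal hsb isOpen_ball hz0a
  intro z hz
  have h : z ∈ {z | u z = 0} := interior_subset (hsub hz)
  exact h
end

section
/- Let v : ℂ → ℂⁿ be a C¹ map with compact support contained in D, and let τ ≥ 1. Then ∫_D ‖∂v/∂z̄‖² e^{τφ} dA ≥ (1/(10τ)) ∫_D ‖∂v/∂z‖² e^{τφ} dA + (τ/20) ∫_D ‖v‖² e^{τφ} dA, where dA is Lebesgue measure on ℂ. -/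
open Complex MeasureTheory Metric Filter Asymptotics Topology

/-- The weight `φ(x+iy) = x + x²/2`. -/
noncomputable def phi (z : ℂ) : ℝ := z.re + z.re ^ 2 / 2


lemma aux_int (f : ℂ → ℝ) (hf : Continuous f) (h : HasCompactSupport f) : Integrable f :=
  hf.integrable_of_hasCompactSupport h

lemma aux_ld {f : ℂ → ℝ} (hf : ContDiff ℝ 1 f) (x b : ℂ) :
    lineDeriv ℝ f x b = fderiv ℝ f x b :=
  ((hf.differentiable (by simp)) x).lineDeriv_eq_fderiv

lemma aux_cf {f : ℂ → ℝ} (hf : ContDiff ℝ 1 f) (b : ℂ) :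
    Continuous (fun x => fderiv ℝ f x b) :=
  (hf.continuous_fderiv (by simp)).clm_apply continuous_const

lemma aux_ibp {f g : ℂ → ℝ} (hf : ContDiff ℝ 1 f) (hg : ContDiff ℝ 1 g)
    (cf : HasCompactSupport f) (cg : HasCompactSupport g) (b : ℂ) :
    ∫ x, f x * fderiv ℝ g x b = - ∫ x, fderiv ℝ f x b * g x := by
  obtain ⟨C, hC⟩ := hf.lipschitzWith_of_hasCompactSupport cf (by simp)
  obtain ⟨D, hD⟩ := hg.lipschitzWith_of_hasCompactSupport cg (by simp)
  have := hC.integral_lineDeriv_mul_eq (μ := volume) hD cg b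
  simp only [aux_ld hf, aux_ld hg, map_neg, neg_mul, integral_neg] at this
  rw [this, neg_neg]
  simp only [mul_comm]

lemma aux_zero {f : ℂ → ℝ} (hf : ContDiff ℝ 1 f) (cf : HasCompactSupport f) (b : ℂ) :
    ∫ x, fderiv ℝ f x b = 0 := by
  obtain ⟨C, hC⟩ := hf.lipschitzWith_of_hasCompactSupport cf (by simp)
  have h1 : LipschitzWith 0 (fun _ : ℂ => (1 : ℝ)) := LipschitzWith.const 1
  have := h1.integral_lineDeriv_mul_eq (μ := volume) hC cf b
  simp only [aux_ld hf, aux_ld contDiff_const, map_neg, neg_mul, integral_neg] at this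
  simp at this
  exact this

lemma aux_swap {f g : ℂ → ℝ} (hf : ContDiff ℝ 1 f) (hg : ContDiff ℝ 1 g)
    (cf : HasCompactSupport f) (cg : HasCompactSupport g) (a b : ℂ) :
    ∫ x, fderiv ℝ f x a * fderiv ℝ g x b = ∫ x, fderiv ℝ g x a * fderiv ℝ f x b := by
  obtain ⟨C, hC⟩ := hf.lipschitzWith_of_hasCompactSupport cf (by simp)
  obtain ⟨D, hD⟩ := hg.lipschitzWith_of_hasCompactSupport cg (by simp)
  have A := hC.integral_inv_smul_sub_mul_tendsto_integral_lineDeriv_mul (μ := volume)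
    (g := fun x => fderiv ℝ g x b) (aux_int _ (aux_cf hg b) (cg.fderiv_apply ℝ b)) a
  have B := (hD.integral_inv_smul_sub_mul_tendsto_integral_lineDeriv_mul (μ := volume)
    (g := fun x => fderiv ℝ f x b) (aux_int _ (aux_cf hf b) (cf.fderiv_apply ℝ b)) (-a)).neg
  have S : ∀ t : ℝ, ∫ x, (t⁻¹ • (f (x + t • a) - f x)) * fderiv ℝ g x b
      = - ∫ x, (t⁻¹ • (g (x + t • (-a)) - g x)) * fderiv ℝ f x b := by
    intro t
    set s : ℂ := t • (-a) with hs
    have hsa : ∀ x : ℂ, x + s + t • a = x := by intro x; rw [hs]; simp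
    have hgs : ContDiff ℝ 1 (fun x => g (x + s)) := hg.comp (contDiff_id.add contDiff_const)
    have cgs : HasCompactSupport (fun x => g (x + s)) :=
      cg.comp_homeomorph (Homeomorph.addRight s)
    have S3 : ∫ x, f (x + t • a) * fderiv ℝ g x b = - ∫ x, g (x + s) * fderiv ℝ f x b := by
      rw [← integral_add_right_eq_self _ s]
      simp only [hsa]
      have := aux_ibp hf hgs cf cgs b
      simp only [fderiv_comp_add_right] at this
      rw [this]
      simp only [mul_comm]
    have S4 : ∫ x, f x * fderiv ℝ g x b = - ∫ x, g x * fderiv ℝ f x b := by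
      rw [aux_ibp hf hg cf cg b]; simp only [mul_comm]
    simp only [smul_eq_mul, mul_assoc, integral_const_mul]
    simp_rw [sub_mul]
    rw [integral_sub, integral_sub, S3, S4]
    · ring
    · exact aux_int _ (hgs.continuous.mul (aux_cf hf b)) cgs.mul_right
    · exact aux_int _ (hg.continuous.mul (aux_cf hf b)) cg.mul_right
    · refine aux_int _ ((hf.continuous.comp (continuous_add_const _)).mul (aux_cf hg b)) ?_
      exact (cg.fderiv_apply ℝ b).mul_left
    · exact aux_int _ (hf.continuous.mul (aux_cf hg b)) cf.mul_right
  simp only [S] at A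
  have := tendsto_nhds_unique A B
  simp only [aux_ld hf, aux_ld hg, map_neg, neg_mul, integral_neg, neg_neg] at this
  exact this

lemma aux_phi (τ : ℝ) (z _h : ℂ) :
    HasFDerivAt (fun z : ℂ => τ * phi z) ((τ * (1 + z.re)) • reCLM) z := by
  have h1 : HasFDerivAt (fun z : ℂ => z.re) reCLM z := reCLM.hasFDerivAt
  have := (h1.add ((h1.pow 2).mul_const (2⁻¹ : ℝ))).const_mul τ
  refine (this.congr_fderiv ?_).congr_of_eventuallyEq ?_
  · ext; simp; ring
  · filter_upwards with z
    simp [phi, div_eq_mul_inv]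

lemma aux_phiC (τ : ℝ) : ContDiff ℝ 1 (fun z : ℂ => τ * phi z) := by
  unfold phi
  have : ContDiff ℝ 1 (fun z : ℂ => z.re) := reCLM.contDiff
  fun_prop

/-- the null Lagrangian -/
noncomputable def GG (τ : ℝ) (p q : ℂ → ℝ) (z : ℂ) : ℝ :=
  Real.exp (τ * phi z) * ((fderiv ℝ q z 1 * fderiv ℝ p z I - fderiv ℝ p z 1 * fderiv ℝ q z I)
    + τ * (1 + z.re) / 2 * (q z * fderiv ℝ p z I - p z * fderiv ℝ q z I)
    - (1 / 4) * ((τ + (τ * (1 + z.re)) ^ 2) * (p z ^ 2 + q z ^ 2)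
      + 2 * (τ * (1 + z.re)) * (p z * fderiv ℝ p z 1 + q z * fderiv ℝ q z 1)))

lemma aux_GG (τ : ℝ) {p q : ℂ → ℝ} (hp : ContDiff ℝ 1 p) (hq : ContDiff ℝ 1 q)
    (cp : HasCompactSupport p) (cq : HasCompactSupport q) :
    Integrable (GG τ p q) ∧ ∫ z, GG τ p q z = 0 := by
  set F : ℂ → ℝ := fun z => Real.exp (τ / 2 * phi z) with hF
  have FC : ContDiff ℝ 1 F := (aux_phiC (τ / 2)).exp
  have FD : ∀ z h, HasFDerivAt F (F z • ((τ / 2 * (1 + z.re)) • reCLM)) z := fun z h =>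
    (aux_phi (τ / 2) z h).exp
  have F2 : ∀ z, Real.exp (τ * phi z) = F z ^ 2 := by
    intro z; rw [hF, ← Real.exp_nat_mul]; congr 1; push_cast; ring
  set P : ℂ → ℝ := fun z => F z * p z with hP
  set Q : ℂ → ℝ := fun z => F z * q z with hQ
  set R : ℂ → ℝ := fun z => (τ * (1 + z.re)) * (P z ^ 2 + Q z ^ 2) with hR
  have PC : ContDiff ℝ 1 P := FC.mul hp
  have QC : ContDiff ℝ 1 Q := FC.mul hq
  have cP : HasCompactSupport P := cp.mul_left
  have cQ : HasCompactSupport Q := cq.mul_left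
  have reC : ContDiff ℝ 1 (fun z : ℂ => z.re) := reCLM.contDiff
  have RC : ContDiff ℝ 1 R := by rw [hR]; fun_prop
  have cR : HasCompactSupport R := by
    have h1 : HasCompactSupport (fun z => P z ^ 2) := by
      simp only [sq]; exact cP.mul_left
    have h2 : HasCompactSupport (fun z => Q z ^ 2) := by
      simp only [sq]; exact cQ.mul_left
    exact (h1.add h2).mul_left
  have dP : ∀ z, HasFDerivAt P (F z • fderiv ℝ p z + p z • (F z • ((τ / 2 * (1 + z.re)) • reCLM))) z :=
    fun z => (FD z 0).mul ((hp.differentiable (by simp)) z).hasFDerivAt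
  have dQ : ∀ z, HasFDerivAt Q (F z • fderiv ℝ q z + q z • (F z • ((τ / 2 * (1 + z.re)) • reCLM))) z :=
    fun z => (FD z 0).mul ((hq.differentiable (by simp)) z).hasFDerivAt
  have dR : ∀ z, fderiv ℝ R z 1 = τ * (P z ^ 2 + Q z ^ 2)
      + (τ * (1 + z.re)) * (2 * P z * fderiv ℝ P z 1 + 2 * Q z * fderiv ℝ Q z 1) := by
    intro z
    have h1 : HasFDerivAt (fun z : ℂ => z.re) reCLM z := reCLM.hasFDerivAt
    have hPz := ((PC.differentiable (by simp)) z).hasFDerivAt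
    have hQz := ((QC.differentiable (by simp)) z).hasFDerivAt
    have := ((h1.const_add 1).const_mul τ).mul ((hPz.pow 2).add (hQz.pow 2))
    have h2 : fderiv ℝ R z = _ := this.fderiv
    rw [h2]
    simp
    ring
  have key : GG τ p q = fun z => (fderiv ℝ Q z 1 * fderiv ℝ P z I
      - fderiv ℝ P z 1 * fderiv ℝ Q z I) - (1 / 4) * fderiv ℝ R z 1 := by
    funext z
    rw [dR, (dP z).fderiv, (dQ z).fderiv, GG, F2]
    simp [hP, hQ]
    ring
  have i1 : Integrable (fun z => fderiv ℝ Q z 1 * fderiv ℝ P z I) :=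
    aux_int _ ((aux_cf QC 1).mul (aux_cf PC I)) (cQ.fderiv_apply ℝ 1).mul_right
  have i2 : Integrable (fun z => fderiv ℝ P z 1 * fderiv ℝ Q z I) :=
    aux_int _ ((aux_cf PC 1).mul (aux_cf QC I)) (cP.fderiv_apply ℝ 1).mul_right
  have i3 : Integrable (fun z => (1 / 4) * fderiv ℝ R z 1) :=
    (aux_int _ (aux_cf RC 1) (cR.fderiv_apply ℝ 1)).const_mul _
  rw [key]
  refine ⟨(i1.sub i2).sub i3, ?_⟩
  have i12 : Integrable (fun z => fderiv ℝ Q z 1 * fderiv ℝ P z I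
      - fderiv ℝ P z 1 * fderiv ℝ Q z I) := i1.sub i2
  beta_reduce
  rw [integral_sub i12 i3, integral_sub i1 i2, integral_const_mul, aux_zero RC cR,
    aux_swap QC PC cQ cP]
  simp

lemma aux_pt (τ x : ℝ) (hτ : 1 ≤ τ) (hx : |x| < 1) (w p q px py qx qy : ℝ) (hw : 0 ≤ w) :
    (1 / (10 * τ)) * (((px + qy) ^ 2 + (qx - py) ^ 2) / 4 * w) + τ / 20 * ((p ^ 2 + q ^ 2) * w)
    + w * ((qx * py - px * qy) + τ * (1 + x) / 2 * (q * py - p * qy)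
    - (1 / 4) * ((τ + (τ * (1 + x)) ^ 2) * (p ^ 2 + q ^ 2)
      + 2 * (τ * (1 + x)) * (p * px + q * qx)))
    ≤ ((px - qy) ^ 2 + (py + qx) ^ 2) / 4 * w := by
  have h0 : 0 < τ := by linarith
  obtain ⟨hx1, hx2⟩ := abs_lt.1 hx
  set m := (1 + x) / 2 with hm
  have hm0 : 0 ≤ m := by rw [hm]; linarith
  have hm1 : m ≤ 1 := by rw [hm]; linarith
  have hxm : 1 + x = 2 * m := by rw [hm]; ring
  rw [hxm]
  -- c = ∂v components, d = δv components
  set c1 := (px + qy) / 2 with hc1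
  set c2 := (qx - py) / 2 with hc2
  have e : ∀ c s : ℝ, (1 / (10 * τ)) * c ^ 2 ≤ (c + τ * m * s) ^ 2 + τ / 5 * s ^ 2 := by
    intro c s
    rw [div_mul_eq_mul_div, one_mul, div_le_iff₀ (by positivity)]
    have hmm : m ^ 2 ≤ 1 := by nlinarith
    have k1 : c ^ 2 ≤ 2 * (c + τ * m * s) ^ 2 + 2 * (τ * m * s) ^ 2 := by
      nlinarith [sq_nonneg (c + 2 * (τ * m * s))]
    have k2 : (τ * m * s) ^ 2 ≤ τ ^ 2 * s ^ 2 := by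
      have : (τ * m * s) ^ 2 = m ^ 2 * (τ ^ 2 * s ^ 2) := by ring
      rw [this]; exact mul_le_of_le_one_left (by positivity) hmm
    have k3 : (c + τ * m * s) ^ 2 ≤ τ * (c + τ * m * s) ^ 2 :=
      le_mul_of_one_le_left (sq_nonneg _) hτ
    nlinarith [sq_nonneg (c + τ * m * s)]
  have e1 := e c1 p
  have e2 := e c2 q
  have E := mul_le_mul_of_nonneg_right (add_le_add e1 e2) hw
  have : px = 2 * c1 - qy := by rw [hc1]; ring
  have : py = qx - 2 * c2 := by rw [hc2]; ring
  clear_value c1 c2 m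
  subst px py
  generalize 1 / (10 * τ) = k at *
  nlinarith [E]

lemma aux_comp {n : ℕ} {v : ℂ → EuclideanSpace ℂ (Fin n)} (hv : ContDiff ℝ 1 v) (j : Fin n) :
    ContDiff ℝ 1 (fun z => (v z j).re) ∧ ContDiff ℝ 1 (fun z => (v z j).im) ∧
    (∀ z h, fderiv ℝ (fun z => (v z j).re) z h = (fderiv ℝ v z h j).re) ∧
    (∀ z h, fderiv ℝ (fun z => (v z j).im) z h = (fderiv ℝ v z h j).im) := by
  let L : EuclideanSpace ℂ (Fin n) →L[ℝ] ℂ :=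
    (EuclideanSpace.proj (𝕜 := ℂ) j : EuclideanSpace ℂ (Fin n) →L[ℂ] ℂ).restrictScalars ℝ
  have hL : ∀ x, L x = x j := fun x => rfl
  have d := fun z => ((hv.differentiable (by simp)) z).hasFDerivAt
  refine ⟨(reCLM.comp L).contDiff.comp hv, (imCLM.comp L).contDiff.comp hv, ?_, ?_⟩
  · intro z h
    have := ((reCLM.comp L).hasFDerivAt.comp z (d z)).fderiv
    exact congrArg (fun T => T h) this
  · intro z h
    have := ((imCLM.comp L).hasFDerivAt.comp z (d z)).fderiv
    exact congrArg (fun T => T h) this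

theorem carleman_estimate (n : ℕ) (v : ℂ → EuclideanSpace ℂ (Fin n))
    (hv : ContDiff ℝ 1 v) (hsupp : HasCompactSupport v)
    (hsub : tsupport v ⊆ ball (0 : ℂ) 1) (τ : ℝ) (hτ : 1 ≤ τ) :
    (1 / (10 * τ)) * (∫ z in ball (0 : ℂ) 1, ‖dz v z‖ ^ 2 * Real.exp (τ * phi z))
      + (τ / 20) * (∫ z in ball (0 : ℂ) 1, ‖v z‖ ^ 2 * Real.exp (τ * phi z))
      ≤ ∫ z in ball (0 : ℂ) 1, ‖dbar v z‖ ^ 2 * Real.exp (τ * phi z) := by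
  let p : Fin n → ℂ → ℝ := fun j z => (v z j).re
  let q : Fin n → ℂ → ℝ := fun j z => (v z j).im
  have cp : ∀ j, HasCompactSupport (p j) := fun j =>
    hsupp.comp_left (g := fun x : EuclideanSpace ℂ (Fin n) => (x j).re) (by simp)
  have cq : ∀ j, HasCompactSupport (q j) := fun j =>
    hsupp.comp_left (g := fun x : EuclideanSpace ℂ (Fin n) => (x j).im) (by simp)
  have hGG := fun j => aux_GG τ (aux_comp hv j).1 (aux_comp hv j).2.1 (cp j) (cq j)
  let G : ℂ → ℝ := fun z => ∑ j, GG τ (p j) (q j) z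
  have iG : Integrable G := integrable_finsetSum _ fun j _ => (hGG j).1
  have zG : ∫ z, G z = 0 := by
    rw [integral_finsetSum _ fun j _ => (hGG j).1]
    exact Finset.sum_eq_zero fun j _ => (hGG j).2
  have out : ∀ z, z ∉ ball (0 : ℂ) 1 → v z = 0 ∧ fderiv ℝ v z = 0 := by
    intro z hz
    have : z ∉ tsupport v := fun h => hz (hsub h)
    exact ⟨image_eq_zero_of_notMem_tsupport this, fderiv_of_notMem_tsupport ℝ this⟩
  have zG' : ∫ z in ball (0 : ℂ) 1, G z = 0 := by
    rw [setIntegral_eq_integral_of_forall_compl_eq_zero, zG]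
    intro z hz
    obtain ⟨h1, h2⟩ := out z hz
    refine Finset.sum_eq_zero fun j _ => ?_
    have hp := (aux_comp hv j).2.2.1 z
    have hq := (aux_comp hv j).2.2.2 z
    simp only [GG, p, q, hp, hq, h1, h2]
    simp
  have wC : Continuous (fun z => Real.exp (τ * phi z)) :=
    Real.continuous_exp.comp (aux_phiC τ).continuous
  have fC : ∀ b, Continuous (fun x => fderiv ℝ v x b) := fun b =>
    (hv.continuous_fderiv (by simp)).clm_apply continuous_const
  have I0 : ∀ u : ℂ → EuclideanSpace ℂ (Fin n), Continuous u → HasCompactSupport u →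
      IntegrableOn (fun z => ‖u z‖ ^ 2 * Real.exp (τ * phi z)) (ball (0 : ℂ) 1) := by
    intro u hu cu
    refine (aux_int _ ((hu.norm.pow 2).mul wC) ?_).integrableOn
    refine cu.mono fun z hz => ?_
    intro h
    exact hz (by simp [h])
  have C1 : Continuous (dz v) := by
    unfold dz
    exact ((fC 1).sub ((fC I).const_smul I)).const_smul (2⁻¹ : ℝ)
  have C2 : Continuous (dbar v) := by
    unfold dbar
    exact ((fC 1).add ((fC I).const_smul I)).const_smul (2⁻¹ : ℝ)
  have S1 : HasCompactSupport (dz v) := by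
    refine hsupp.mono' fun z hz => ?_
    by_contra h
    exact hz (by simp [dz, fderiv_of_notMem_tsupport ℝ h])
  have S2 : HasCompactSupport (dbar v) := by
    refine hsupp.mono' fun z hz => ?_
    by_contra h
    exact hz (by simp [dbar, fderiv_of_notMem_tsupport ℝ h])
  have I1 := I0 (dz v) C1 S1
  have I2 := I0 (dbar v) C2 S2
  have I3 := I0 v hv.continuous hsupp
  have iG' : IntegrableOn G (ball (0 : ℂ) 1) := iG.integrableOn
  have J1 := I1.const_mul (1 / (10 * τ))
  have J3 := I3.const_mul (τ / 20)
  have J := J1.add J3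
  have K := J.add iG'
  have main := setIntegral_mono_on K I2 measurableSet_ball ?_
  · have s1 := integral_add J iG'
    have s2 := integral_add J1 J3
    rw [integral_const_mul, integral_const_mul] at s2
    rw [zG', add_zero] at s1
    calc _ = _ := s2.symm
      _ = _ := s1.symm
      _ ≤ _ := main
  intro z hz
  have hx : |z.re| < 1 := (abs_re_le_norm z).trans_lt (by simpa using hz)
  simp only [Pi.add_apply, G, EuclideanSpace.norm_sq_eq, Finset.sum_mul, Finset.mul_sum,
    ← Finset.sum_add_distrib]
  refine Finset.sum_le_sum fun j _ => ?_
  have := aux_pt τ z.re hτ hx (Real.exp (τ * phi z)) (p j z) (q j z)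
    (fderiv ℝ (p j) z 1) (fderiv ℝ (p j) z I) (fderiv ℝ (q j) z 1) (fderiv ℝ (q j) z I)
    (Real.exp_pos _).le
  have hp := (aux_comp hv j).2.2.1 z
  have hq := (aux_comp hv j).2.2.2 z
  have e1 : ‖dz v z j‖ ^ 2 = ((fderiv ℝ (p j) z 1 + fderiv ℝ (q j) z I) ^ 2
      + (fderiv ℝ (q j) z 1 - fderiv ℝ (p j) z I) ^ 2) / 4 := by
    simp only [p, q, hp, hq, ← normSq_eq_norm_sq, normSq_apply, dz]
    simp
    ring
  have e2 : ‖dbar v z j‖ ^ 2 = ((fderiv ℝ (p j) z 1 - fderiv ℝ (q j) z I) ^ 2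
      + (fderiv ℝ (p j) z I + fderiv ℝ (q j) z 1) ^ 2) / 4 := by
    simp only [p, q, hp, hq, ← normSq_eq_norm_sq, normSq_apply, dbar]
    simp
    ring
  have e3 : ‖v z j‖ ^ 2 = p j z ^ 2 + q j z ^ 2 := by
    simp only [p, q, ← normSq_eq_norm_sq, normSq_apply]
    ring
  rw [e1, e2, e3]
  exact this
end
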